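/- arXiv:1811.06566 — 3 statements merged into one kernel-verified Lean document; each statement's English description precedes it below -/
import Mathlib

section
/- Let W be irreducible and let g ∈ W be a regular element of order d, with reflection length l_R(g). Then the number of reduced reflection factorizations of g, i.e. Fact_{W,g}(l_R(g)) := #{(t_1, …, t_{l_R(g)}) ∈ R^{l_R(g)} : t_1⋯t_{l_R(g)} = g}, is an integer multiple of d^{l_R(g)} · (l_R(g))! / |W|; that is, there exists a nonnegative integer m with |W| · Fact_{W,g}(l_R(g)) = m · d^{l_R(g)} · (l_R(g))!. -/
open scoped BigOperators

noncomputable section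

/-- `χ` is an irreducible complex character of the group `G`. -/
def IsIrredChar (G : Type*) [Group G] (χ : G → ℂ) : Prop :=
  ∃ (n : ℕ) (ρ : Representation ℂ G (Fin n → ℂ)),
    0 < n ∧
    (∀ U : Submodule ℂ (Fin n → ℂ), (∀ g : G, U.map (ρ g) ≤ U) → U = ⊥ ∨ U = ⊤) ∧
    ∀ g : G, χ g = LinearMap.trace ℂ (Fin n → ℂ) (ρ g)

variable {V : Type*} [AddCommGroup V] [Module ℂ V]

/-- The fixed space `ker (w - id)` of an invertible linear map `w`. -/
def fixedSpace (w : (V →ₗ[ℂ] V)ˣ) : Submodule ℂ V :=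
  LinearMap.ker ((w : V →ₗ[ℂ] V) - LinearMap.id)

/-- `w` is a reflection: its fixed space is a hyperplane (codimension 1). -/
def IsReflection (w : (V →ₗ[ℂ] V)ˣ) : Prop :=
  Module.finrank ℂ V = Module.finrank ℂ (fixedSpace w) + 1

/-- The linear map underlying an element of `W`. -/
def toLin (W : Subgroup (V →ₗ[ℂ] V)ˣ) (w : W) : V →ₗ[ℂ] V :=
  ((w : (V →ₗ[ℂ] V)ˣ) : V →ₗ[ℂ] V)

/-- The set of reflections of `W`. -/
def refls (W : Subgroup (V →ₗ[ℂ] V)ˣ) : Set W :=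
  {t | IsReflection (t : (V →ₗ[ℂ] V)ˣ)}

/-- The arrangement of reflecting hyperplanes of `W`. -/
def arrangement (W : Subgroup (V →ₗ[ℂ] V)ˣ) : Set (Submodule ℂ V) :=
  {H | ∃ t : W, t ∈ refls W ∧ H = fixedSpace (t : (V →ₗ[ℂ] V)ˣ)}

/-- The pointwise stabilizer of a subspace `H` in `W`. -/
def ptStab (W : Subgroup (V →ₗ[ℂ] V)ˣ) (H : Submodule ℂ V) : Set W :=
  {w | ∀ v ∈ H, toLin W w v = v}

/-- The `W`-orbit of a hyperplane `H`. -/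
def orbitOf (W : Subgroup (V →ₗ[ℂ] V)ˣ) (H : Submodule ℂ V) : Set (Submodule ℂ V) :=
  {H' | ∃ w : W, H' = H.map (toLin W w)}

/-- The reflections of `W` whose hyperplane lies in the orbit of `H`. -/
def Cref (W : Subgroup (V →ₗ[ℂ] V)ˣ) (H : Submodule ℂ V) : Set W :=
  {t | t ∈ refls W ∧ fixedSpace (t : (V →ₗ[ℂ] V)ˣ) ∈ orbitOf W H}

/-- `g ∈ W` is a regular element of order `d`: it has a nonzero eigenvector,
with eigenvalue a primitive `d`-th root of unity, lying on no reflecting hyperplane. -/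
def IsRegularElt (W : Subgroup (V →ₗ[ℂ] V)ˣ) (g : W) (d : ℕ) : Prop :=
  orderOf g = d ∧ ∃ (ζ : ℂ) (v : V), v ≠ 0 ∧ IsPrimitiveRoot ζ d ∧
    toLin W g v = ζ • v ∧ ∀ H ∈ arrangement W, v ∉ H

/-- The action of `W` on `V` is irreducible. -/
def IsIrredAction (W : Subgroup (V →ₗ[ℂ] V)ˣ) : Prop :=
  ∀ U : Submodule ℂ V, (∀ w : W, U.map (toLin W w) ≤ U) → U = ⊥ ∨ U = ⊤

/-- `f` is a length-`l` reflection factorization of `g`. -/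
def IsReflFac (W : Subgroup (V →ₗ[ℂ] V)ˣ) (g : W) (l : ℕ) (f : Fin l → W) : Prop :=
  (∀ i, f i ∈ refls W) ∧ (List.ofFn f).prod = g

/-- `l` is the reflection length of `g`: the minimal length of a reflection
factorization of `g`. -/
def IsReflLength (W : Subgroup (V →ₗ[ℂ] V)ˣ) (g : W) (l : ℕ) : Prop :=
  (∃ f : Fin l → W, IsReflFac W g l f) ∧
    ∀ (k : ℕ) (f : Fin k → W), IsReflFac W g k f → l ≤ k

open Classical in
/-- `n` is the minimal number of factors whose hyperplane lies in the orbit `C`,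
over all reflection factorizations of `g` (of any length). -/
def IsMinOrbitCount (W : Subgroup (V →ₗ[ℂ] V)ˣ) (g : W)
    (C : Set (Submodule ℂ V)) (n : ℕ) : Prop :=
  (∃ (N : ℕ) (f : Fin N → W), IsReflFac W g N f ∧
      (Finset.univ.filter fun i => fixedSpace (f i : (V →ₗ[ℂ] V)ˣ) ∈ C).card = n) ∧
  ∀ (N : ℕ) (f : Fin N → W), IsReflFac W g N f →
      n ≤ (Finset.univ.filter fun i => fixedSpace (f i : (V →ₗ[ℂ] V)ˣ) ∈ C).card

set_option linter.unusedSectionVars false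
set_option linter.unusedSimpArgs false
section Part1

open MvPolynomial in
/-- the polynomial of a linear form -/
def linP {ι : Type*} [Fintype ι] [DecidableEq ι] (l : (ι → ℂ) →ₗ[ℂ] ℂ) : MvPolynomial ι ℂ :=
  ∑ i, C (l (Pi.single i 1)) * X i

open MvPolynomial in
/-- directional derivative -/
def ddP {ι : Type*} (y : ι → ℂ) : Derivation ℂ (MvPolynomial ι ℂ) (MvPolynomial ι ℂ) :=
  mkDerivation ℂ (fun i => C (y i))

open MvPolynomial in
/-- precomposition with a linear map -/
def actP {ι : Type*} [Fintype ι] [DecidableEq ι] (M : Module.End ℂ (ι → ℂ)) :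
    MvPolynomial ι ℂ →ₐ[ℂ] MvPolynomial ι ℂ :=
  aeval (fun i => linP ((LinearMap.proj i : (ι → ℂ) →ₗ[ℂ] ℂ) ∘ₗ M))

/-- restriction to the line `x + s y` -/
def lineP {ι : Type*} (x y : ι → ℂ) : MvPolynomial ι ℂ →ₐ[ℂ] Polynomial ℂ :=
  MvPolynomial.aeval (fun i => Polynomial.C (x i) + Polynomial.C (y i) * Polynomial.X)

set_option linter.unusedSectionVars false
set_option linter.unusedSimpArgs false

section basics
open MvPolynomial
variable {ι : Type*} [Fintype ι] [DecidableEq ι]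

lemma eval_linP (l : (ι → ℂ) →ₗ[ℂ] ℂ) (v : ι → ℂ) : eval v (linP l) = l v := by
  conv_rhs => rw [← Finset.univ_sum_single v]
  simp only [linP, map_sum, map_mul, eval_C, eval_X]
  refine Finset.sum_congr rfl fun i _ => ?_
  have : (Pi.single i (v i) : ι → ℂ) = v i • Pi.single i 1 := by
    rw [← Pi.single_smul]; simp
  rw [this, map_smul, smul_eq_mul, mul_comm]

lemma eval_actP (M : Module.End ℂ (ι → ℂ)) (f : MvPolynomial ι ℂ) (v : ι → ℂ) :
    eval v (actP M f) = eval (M v) f := by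
  induction f using MvPolynomial.induction_on with
  | C a => simp [actP]
  | add p q hp hq => simp [hp, hq]
  | mul_X p i hp =>
    rw [map_mul, map_mul, hp, map_mul, eval_X]
    congr 1
    simp [actP, eval_linP]

lemma evext {f g : MvPolynomial ι ℂ} (h : ∀ v, eval v f = eval v g) : f = g :=
  MvPolynomial.funext h

lemma actP_one (f : MvPolynomial ι ℂ) : actP 1 f = f := evext fun v => by simp [eval_actP]

lemma actP_mul (M N : Module.End ℂ (ι → ℂ)) (f : MvPolynomial ι ℂ) :
    actP (M * N) f = actP N (actP M f) := evext fun v => by simp [eval_actP]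

lemma actP_linP (M : Module.End ℂ (ι → ℂ)) (l : (ι → ℂ) →ₗ[ℂ] ℂ) :
    actP M (linP l) = linP (l ∘ₗ M) := evext fun v => by simp [eval_actP, eval_linP]

lemma linP_smul (c : ℂ) (l : (ι → ℂ) →ₗ[ℂ] ℂ) : linP (c • l) = C c * linP l :=
  evext fun v => by simp [eval_linP]

lemma ddP_linP (y : ι → ℂ) (l : (ι → ℂ) →ₗ[ℂ] ℂ) : ddP y (linP l) = C (l y) := by
  rw [← eval_linP l y]
  simp [linP, ddP, Derivation.leibniz, mkDerivation_X, mul_comm, ← C_mul']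

lemma ddP_C (y : ι → ℂ) (c : ℂ) : ddP y (C c) = 0 := by simp [ddP]

lemma ddP_C_mul (y : ι → ℂ) (c : ℂ) (f : MvPolynomial ι ℂ) : ddP y (C c * f) = C c * ddP y f := by
  rw [Derivation.leibniz, ddP_C]; simp

lemma ddP_actP (M : Module.End ℂ (ι → ℂ)) (y : ι → ℂ) (f : MvPolynomial ι ℂ) :
    ddP y (actP M f) = actP M (ddP (M y) f) := by
  induction f using MvPolynomial.induction_on with
  | C a => simp [actP, ddP]
  | add p q hp hq => simp [hp, hq]
  | mul_X p i hp =>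
    have h1 : ddP y (actP M (X i)) = actP M (ddP (M y) (X i)) := by
      simp [actP, ddP_linP]; simp [ddP, mkDerivation_X]
    rw [map_mul, Derivation.leibniz, Derivation.leibniz, hp, h1]
    simp

lemma ddP_eq_sum (y : ι → ℂ) (f : MvPolynomial ι ℂ) :
    ddP y f = ∑ i, C (y i) * pderiv i f := by
  induction f using MvPolynomial.induction_on with
  | C a => simp [ddP]
  | add p q hp hq => simp [hp, hq, mul_add, Finset.sum_add_distrib]
  | mul_X p i hp =>
    rw [Derivation.leibniz, hp]
    simp only [Derivation.leibniz, pderiv_X, smul_eq_mul, mul_add, Finset.sum_add_distrib]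
    congr 1
    · rw [Finset.sum_eq_single i]
      · simp [ddP, mkDerivation_X]; ring
      · intro b _ hb; simp [Pi.single_apply, hb.symm]
      · simp
    · rw [Finset.mul_sum]
      exact Finset.sum_congr rfl fun j _ => by ring

lemma linP_ne_zero {l : (ι → ℂ) →ₗ[ℂ] ℂ} (h : l ≠ 0) : linP l ≠ 0 := by
  intro h0
  apply h
  ext i
  have := eval_linP l (Pi.single i 1)
  rw [h0] at this
  simpa using this.symm

lemma linP_homog (l : (ι → ℂ) →ₗ[ℂ] ℂ) : (linP l).IsHomogeneous 1 := by
  apply IsHomogeneous.sum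
  intro i _
  simpa using (isHomogeneous_C ι (l (Pi.single i 1))).mul (isHomogeneous_X ℂ i)

lemma linP_prime {l : (ι → ℂ) →ₗ[ℂ] ℂ} (h : l ≠ 0) : Prime (linP l) := by
  have hd : (linP l).totalDegree = 1 := (linP_homog l).totalDegree (linP_ne_zero h)
  apply Irreducible.prime
  apply irreducible_of_totalDegree_eq_one hd
  intro x hx
  obtain ⟨m, hm⟩ := (MvPolynomial.ne_zero_iff).1 (linP_ne_zero h)
  have := hx m
  rw [isUnit_iff_ne_zero]
  rintro rfl
  exact hm (by simpa using this)

/-- divisibility of linear forms -/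
lemma ker_of_linP_dvd {l m : (ι → ℂ) →ₗ[ℂ] ℂ} (h : linP l ∣ linP m) (x : ι → ℂ) (hx : l x = 0) :
    m x = 0 := by
  obtain ⟨q, hq⟩ := h
  rw [← eval_linP m, hq, map_mul, eval_linP, hx, zero_mul]

/-- if M fixes the kernel of l pointwise then l divides f - f∘M -/
lemma linP_dvd_sub_act {l : (ι → ℂ) →ₗ[ℂ] ℂ} {M : Module.End ℂ (ι → ℂ)} {r : ι → ℂ}
    (hM : ∀ x, M x = x + l x • r) (f : MvPolynomial ι ℂ) : linP l ∣ f - actP M f := by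
  induction f using MvPolynomial.induction_on with
  | C a => simp [actP]
  | add p q hp hq =>
    rw [map_add, add_sub_add_comm]; exact dvd_add hp hq
  | mul_X p i hp =>
    have h1 : linP l ∣ X i - actP M (X i) := by
      refine ⟨C (- r i), evext fun v => ?_⟩
      simp [eval_actP, eval_linP, hM]
    have : p * X i - actP M (p * X i) = p * (X i - actP M (X i)) + (p - actP M p) * actP M (X i) := by
      rw [map_mul]; ring
    rw [this]
    exact dvd_add (Dvd.dvd.mul_left h1 _) (Dvd.dvd.mul_right hp _)

/-- all monomials have degree `< m` -/
def DL (m : ℕ) (f : MvPolynomial ι ℂ) : Prop := f = 0 ∨ f.totalDegree < m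

lemma DL_zero {f : MvPolynomial ι ℂ} (h : DL 0 f) : f = 0 := by
  rcases h with h | h
  · exact h
  · simp at h

lemma DL_iff {m : ℕ} {f : MvPolynomial ι ℂ} : DL (m+1) f ↔ f.totalDegree ≤ m := by
  constructor
  · rintro (h | h)
    · simp [h]
    · omega
  · intro h; right; omega

lemma DL.add {m : ℕ} {f g : MvPolynomial ι ℂ} (hf : DL m f) (hg : DL m g) : DL m (f + g) := by
  rcases m with _ | m
  · left; rw [DL_zero hf, DL_zero hg, add_zero]
  · rw [DL_iff] at *
    exact (totalDegree_add _ _).trans (max_le hf hg)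

lemma DL.C_mul {m : ℕ} {f : MvPolynomial ι ℂ} (c : ℂ) (hf : DL m f) : DL m (C c * f) := by
  rcases m with _ | m
  · left; rw [DL_zero hf, mul_zero]
  · rw [DL_iff] at *
    exact (totalDegree_mul _ _).trans (by simpa using hf)

lemma DL.neg {m : ℕ} {f : MvPolynomial ι ℂ} (hf : DL m f) : DL m (-f) := by
  have := hf.C_mul (-1); simpa using this

lemma DL.sub {m : ℕ} {f g : MvPolynomial ι ℂ} (hf : DL m f) (hg : DL m g) : DL m (f - g) := by
  rw [sub_eq_add_neg]; exact hf.add hg.neg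

lemma DL.sum {m : ℕ} {κ : Type*} {s : Finset κ} {f : κ → MvPolynomial ι ℂ}
    (hf : ∀ i ∈ s, DL m (f i)) : DL m (∑ i ∈ s, f i) := by
  classical
  induction s using Finset.induction_on with
  | empty => left; simp
  | insert a s ha ih =>
    rw [Finset.sum_insert ha]
    exact (hf a (by simp)).add (ih fun i hi => hf i (by simp [hi]))

lemma DL.act {m : ℕ} {f : MvPolynomial ι ℂ} (M : Module.End ℂ (ι → ℂ)) (hf : DL m f) :
    DL m (actP M f) := by
  rw [f.as_sum, map_sum]
  rcases m with _ | m
  · rw [DL_zero hf]; left; simp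
  rw [DL_iff] at hf
  apply DL.sum
  intro s hs
  rw [DL_iff]
  have h1 : (actP M (monomial s (coeff s f))).IsHomogeneous (s.sum fun _ e => e) := by
    rw [actP, aeval_monomial]
    have := (isHomogeneous_C ι (coeff s f)).mul (IsHomogeneous.prod s.support
      (fun i => linP ((LinearMap.proj i : (ι → ℂ) →ₗ[ℂ] ℂ) ∘ₗ M) ^ s i) (fun i => 1 * s i)
      (fun i _ => (linP_homog _).pow (s i)))
    simpa [Finsupp.sum, Finsupp.prod] using this
  exact h1.totalDegree_le.trans ((le_totalDegree hs).trans hf)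

lemma DL.linP_cancel {m : ℕ} {l : (ι → ℂ) →ₗ[ℂ] ℂ} (hl : l ≠ 0) {f : MvPolynomial ι ℂ}
    (h : DL (m+1) (linP l * f)) : DL m f := by
  by_cases h0 : f = 0
  · left; exact h0
  rw [DL_iff, totalDegree_mul_of_isDomain (linP_ne_zero hl) h0,
    (linP_homog l).totalDegree (linP_ne_zero hl)] at h
  right; omega

lemma DL.dd {m : ℕ} {f : MvPolynomial ι ℂ} (y : ι → ℂ) (h : DL (m+1) f) : DL m (ddP y f) := by
  rw [ddP_eq_sum]
  apply DL.sum
  intro i _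
  apply DL.C_mul
  rw [f.as_sum, map_sum]
  rw [DL_iff] at h
  apply DL.sum
  intro s hs
  rw [pderiv_monomial]
  have hd := (le_totalDegree hs).trans h
  by_cases h0 : s i = 0
  · left; simp [h0]
  right
  refine lt_of_le_of_lt (totalDegree_monomial_le _ _) ?_
  have hle : Finsupp.single i 1 ≤ s := by
    rw [Finsupp.single_le_iff]; omega
  have hs' : s = (s - Finsupp.single i 1) + Finsupp.single i 1 := (tsub_add_cancel_of_le hle).symm
  have : (s.sum fun _ e => e) = ((s - Finsupp.single i 1).sum fun _ e => e) + 1 := by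
    conv_lhs => rw [hs']
    rw [Finsupp.sum_add_index' (by simp) (by simp)]; simp
  simp only [Finsupp.sum] at this hd ⊢
  simp only [Function.id_def]
  omega

lemma eval_lineP (x y : ι → ℂ) (f : MvPolynomial ι ℂ) (s : ℂ) :
    (lineP x y f).eval s = eval (x + s • y) f := by
  induction f using MvPolynomial.induction_on with
  | C a => simp [lineP]
  | add p q hp hq => simp [hp, hq]
  | mul_X p i hp =>
    rw [map_mul, Polynomial.eval_mul, hp, map_mul, eval_X]
    congr 1
    simp [lineP]
    ring

lemma lineP_linP (x y : ι → ℂ) (l : (ι → ℂ) →ₗ[ℂ] ℂ) :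
    lineP x y (linP l) = Polynomial.C (l x) + Polynomial.C (l y) * Polynomial.X :=
  Polynomial.funext fun s => by simp [eval_lineP, eval_linP]; ring

lemma lineP_C (x y : ι → ℂ) (c : ℂ) : lineP x y (C c) = Polynomial.C c := by simp [lineP]

lemma derivative_lineP (x y : ι → ℂ) (f : MvPolynomial ι ℂ) :
    Polynomial.derivative (lineP x y f) = lineP x y (ddP y f) := by
  induction f using MvPolynomial.induction_on with
  | C a => simp [lineP, ddP]
  | add p q hp hq => simp [hp, hq]
  | mul_X p i hp =>
    have h1 : Polynomial.derivative (lineP x y (X i)) = lineP x y (ddP y (X i)) := by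
      simp [lineP, ddP, mkDerivation_X]
    rw [map_mul, Polynomial.derivative_mul, Derivation.leibniz, hp, h1]
    simp; ring

end basics

end Part1

section Part2

/-- reflection data -/
structure RD (G : Type*) (ι : Type*) [Group G] [Fintype ι] [DecidableEq ι] where
  ρ : G →* Module.End ℂ (ι → ℂ)
  R : Finset G
  α : G → ((ι → ℂ) →ₗ[ℂ] ℂ)
  r : G → (ι → ℂ)
  one_notin : (1 : G) ∉ R
  refl : ∀ t ∈ R, ∀ x, ρ t x = x + α t x • r t
  ane : ∀ t ∈ R, α t ≠ 0
  rne : ∀ t ∈ R, α t (r t) ≠ 0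
  conj : ∀ t ∈ R, ∀ w : G, w * t * w⁻¹ ∈ R
  aconj : ∀ t ∈ R, ∀ w : G, ∃ c : ℂ, c ≠ 0 ∧ ∀ x, α (w * t * w⁻¹) x = c * α t (ρ w⁻¹ x)
  same : ∀ s ∈ R, ∀ t ∈ R, (∀ x, α s x = 0 → α t x = 0) → α s = α t
  stab : ∀ s ∈ R, ∀ w : G, (∀ x, α s x = 0 → ρ w x = x) ↔ (w = 1 ∨ (w ∈ R ∧ α w = α s))

namespace RD
open MvPolynomial
variable {G ι : Type*} [Group G] [Fintype G] [DecidableEq G] [Fintype ι] [DecidableEq ι] (D : RD G ι)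

lemma ρ_inv_apply (w : G) (x : ι → ℂ) : D.ρ w (D.ρ w⁻¹ x) = x := by
  rw [← Module.End.mul_apply, ← map_mul]; simp

lemma ρ_inv_apply' (w : G) (x : ι → ℂ) : D.ρ w⁻¹ (D.ρ w x) = x := by
  rw [← Module.End.mul_apply, ← map_mul]; simp

lemma inv_aux {t : G} (ht : t ∈ D.R) : t⁻¹ ∈ D.R ∧ D.α t⁻¹ = D.α t := by
  have h1 : ∀ x, D.α t x = 0 → D.ρ t⁻¹ x = x := by
    intro x hx
    have : D.ρ t x = x := by rw [D.refl t ht, hx]; simp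
    conv_lhs => rw [← this]
    exact D.ρ_inv_apply' t x
  rcases (D.stab t ht t⁻¹).1 h1 with h | h
  · exfalso
    rw [inv_eq_one] at h
    exact D.one_notin (h ▸ ht)
  · exact h

lemma inv_memR {t : G} (ht : t ∈ D.R) : t⁻¹ ∈ D.R := (D.inv_aux ht).1
lemma α_inv {t : G} (ht : t ∈ D.R) : D.α t⁻¹ = D.α t := (D.inv_aux ht).2

/-- regular vectors -/
def Reg (v : ι → ℂ) : Prop := ∀ t ∈ D.R, D.α t v ≠ 0

lemma Reg.act {v : ι → ℂ} (hv : D.Reg v) (w : G) : D.Reg (D.ρ w v) := by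
  intro t ht h0
  obtain ⟨c, hc, h⟩ := D.aconj t ht w⁻¹
  have := h v
  simp only [inv_inv] at this
  rw [h0, mul_zero] at this
  have h2 := D.conj t ht w⁻¹
  simp only [inv_inv] at h2
  exact hv _ h2 this

lemma ratio (t : G) (ht : t ∈ D.R) (w : G) (y v : ι → ℂ) :
    D.α t (D.ρ w⁻¹ y) / D.α t (D.ρ w⁻¹ v) = D.α (w * t * w⁻¹) y / D.α (w * t * w⁻¹) v := by
  obtain ⟨c, hc, h⟩ := D.aconj t ht w
  rw [h, h, mul_div_mul_left _ _ hc]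

lemma sum_conj {M : Type*} [AddCommMonoid M] (w : G) (f : G → M) :
    ∑ t ∈ D.R, f (w * t * w⁻¹) = ∑ t ∈ D.R, f t := by
  refine Finset.sum_bij' (fun t _ => w * t * w⁻¹) (fun t _ => w⁻¹ * t * w) ?_ ?_ ?_ ?_ ?_
  · intro t ht; exact D.conj t ht w
  · intro t ht; simpa using D.conj t ht w⁻¹
  · intro t _; group
  · intro t _; group
  · intro t _; rfl

lemma sum_inv {M : Type*} [AddCommMonoid M] (f : G → M) :
    ∑ t ∈ D.R, f t⁻¹ = ∑ t ∈ D.R, f t := by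
  refine Finset.sum_bij' (fun t _ => t⁻¹) (fun t _ => t⁻¹) ?_ ?_ ?_ ?_ ?_
  · intro t ht; exact D.inv_memR ht
  · intro t ht; exact D.inv_memR ht
  · simp
  · simp
  · intro t _; rfl

/-- discriminant-like product -/
def δ : MvPolynomial ι ℂ := ∏ t ∈ D.R, linP (D.α t)

def δ' (t : G) : MvPolynomial ι ℂ := ∏ s ∈ D.R.erase t, linP (D.α s)

lemma δ_eq {t : G} (ht : t ∈ D.R) : D.δ = linP (D.α t) * D.δ' t :=
  (Finset.mul_prod_erase D.R (fun s => linP (D.α s)) ht).symm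

lemma δ_ne : D.δ ≠ 0 := Finset.prod_ne_zero_iff.2 fun t ht => linP_ne_zero (D.ane t ht)

lemma reg_iff (v : ι → ℂ) : D.Reg v ↔ eval v D.δ ≠ 0 := by
  simp [Reg, δ, map_prod, eval_linP, Finset.prod_ne_zero_iff]

/-- polynomials agreeing at regular points are equal -/
lemma reg_ext {f g : MvPolynomial ι ℂ} (h : ∀ v, D.Reg v → eval v f = eval v g) : f = g := by
  have : D.δ * f = D.δ * g := evext fun v => by
    rw [map_mul, map_mul]
    by_cases hv : D.Reg v
    · rw [h v hv]
    · rw [reg_iff, not_not] at hv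
      rw [hv, zero_mul, zero_mul]
  exact mul_left_cancel₀ D.δ_ne this

/-- flat sections -/
def Flat (F : G → MvPolynomial ι ℂ) : Prop := ∀ v, D.Reg v → ∀ y w,
  eval v (ddP y (F w)) = ∑ t ∈ D.R, D.α t y / D.α t v * (eval v (F w) - eval v (F (t⁻¹ * w)))

/-- the space of flat sections -/
def S : Submodule ℂ (G → MvPolynomial ι ℂ) where
  carrier := {F | D.Flat F}
  zero_mem' := by intro v _ y w; simp
  add_mem' := by
    intro F F' h h' v hv y w
    simp only [Pi.add_apply, map_add, h v hv, h' v hv, ← Finset.sum_add_distrib]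
    exact Finset.sum_congr rfl fun t _ => by ring
  smul_mem' := by
    intro c F h v hv y w
    simp only [Pi.smul_apply, Derivation.map_smul, smul_eval, h v hv, Finset.mul_sum]
    exact Finset.sum_congr rfl fun t _ => by ring

lemma mem_S {F : G → MvPolynomial ι ℂ} : F ∈ D.S ↔ D.Flat F := Iff.rfl

/-- diagonal action -/
def T (x : G) : (G → MvPolynomial ι ℂ) →ₗ[ℂ] (G → MvPolynomial ι ℂ) where
  toFun F := fun w => actP (D.ρ x⁻¹) (F (x⁻¹ * w))
  map_add' := by intro F F'; ext1 w; simp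
  map_smul' := by intro c F; ext1 w; simp

lemma T_apply (x : G) (F : G → MvPolynomial ι ℂ) (w : G) :
    D.T x F w = actP (D.ρ x⁻¹) (F (x⁻¹ * w)) := rfl

lemma eval_T (x : G) (F : G → MvPolynomial ι ℂ) (w : G) (v : ι → ℂ) :
    eval v (D.T x F w) = eval (D.ρ x⁻¹ v) (F (x⁻¹ * w)) := by rw [T_apply, eval_actP]

lemma T_mul (x y : G) (F : G → MvPolynomial ι ℂ) : D.T (x * y) F = D.T x (D.T y F) := by
  ext1 w
  apply evext
  intro v
  simp [eval_T, mul_assoc]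

lemma T_mem (x : G) {F : G → MvPolynomial ι ℂ} (hF : F ∈ D.S) : D.T x F ∈ D.S := by
  intro v hv y w
  rw [T_apply, ddP_actP, eval_actP, hF _ (Reg.act D hv _)]
  refine Eq.trans ?_ (D.sum_conj x _)
  refine Finset.sum_congr rfl fun t ht => ?_
  rw [D.ratio t ht, eval_actP, eval_T]
  simp [mul_assoc]

/-- right translation -/
lemma right_mem (u : G) {F : G → MvPolynomial ι ℂ} (hF : F ∈ D.S) :
    (fun w => F (w * u)) ∈ D.S := by
  intro v hv y w
  rw [hF v hv]
  simp [mul_assoc]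

lemma S_poly {F : G → MvPolynomial ι ℂ} (hF : F ∈ D.S) (y : ι → ℂ) (w : G) :
    D.δ * ddP y (F w) = ∑ t ∈ D.R, C (D.α t y) * D.δ' t * (F w - F (t⁻¹ * w)) := by
  apply D.reg_ext
  intro v hv
  rw [map_mul, hF v hv, map_sum, Finset.mul_sum]
  refine Finset.sum_congr rfl fun t ht => ?_
  have := hv t ht
  rw [D.δ_eq ht]
  simp [eval_linP]
  field_simp

lemma S_line {F : G → MvPolynomial ι ℂ} (hF : F ∈ D.S) (x y : ι → ℂ) (w : G) :
    lineP x y D.δ * Polynomial.derivative (lineP x y (F w)) = ∑ t ∈ D.R,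
      Polynomial.C (D.α t y) * lineP x y (D.δ' t) * (lineP x y (F w) - lineP x y (F (t⁻¹ * w))) := by
  rw [derivative_lineP, ← map_mul, D.S_poly hF, map_sum]
  simp [lineP_C]

lemma X_pow_succ_dvd {f : Polynomial ℂ} {m : ℕ} (h0 : Polynomial.X ^ m ∣ f)
    (hc : f.coeff m = 0) : Polynomial.X ^ (m+1) ∣ f := by
  rw [Polynomial.X_pow_dvd_iff] at *
  intro k hk
  rcases Nat.lt_succ_iff_lt_or_eq.1 hk with h | h
  · exact h0 k h
  · rw [h, hc]

lemma eq_zero_of_dvd {f : Polynomial ℂ} (h : ∀ m, Polynomial.X ^ m ∣ f) : f = 0 := by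
  ext m
  have := h (m+1)
  rw [Polynomial.X_pow_dvd_iff] at this
  simpa using this m (by omega)

lemma S_ext_zero {F : G → MvPolynomial ι ℂ} (hF : F ∈ D.S) {v : ι → ℂ} (hv : D.Reg v)
    (h0 : ∀ w, eval v (F w) = 0) : F = 0 := by
  ext1 w
  apply evext
  intro x
  set y := x - v with hy
  have key : ∀ m w, Polynomial.X ^ m ∣ lineP v y (F w) := by
    intro m
    induction m with
    | zero => simp
    | succ m ih =>
      intro w
      apply X_pow_succ_dvd (ih w)
      rcases m with _ | m
      · rw [Polynomial.coeff_zero_eq_eval_zero, eval_lineP]; simpa using h0 w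
      have h1 : Polynomial.X ^ (m+1) ∣ lineP v y D.δ * Polynomial.derivative (lineP v y (F w)) := by
        rw [D.S_line hF]
        exact Finset.dvd_sum fun t _ => Dvd.dvd.mul_left (dvd_sub (ih _) (ih _)) _
      have h2 := Polynomial.prime_X.pow_dvd_of_dvd_mul_left (m+1) (a := lineP v y D.δ) (by
        rw [Polynomial.X_dvd_iff, Polynomial.coeff_zero_eq_eval_zero, eval_lineP]
        simpa using (D.reg_iff v).1 hv) h1
      rw [Polynomial.X_pow_dvd_iff] at h2
      have h3 := h2 m (by omega)
      rw [Polynomial.coeff_derivative] at h3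
      rcases mul_eq_zero.1 h3 with h | h
      · exact h
      · exfalso; norm_cast at h
  have h3 := eq_zero_of_dvd fun m => key m w
  have := eval_lineP v y (F w) 1
  rw [h3] at this
  simpa [hy] using this.symm

lemma S_ext {F F' : G → MvPolynomial ι ℂ} (hF : F ∈ D.S) (hF' : F' ∈ D.S) {v : ι → ℂ} (hv : D.Reg v)
    (h0 : ∀ w, eval v (F w) = eval v (F' w)) : F = F' := by
  rw [← sub_eq_zero]
  exact D.S_ext_zero (D.S.sub_mem hF hF') hv fun w => by simp [h0]

end RD

end Part2

section Part3

namespace RD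
open MvPolynomial
variable {G ι : Type*} [Group G] [Fintype G] [DecidableEq G] [Fintype ι] [DecidableEq ι] (D : RD G ι)

/-- pointwise stabilizer of the kernel of `l` -/
def P (l : (ι → ℂ) →ₗ[ℂ] ℂ) : Subgroup G where
  carrier := {w | ∀ x, l x = 0 → D.ρ w x = x}
  one_mem' := by intro x _; simp
  mul_mem' := by
    intro a b ha hb x hx
    rw [map_mul, Module.End.mul_apply, hb x hx, ha x hx]
  inv_mem' := by
    intro a ha x hx
    conv_lhs => rw [← ha x hx]
    exact D.ρ_inv_apply' a x

lemma mem_P {l : (ι → ℂ) →ₗ[ℂ] ℂ} {w : G} : w ∈ D.P l ↔ ∀ x, l x = 0 → D.ρ w x = x := Iff.rfl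

lemma mem_P_iff {s : G} (hs : s ∈ D.R) {w : G} :
    w ∈ D.P (D.α s) ↔ (w = 1 ∨ (w ∈ D.R ∧ D.α w = D.α s)) := D.stab s hs w

lemma self_mem_P {s : G} (hs : s ∈ D.R) : s ∈ D.P (D.α s) :=
  (D.mem_P_iff hs).2 (Or.inr ⟨hs, rfl⟩)

/-- order of the stabilizer -/
def e (l : (ι → ℂ) →ₗ[ℂ] ℂ) : ℕ := Nat.card (D.P l)

lemma e_pos (l : (ι → ℂ) →ₗ[ℂ] ℂ) : 0 < D.e l := Nat.card_pos

lemma pow_e {l : (ι → ℂ) →ₗ[ℂ] ℂ} {t : G} (ht : t ∈ D.P l) : t ^ D.e l = 1 := by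
  have := pow_card_eq_one' (x := (⟨t, ht⟩ : D.P l))
  exact congrArg Subtype.val this

lemma e_conj {s : G} (hs : s ∈ D.R) (w : G) : D.e (D.α (w * s * w⁻¹)) = D.e (D.α s) := by
  obtain ⟨c, hc, h⟩ := D.aconj s hs w
  unfold e
  refine Nat.card_congr ⟨fun p => ⟨w⁻¹ * p * w, ?_⟩, fun p => ⟨w * p * w⁻¹, ?_⟩, ?_, ?_⟩
  · intro x hx
    have := p.2 (D.ρ w x) (by rw [h]; simp [ρ_inv_apply', hx])
    rw [map_mul, map_mul, Module.End.mul_apply, Module.End.mul_apply, this, ρ_inv_apply']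
  · intro x hx
    rw [h] at hx
    have := p.2 (D.ρ w⁻¹ x) (by simpa [hc] using hx)
    rw [map_mul, map_mul, Module.End.mul_apply, Module.End.mul_apply, this, ρ_inv_apply]
  · intro p; ext; simp [mul_assoc]
  · intro p; ext; simp [mul_assoc]

lemma α_scale {s t : G} (hs : s ∈ D.R) (ht : t ∈ D.P (D.α s)) :
    ∃ c : ℂ, c ^ D.e (D.α s) = 1 ∧ ∀ x, D.α s (D.ρ t x) = c * D.α s x := by
  have h1 : ∃ c : ℂ, ∀ x, D.α s (D.ρ t x) = c * D.α s x := by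
    rcases (D.mem_P_iff hs).1 ht with h | ⟨h, h'⟩
    · exact ⟨1, by simp [h]⟩
    · refine ⟨1 + D.α s (D.r t), fun x => ?_⟩
      rw [D.refl t h, h']; simp; ring
  obtain ⟨c, hc⟩ := h1
  refine ⟨c, ?_, hc⟩
  have h2 : ∀ n : ℕ, ∀ x, D.α s (D.ρ (t ^ n) x) = c ^ n * D.α s x := by
    intro n
    induction n with
    | zero => simp
    | succ n ih => intro x; rw [pow_succ', map_mul, Module.End.mul_apply, hc, ih, pow_succ']; ring
  obtain ⟨x, hx⟩ : ∃ x, D.α s x ≠ 0 := by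
    by_contra hh
    push Not at hh
    exact D.ane s hs (LinearMap.ext hh)
  have h3 := h2 (D.e (D.α s)) x
  rw [D.pow_e ht] at h3
  rw [map_one, Module.End.one_apply] at h3
  exact mul_right_cancel₀ hx (by rw [one_mul]; exact h3.symm)

lemma act_pow_e {s t : G} (hs : s ∈ D.R) (ht : t ∈ D.P (D.α s)) :
    actP (D.ρ t) (linP (D.α s) ^ D.e (D.α s)) = linP (D.α s) ^ D.e (D.α s) := by
  obtain ⟨c, hc, h⟩ := D.α_scale hs ht
  apply evext
  intro v
  rw [eval_actP, map_pow, map_pow, eval_linP, eval_linP, h, mul_pow, hc, one_mul]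

lemma dvd_sub_act {s t : G} (hs : s ∈ D.R) (ht : t ∈ D.P (D.α s)) (f : MvPolynomial ι ℂ) :
    linP (D.α s) ∣ f - actP (D.ρ t) f := by
  rcases (D.mem_P_iff hs).1 ht with h | ⟨h, h'⟩
  · rw [h, map_one, actP_one, sub_self]; exact dvd_zero _
  · rw [← h']
    exact linP_dvd_sub_act (D.refl t h) f

/-- the lattice -/
structure IsQ (L : Set (G → ℂ)) (F : G → MvPolynomial ι ℂ) : Prop where
  ann : ∀ l ∈ L, ∑ w, C (l w) * F w = 0
  dvd : ∀ s ∈ D.R, ∀ w, linP (D.α s) ^ D.e (D.α s) ∣ F w - F (s⁻¹ * w)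

variable {D}
lemma IsQ.dvdP {L : Set (G → ℂ)} {F : G → MvPolynomial ι ℂ} (h : D.IsQ L F) {s x : G} (hs : s ∈ D.R)
    (hx : x ∈ D.P (D.α s)) (w : G) : linP (D.α s) ^ D.e (D.α s) ∣ F w - F (x⁻¹ * w) := by
  rcases (D.mem_P_iff hs).1 hx with h' | ⟨h', h''⟩
  · rw [h']; simp
  · rw [← h'']; exact h.dvd x h' w

lemma IsQ.theta {L : Set (G → ℂ)} {F : G → MvPolynomial ι ℂ} (h : D.IsQ L F) :
    ∃ Θ : G → G → MvPolynomial ι ℂ, ∀ t ∈ D.R, ∀ w,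
      F w - actP (D.ρ t⁻¹) (F (t⁻¹ * w)) = linP (D.α t) * Θ t w := by
  have : ∀ t w, ∃ q, t ∈ D.R → F w - actP (D.ρ t⁻¹) (F (t⁻¹ * w)) = linP (D.α t) * q := by
    intro t w
    by_cases ht : t ∈ D.R
    · have h1 : linP (D.α t) ∣ F w - F (t⁻¹ * w) :=
        (dvd_pow_self _ (D.e_pos _).ne').trans (h.dvd t ht w)
      have h2 := D.dvd_sub_act ht ((D.P (D.α t)).inv_mem (D.self_mem_P ht)) (F (t⁻¹ * w))
      obtain ⟨q, hq⟩ := dvd_add h1 h2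
      refine ⟨q, fun _ => ?_⟩
      rw [← hq]; ring
    · exact ⟨0, fun h => absurd h ht⟩
  choose Θ hΘ using this
  exact ⟨Θ, fun t ht w => hΘ t w ht⟩

/-- The Dunkl-type operator preserves the lattice. -/
lemma IsQ.dunkl {L : Set (G → ℂ)} (hL : ∀ l ∈ L, ∀ x, (fun w => l (x * w)) ∈ L)
    {F : G → MvPolynomial ι ℂ} (h : D.IsQ L F)
    {Θ : G → G → MvPolynomial ι ℂ} (hΘ : ∀ t ∈ D.R, ∀ w,
      F w - actP (D.ρ t⁻¹) (F (t⁻¹ * w)) = linP (D.α t) * Θ t w) (y : ι → ℂ) :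
    D.IsQ L (fun w => ddP y (F w) - ∑ t ∈ D.R, C (D.α t y) * Θ t w) := by
  constructor
  · intro l hl
    have h1 : ∀ t ∈ D.R, ∑ w, C (l w) * Θ t w = 0 := by
      intro t ht
      have : linP (D.α t) * ∑ w, C (l w) * Θ t w = 0 := by
        rw [Finset.mul_sum]
        have : ∀ w, linP (D.α t) * (C (l w) * Θ t w) = C (l w) * F w -
            actP (D.ρ t⁻¹) (C (l w) * F (t⁻¹ * w)) := by
          intro w
          rw [map_mul, mul_left_comm, ← hΘ t ht]
          simp [actP]
          ring
        simp only [this, Finset.sum_sub_distrib, h.ann l hl, ← map_sum]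
        have h3 : ∑ w, C (l w) * F (t⁻¹ * w) = 0 := by
          rw [← h.ann _ (hL l hl t)]
          refine Fintype.sum_equiv (Equiv.mulLeft t⁻¹) _ _ ?_
          intro w; simp
        rw [h3]; simp
      exact (mul_eq_zero.1 this).resolve_left (linP_ne_zero (D.ane t ht))
    have h2 : ∑ w, C (l w) * ddP y (F w) = 0 := by
      simp only [← ddP_C_mul, ← map_sum, h.ann l hl]
      simp
    simp only [mul_sub, Finset.sum_sub_distrib, h2, Finset.mul_sum]
    rw [Finset.sum_comm, Finset.sum_eq_zero, sub_zero]
    intro t ht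
    simp only [mul_left_comm (C (l _)), ← Finset.mul_sum, h1 t ht, mul_zero]
  · intro s hs w
    set a := linP (D.α s) with ha
    set E := D.e (D.α s) with hE
    have ha0 : a ≠ 0 := linP_ne_zero (D.ane s hs)
    have off : ∀ t ∈ D.R, D.α t ≠ D.α s → a ^ E ∣ Θ t w - Θ t (s⁻¹ * w) := by
      intro t ht hts
      have hnd : ¬ a ∣ linP (D.α t) := by
        intro hd
        exact hts (D.same s hs t ht (ker_of_linP_dvd hd)).symm
      apply (linP_prime (D.ane s hs)).pow_dvd_of_dvd_mul_left E hnd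
      have e1 : linP (D.α t) * (Θ t w - Θ t (s⁻¹ * w)) = (F w - F (s⁻¹ * w)) -
          actP (D.ρ t⁻¹) (F (t⁻¹ * w) - F ((t⁻¹ * s * t)⁻¹ * (t⁻¹ * w))) := by
        rw [mul_sub, ← hΘ t ht, ← hΘ t ht, map_sub]
        simp only [mul_inv_rev, inv_inv, mul_assoc, mul_inv_cancel_left]
        ring
      rw [e1]
      refine dvd_sub (h.dvd s hs w) ?_
      have hs' : t⁻¹ * s * t ∈ D.R := by simpa using D.conj s hs t⁻¹
      have he' : D.e (D.α (t⁻¹ * s * t)) = E := by simpa using D.e_conj hs t⁻¹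
      have hd := h.dvd _ hs' (t⁻¹ * w)
      obtain ⟨c, hc, hcc⟩ := D.aconj s hs t⁻¹
      simp only [inv_inv] at hcc
      have h4 := map_dvd (actP (D.ρ t⁻¹)) hd
      refine dvd_trans ?_ h4
      rw [map_pow, he']
      apply pow_dvd_pow_of_dvd
      refine ⟨C c, evext fun v => ?_⟩
      rw [eval_actP, eval_linP, map_mul, eval_linP, hcc, ρ_inv_apply]
      simp [mul_comm]
    apply (mul_dvd_mul_iff_left ha0).1
    rw [← pow_succ']
    obtain ⟨g, hg⟩ := h.dvd s hs w
    have hder : a * (ddP y (F w) - ddP y (F (s⁻¹ * w))) =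
        a ^ (E+1) * ddP y g + C (D.α s y) * (E : MvPolynomial ι ℂ) * (F w - F (s⁻¹ * w)) := by
      rw [← map_sub, hg, Derivation.leibniz, Derivation.leibniz_pow, ddP_linP]
      obtain ⟨k, hk⟩ : ∃ k, E = k + 1 := ⟨E - 1, by have := D.e_pos (D.α s); omega⟩
      rw [← hE, hk]
      simp only [Nat.add_sub_cancel, smul_eq_mul, nsmul_eq_mul, ← ha]
      ring
    classical
    have hsplit : ∀ f : G → MvPolynomial ι ℂ, ∑ t ∈ D.R, f t =
        ∑ t ∈ D.R.filter (fun t => D.α t = D.α s), f t +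
        ∑ t ∈ D.R.filter (fun t => ¬ D.α t = D.α s), f t := fun f =>
      (Finset.sum_filter_add_sum_filter_not _ _ _).symm
    set PF : Finset G := insert 1 (D.R.filter (fun t => D.α t = D.α s)) with hPF
    have hmemPF : ∀ x, x ∈ PF ↔ x ∈ D.P (D.α s) := by
      intro x; rw [D.mem_P_iff hs, hPF]; simp
    have hcard : PF.card = E := by
      rw [hE, e, ← Nat.card_eq_finsetCard]
      exact Nat.card_congr (Equiv.subtypeEquivRight hmemPF)
    have hone : (1 : G) ∉ D.R.filter (fun t => D.α t = D.α s) := by simp [D.one_notin]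
    have hon : a * ∑ t ∈ D.R.filter (fun t => D.α t = D.α s),
        (C (D.α t y) * Θ t w - C (D.α t y) * Θ t (s⁻¹ * w)) =
        C (D.α s y) * ∑ t ∈ PF, ((F w - F (s⁻¹ * w)) -
          actP (D.ρ t⁻¹) (F (t⁻¹ * w) - F (t⁻¹ * (s⁻¹ * w)))) := by
      rw [hPF, Finset.sum_insert hone, Finset.mul_sum]
      simp only [inv_one, map_one, one_mul, actP_one, sub_self, zero_add, Finset.mul_sum]
      refine Finset.sum_congr rfl fun t ht => ?_
      rw [Finset.mem_filter] at ht
      have e1 := hΘ t ht.1 w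
      have e2 := hΘ t ht.1 (s⁻¹ * w)
      rw [ht.2, ← ha] at e1 e2
      rw [ht.2, map_sub]
      linear_combination (- C (D.α s y)) * e1 + C (D.α s y) * e2
    have hsum0 : ∑ t ∈ PF, (F (t⁻¹ * w) - F (t⁻¹ * (s⁻¹ * w))) = 0 := by
      rw [Finset.sum_sub_distrib, sub_eq_zero]
      refine Finset.sum_bij' (fun t _ => s⁻¹ * t) (fun t _ => s * t) ?_ ?_ ?_ ?_ ?_
      · intro t ht
        rw [hmemPF] at *
        exact mul_mem (inv_mem (D.self_mem_P hs)) ht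
      · intro t ht
        rw [hmemPF] at *
        exact mul_mem (D.self_mem_P hs) ht
      · intro t _; simp
      · intro t _; simp
      · intro t _; simp [mul_assoc]
    have hP : a ^ (E+1) ∣ ∑ t ∈ PF, actP (D.ρ t⁻¹) (F (t⁻¹ * w) - F (t⁻¹ * (s⁻¹ * w))) := by
      have : ∑ t ∈ PF, actP (D.ρ t⁻¹) (F (t⁻¹ * w) - F (t⁻¹ * (s⁻¹ * w))) =
          - ∑ t ∈ PF, ((F (t⁻¹ * w) - F (t⁻¹ * (s⁻¹ * w))) -
            actP (D.ρ t⁻¹) (F (t⁻¹ * w) - F (t⁻¹ * (s⁻¹ * w)))) := by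
        rw [Finset.sum_sub_distrib, hsum0]; ring
      rw [this, dvd_neg]
      refine Finset.dvd_sum fun t ht => ?_
      rw [hmemPF] at ht
      have hx : t⁻¹ * s * t ∈ D.P (D.α s) :=
        mul_mem (mul_mem (inv_mem ht) (D.self_mem_P hs)) ht
      obtain ⟨q, hq⟩ := h.dvdP hs hx (t⁻¹ * w)
      have e3 : (t⁻¹ * s * t)⁻¹ * (t⁻¹ * w) = t⁻¹ * (s⁻¹ * w) := by group
      rw [e3] at hq
      rw [hq, map_mul, D.act_pow_e hs (inv_mem ht), ← mul_sub, pow_succ]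
      exact mul_dvd_mul dvd_rfl (D.dvd_sub_act hs (inv_mem ht) q)
    have hfin : a * ((ddP y (F w) - ∑ t ∈ D.R, C (D.α t y) * Θ t w) -
        (ddP y (F (s⁻¹ * w)) - ∑ t ∈ D.R, C (D.α t y) * Θ t (s⁻¹ * w))) =
        a ^ (E+1) * ddP y g + C (D.α s y) *
          ∑ t ∈ PF, actP (D.ρ t⁻¹) (F (t⁻¹ * w) - F (t⁻¹ * (s⁻¹ * w))) -
        a * ∑ t ∈ D.R.filter (fun t => ¬ D.α t = D.α s),
          C (D.α t y) * (Θ t w - Θ t (s⁻¹ * w)) := by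
      rw [hsplit, hsplit]
      rw [Finset.sum_sub_distrib, Finset.sum_sub_distrib, Finset.sum_const, hcard, nsmul_eq_mul] at hon
      simp only [mul_sub (C _) (Θ _ _), Finset.sum_sub_distrib]
      linear_combination hder - hon
    change a ^ (E+1) ∣ a * ((ddP y (F w) - ∑ t ∈ D.R, C (D.α t y) * Θ t w) -
        (ddP y (F (s⁻¹ * w)) - ∑ t ∈ D.R, C (D.α t y) * Θ t (s⁻¹ * w)))
    rw [hfin]
    refine dvd_sub (dvd_add (dvd_mul_right _ _) (Dvd.dvd.mul_left hP _)) ?_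
    rw [pow_succ']
    refine mul_dvd_mul dvd_rfl (Finset.dvd_sum fun t ht => ?_)
    rw [Finset.mem_filter] at ht
    exact Dvd.dvd.mul_left (off t ht.1 ht.2) _

lemma exists_singular {L : Set (G → ℂ)} (hL : ∀ l ∈ L, ∀ x, (fun w => l (x * w)) ∈ L)
    {F₀ : G → MvPolynomial ι ℂ} (h₀ : D.IsQ L F₀) (hne : F₀ ≠ 0) :
    ∃ F, D.IsQ L F ∧ F ≠ 0 ∧ ∀ y w v, D.Reg v → eval v (ddP y (F w)) =
      ∑ t ∈ D.R, D.α t y / D.α t v * (eval v (F w) - eval (D.ρ t⁻¹ v) (F (t⁻¹ * w))) := by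
  classical
  have hex : ∃ m, ∃ F, D.IsQ L F ∧ F ≠ 0 ∧ ∀ w, DL m (F w) := by
    refine ⟨(∑ w, (F₀ w).totalDegree) + 1, F₀, h₀, hne, fun w => ?_⟩
    rw [DL_iff]
    exact Finset.single_le_sum (f := fun w => (F₀ w).totalDegree) (fun _ _ => Nat.zero_le _)
      (Finset.mem_univ w)
  obtain ⟨F, hF, hF0, hdeg⟩ := Nat.find_spec hex
  have hmin : ∀ k < Nat.find hex, ∀ F, D.IsQ L F → (∀ w, DL k (F w)) → F = 0 := by
    intro k hk F hF hd
    by_contra hh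
    exact Nat.find_min hex hk ⟨F, hF, hh, hd⟩
  set m := Nat.find hex with hm
  rcases hm' : m with _ | k
  · exfalso
    rw [hm'] at hdeg
    exact hF0 (funext fun w => DL_zero (hdeg w))
  rw [hm'] at hdeg
  obtain ⟨Θ, hΘ⟩ := hF.theta
  refine ⟨F, hF, hF0, fun y w v hv => ?_⟩
  have h1 := hmin k (by omega) _ (hF.dunkl hL hΘ y) (fun w => by
    refine ((hdeg w).dd y).sub (DL.sum fun t ht => DL.C_mul _ ?_)
    apply DL.linP_cancel (D.ane t ht)
    rw [← hΘ t ht]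
    exact (hdeg w).sub ((hdeg _).act _))
  have h2 := congrFun h1 w
  simp only [Pi.zero_apply, sub_eq_zero] at h2
  rw [h2, map_sum]
  refine Finset.sum_congr rfl fun t ht => ?_
  have h3 := congrArg (eval v) (hΘ t ht w)
  rw [map_sub, eval_actP, map_mul, eval_linP] at h3
  rw [h3, map_mul, eval_C]
  have := hv t ht
  field_simp

lemma hat_mem {F : G → MvPolynomial ι ℂ} (h : ∀ y w v, D.Reg v → eval v (ddP y (F w)) =
      ∑ t ∈ D.R, D.α t y / D.α t v * (eval v (F w) - eval (D.ρ t⁻¹ v) (F (t⁻¹ * w)))) (u : G) :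
    (fun w => actP (D.ρ w⁻¹) (F (w⁻¹ * u))) ∈ D.S := by
  intro v hv y w
  simp only []
  rw [ddP_actP, eval_actP, h _ _ _ (Reg.act D hv _)]
  rw [← D.sum_inv (fun t => D.α t y / D.α t v * _)]
  refine Eq.trans ?_ (D.sum_conj w _)
  refine Finset.sum_congr rfl fun t ht => ?_
  rw [D.ratio t ht, D.α_inv (D.conj t ht w), eval_actP, eval_actP]
  congr 2
  · rw [← Module.End.mul_apply, ← map_mul]
    simp [mul_assoc]

lemma exists_IsQ {L : Set (G → ℂ)} {j : G → ℂ} (hj : ∀ l ∈ L, ∑ w, l w * j w = 0) (hj0 : j ≠ 0) :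
    ∃ F, D.IsQ L F ∧ F ≠ 0 := by
  set p := ∏ t ∈ D.R, linP (D.α t) ^ D.e (D.α t) with hp
  have hp0 : p ≠ 0 := Finset.prod_ne_zero_iff.2 fun t ht => pow_ne_zero _ (linP_ne_zero (D.ane t ht))
  refine ⟨fun w => p * C (j w), ⟨?_, ?_⟩, ?_⟩
  · intro l hl
    have := congrArg (fun c => p * C c) (hj l hl)
    simp only [map_sum, Finset.mul_sum, map_zero, mul_zero, map_mul] at this
    rw [← this]
    exact Finset.sum_congr rfl fun w _ => by ring
  · intro s hs w
    rw [← mul_sub]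
    exact Dvd.dvd.mul_right (Finset.dvd_prod_of_mem (fun t => linP (D.α t) ^ D.e (D.α t)) hs) _
  · intro h
    apply hj0
    ext w
    have := congrFun h w
    simpa [hp0] using this

end RD

end Part3

section Part4

/-- semiprimeness of the complex group algebra, in coordinates -/
lemma semiprime_fun {G : Type*} [Group G] [Fintype G] (f : G → ℂ)
    (h : ∀ y z u, ∑ x, f (y * x⁻¹ * z) * f (x * u) = 0) : f = 0 := by
  set p : G → G → ℂ := fun a b => ∑ x, star (f (x * a)) * f (x * b) with hp
  have h1 : ∀ a c, ∑ b, p a b * p b c = 0 := by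
    intro a c
    have : ∀ b, p a b * p b c = ∑ x, star (f (x * a)) * ∑ x', f (x * b) * (star (f (x' * b)) * f (x' * c)) := by
      intro b
      rw [hp]
      simp only [Finset.sum_mul, Finset.mul_sum, mul_assoc]
      rw [Finset.sum_comm]
    simp only [this]
    rw [Finset.sum_comm]
    refine Finset.sum_eq_zero fun x _ => ?_
    rw [← Finset.mul_sum, Finset.sum_comm]
    have h2 : ∀ x', ∑ b, f (x * b) * (star (f (x' * b)) * f (x' * c)) =
        ∑ b, star (f b) * (f (x * x'⁻¹ * b) * f (x' * c)) := by
      intro x'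
      refine Fintype.sum_equiv (Equiv.mulLeft x') _ _ fun b => ?_
      simp only [Equiv.coe_mulLeft, mul_assoc, inv_mul_cancel_left]
      ring
    simp only [h2]
    rw [Finset.sum_comm]
    simp only [← Finset.mul_sum, h, mul_zero, Finset.sum_const_zero]
  have hstar : ∀ a b, p b a = star (p a b) := by
    intro a b
    simp only [hp, star_sum, star_mul', star_star]
    exact Finset.sum_congr rfl fun x _ => by ring
  have sq0 : ∀ k : G → ℂ, ∑ b, star (k b) * k b = 0 → ∀ b, k b = 0 := by
    intro k hk b
    have h3 : ∑ b, ‖k b‖ ^ 2 = 0 := by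
      have : ((∑ b, ‖k b‖ ^ 2 : ℝ) : ℂ) = 0 := by
        rw [← hk]; push_cast
        refine Finset.sum_congr rfl fun b _ => ?_
        exact (Complex.conj_mul' (k b)).symm
      exact_mod_cast this
    rw [Finset.sum_eq_zero_iff_of_nonneg (fun b _ => by positivity)] at h3
    have := h3 b (Finset.mem_univ b)
    simpa using this
  have hp0 : ∀ a b, p a b = 0 := by
    intro a
    apply sq0 (p a)
    rw [← h1 a a]
    exact Finset.sum_congr rfl fun b _ => by rw [hstar a b]; ring
  ext w
  have := sq0 (fun x => f (x * 1)) (hp0 1 1) w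
  simpa using this

namespace RD
open MvPolynomial
variable {G ι : Type*} [Group G] [Fintype G] [DecidableEq G] [Fintype ι] [DecidableEq ι] (D : RD G ι)

lemma T_one (F : G → MvPolynomial ι ℂ) : D.T 1 F = F := by
  ext1 w; rw [T_apply]; simp [actP_one]

/-- the annihilator of the flat sections -/
def I : Submodule ℂ (G → ℂ) where
  carrier := {a | ∀ F ∈ D.S, ∑ x, a x • D.T x F = 0}
  zero_mem' := by intro F _; simp
  add_mem' := by
    intro a b ha hb F hF
    simp only [Pi.add_apply, add_smul, Finset.sum_add_distrib, ha F hF, hb F hF, add_zero]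
  smul_mem' := by
    intro c a ha F hF
    simp only [Pi.smul_apply, smul_eq_mul, mul_smul, ← Finset.smul_sum, ha F hF, smul_zero]

lemma I_right {a : G → ℂ} (ha : a ∈ D.I) (x : G) : (fun w => a (w * x)) ∈ D.I := by
  intro F hF
  rw [← ha _ (D.T_mem x⁻¹ hF)]
  refine Fintype.sum_equiv (Equiv.mulRight x) _ _ fun w => ?_
  simp only [Equiv.coe_mulRight, ← T_mul, mul_inv_cancel_right]

lemma I_left {a : G → ℂ} (ha : a ∈ D.I) (x : G) : (fun w => a (x * w)) ∈ D.I := by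
  intro F hF
  have := congrArg (D.T x⁻¹) (ha F hF)
  rw [map_sum, map_zero] at this
  rw [← this]
  refine Fintype.sum_equiv (Equiv.mulLeft x) _ _ fun w => ?_
  simp only [Equiv.coe_mulLeft, map_smul, ← T_mul, inv_mul_cancel_left]

lemma faithful : D.I = ⊥ := by
  by_contra hI
  obtain ⟨a, ha, ha0⟩ := D.I.ne_bot_iff.1 hI
  set L : Set (G → ℂ) := {l | ∀ j : G → ℂ, (fun w => j w⁻¹) ∈ D.I → ∑ w, l w * j w = 0} with hLdef
  have hL : ∀ l ∈ L, ∀ x, (fun w => l (x * w)) ∈ L := by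
    intro l hl x j hj
    have := hl (fun w => j (x⁻¹ * w)) (by simpa using D.I_right hj x)
    rw [← this]
    refine Fintype.sum_equiv (Equiv.mulLeft x) _ _ fun w => ?_
    simp
  obtain ⟨F₀, hF₀, hne⟩ := exists_IsQ (D := D) (L := L) (j := fun w => a w⁻¹)
    (fun l hl => hl _ (by simpa using ha)) (by
      intro h; apply ha0; ext w
      simpa using congrFun h w⁻¹)
  obtain ⟨F, hF, hF0, hs⟩ := exists_singular hL hF₀ hne
  obtain ⟨w₀, hw₀⟩ := Function.ne_iff.1 hF0
  obtain ⟨v, hv⟩ : ∃ v, eval v (F w₀) ≠ 0 := by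
    by_contra hh
    push Not at hh
    exact hw₀ (evext (by simpa using hh))
  set f : G → ℂ := fun w => eval v (F w) with hf
  have hfJ : (fun w => f w⁻¹) ∈ D.I := by
    by_contra hn
    obtain ⟨φ, hφ, hker⟩ := Submodule.exists_le_ker_of_notMem hn
    apply hφ
    have hexp : ∀ k : G → ℂ, φ k = ∑ w, k w * φ (Pi.single w 1) := by
      intro k
      conv_lhs => rw [← Finset.univ_sum_single k]
      rw [map_sum]
      refine Finset.sum_congr rfl fun w _ => ?_
      have : (Pi.single w (k w) : G → ℂ) = k w • Pi.single w 1 := by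
        rw [← Pi.single_smul]; simp
      rw [this, map_smul, smul_eq_mul]
    have hl : (fun w => φ (Pi.single w⁻¹ 1)) ∈ L := by
      intro j hj
      have := hker hj
      rw [LinearMap.mem_ker, hexp] at this
      rw [← this]
      refine Fintype.sum_equiv (Equiv.inv G) _ _ fun w => ?_
      simp [mul_comm]
    have h1 := congrArg (eval v) (hF.ann _ hl)
    rw [map_sum, map_zero] at h1
    rw [hexp, ← h1]
    refine Fintype.sum_equiv (Equiv.inv G) _ _ fun w => ?_
    simp [mul_comm, hf]
  have hJf : ∀ b ∈ D.I, ∀ u, ∑ x, b x * f (x * u) = 0 := by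
    intro b hb u
    have := congrFun (hb _ (hat_mem hs u)) 1
    have h2 := congrArg (eval v) this
    rw [Finset.sum_apply, map_sum, Pi.zero_apply, map_zero] at h2
    rw [← h2]
    refine Finset.sum_congr rfl fun x _ => ?_
    rw [Pi.smul_apply, smul_eval, eval_T, eval_actP]
    simp [ρ_inv_apply, hf]
  have hf0 := semiprime_fun f (fun y z u => by
    have h1 := D.I_left (D.I_right hfJ y⁻¹) z⁻¹
    have := hJf _ h1 u
    simpa [mul_assoc] using this)
  exact hv (congrFun hf0 w₀)

/-- evaluation of flat sections at a point -/
def evS (v : ι → ℂ) : D.S →ₗ[ℂ] (G → ℂ) where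
  toFun F := fun w => eval v (F.1 w)
  map_add' := by intro F F'; ext w; simp
  map_smul' := by intro c F; ext w; simp

lemma evS_inj {v : ι → ℂ} (hv : D.Reg v) : Function.Injective (D.evS v) := by
  rw [← LinearMap.ker_eq_bot, LinearMap.ker_eq_bot']
  intro F hF
  ext1
  exact D.S_ext_zero F.2 hv (fun w => congrFun hF w)

def muS (v : ι → ℂ) : D.S →ₗ[ℂ] (G → ℂ) where
  toFun F := fun w => eval (D.ρ w⁻¹ v) (F.1 w⁻¹)
  map_add' := by intro F F'; ext w; simp
  map_smul' := by intro c F; ext w; simp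

lemma muS_surj {v : ι → ℂ} (hv : D.Reg v) : Function.Surjective (D.muS v) := by
  rw [← LinearMap.range_eq_top]
  by_contra hn
  obtain ⟨k, hk⟩ : ∃ k, k ∉ LinearMap.range (D.muS v) := by
    by_contra hh; push Not at hh
    exact hn (eq_top_iff.2 fun x _ => hh x)
  obtain ⟨φ, hφ, hker⟩ := Submodule.exists_le_ker_of_notMem hk
  have hexp : ∀ k : G → ℂ, φ k = ∑ w, φ (Pi.single w 1) * k w := by
    intro k
    conv_lhs => rw [← Finset.univ_sum_single k]
    rw [map_sum]
    refine Finset.sum_congr rfl fun w _ => ?_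
    have : (Pi.single w (k w) : G → ℂ) = k w • Pi.single w 1 := by
      rw [← Pi.single_smul]; simp
    rw [this, map_smul, smul_eq_mul, mul_comm]
  have ha : (fun w => φ (Pi.single w 1)) ∈ D.I := by
    intro F hF
    apply D.S_ext_zero (D.S.sum_mem fun x _ => D.S.smul_mem _ (D.T_mem x hF)) hv
    intro u
    have h1 : φ (D.muS v ⟨_, D.right_mem u hF⟩) = 0 :=
      hker (LinearMap.mem_range_self (D.muS v) ⟨_, D.right_mem u hF⟩)
    rw [hexp] at h1
    rw [Finset.sum_apply, map_sum, ← h1]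
    refine Finset.sum_congr rfl fun x _ => ?_
    rw [Pi.smul_apply, smul_eval, eval_T]
    rfl
  rw [D.faithful, Submodule.mem_bot] at ha
  apply hφ
  rw [hexp]
  exact Finset.sum_eq_zero fun w _ => by
    have := congrFun ha w
    simp only [Pi.zero_apply] at this
    rw [this, zero_mul]

lemma evS_surj {v : ι → ℂ} (hv : D.Reg v) : Function.Surjective (D.evS v) := by
  have : FiniteDimensional ℂ D.S := FiniteDimensional.of_injective _ (D.evS_inj hv)
  have h1 := LinearMap.finrank_le_finrank_of_injective (D.evS_inj hv)
  have h2 := LinearMap.finrank_le_finrank_of_surjective (D.muS_surj hv)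
  exact (LinearMap.injective_iff_surjective_of_finrank_eq_finrank (le_antisymm h1 h2)).1 (D.evS_inj hv)

end RD

end Part4

section Part5

section KA
variable {G : Type*} [Group G] [Fintype G] [DecidableEq G]

/-- group element in the group algebra -/
def gs (x : G) : MonoidAlgebra ℂ G := MonoidAlgebra.single x 1

lemma gs_mul (x y : G) : gs (x * y) = gs x * gs y := by simp [gs, MonoidAlgebra.single_mul_single]

lemma gs_one : gs (1 : G) = 1 := rfl

lemma gs_mul_inv (x : G) : gs x * gs x⁻¹ = 1 := by rw [← gs_mul]; simp [gs_one]

lemma gs_inv_mul (x : G) : gs x⁻¹ * gs x = 1 := by rw [← gs_mul]; simp [gs_one]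

lemma coeff_gs (x w : G) : (gs x).coeff w = if x = w then 1 else 0 := by
  simp [gs, Finsupp.single_apply]

lemma coeff_gs_mul (x w : G) (a : MonoidAlgebra ℂ G) : (gs x * a).coeff w = a.coeff (x⁻¹ * w) := by
  rw [gs, MonoidAlgebra.coeff_single_mul_eq_mul_coeff (x⁻¹ * w), one_mul]
  intro m _
  rw [eq_inv_mul_iff_mul_eq]

lemma coeff_mul_gs (x w : G) (a : MonoidAlgebra ℂ G) : (a * gs x).coeff w = a.coeff (w * x⁻¹) := by
  rw [gs, MonoidAlgebra.coeff_mul_single_eq_coeff_mul (w * x⁻¹), mul_one]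
  intro m _
  rw [eq_mul_inv_iff_mul_eq]

lemma ka_sum_coeff (s : Finset G) (f : G → MonoidAlgebra ℂ G) (w : G) :
    (∑ i ∈ s, f i).coeff w = ∑ i ∈ s, (f i).coeff w := by
  rw [MonoidAlgebra.coeff_sum, Finsupp.finsetSum_apply]

lemma ka_eq_sum (a : MonoidAlgebra ℂ G) : a = ∑ w, a.coeff w • gs w := by
  ext w
  simp [ka_sum_coeff, coeff_gs]

lemma ka_ext {a b : MonoidAlgebra ℂ G} (h : ∀ w, a.coeff w = b.coeff w) : a = b := by
  ext w; exact h w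

lemma ka_coeff_mul (a b : MonoidAlgebra ℂ G) (w : G) :
    (a * b).coeff w = ∑ x, a.coeff x * b.coeff (x⁻¹ * w) := by
  conv_lhs => rw [ka_eq_sum a, Finset.sum_mul]
  simp [ka_sum_coeff, coeff_gs_mul]

lemma ka_coeff_mul' (a b : MonoidAlgebra ℂ G) (w : G) :
    (a * b).coeff w = ∑ x, a.coeff (w * x⁻¹) * b.coeff x := by
  conv_lhs => rw [ka_eq_sum b, Finset.mul_sum]
  simp [ka_sum_coeff, coeff_mul_gs, mul_comm]

lemma tau_comm (a b : MonoidAlgebra ℂ G) : (a * b).coeff 1 = (b * a).coeff 1 := by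
  rw [ka_coeff_mul, ka_coeff_mul']
  exact Finset.sum_congr rfl fun x _ => by simp [mul_comm]

lemma eq_zero_of_tau {c : MonoidAlgebra ℂ G} (h : ∀ x, (c * x).coeff 1 = 0) : c = 0 := by
  ext w
  have := h (gs w⁻¹)
  rw [coeff_mul_gs] at this
  simpa using this

lemma central_of_gs {c : MonoidAlgebra ℂ G} (h : ∀ x, gs x * c = c * gs x) (a : MonoidAlgebra ℂ G) :
    a * c = c * a := by
  rw [ka_eq_sum a, Finset.sum_mul, Finset.mul_sum]
  refine Finset.sum_congr rfl fun x _ => ?_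
  rw [smul_mul_assoc, mul_smul_comm, h]

lemma central_zero {c : MonoidAlgebra ℂ G} (hc : ∀ a, a * c = c * a)
    (h : ∀ u : MonoidAlgebra ℂ G, (∀ a, a * u = u * a) → (c * u).coeff 1 = 0) : c = 0 := by
  apply eq_zero_of_tau
  intro x
  have h1 := h (∑ k, gs k * x * gs k⁻¹) (central_of_gs (fun y => by
    rw [Finset.mul_sum, Finset.sum_mul]
    refine Fintype.sum_equiv (Equiv.mulLeft y) _ _ fun k => ?_
    simp only [Equiv.coe_mulLeft, mul_inv_rev, gs_mul]
    simp only [mul_assoc, gs_inv_mul, mul_one]))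
  rw [Finset.mul_sum, ka_sum_coeff] at h1
  have h2 : ∀ k, (c * (gs k * x * gs k⁻¹)).coeff 1 = (c * x).coeff 1 := by
    intro k
    rw [← mul_assoc, tau_comm, ← mul_assoc, ← mul_assoc, hc, mul_assoc c, gs_inv_mul, mul_one]
  simp only [h2, Finset.sum_const, nsmul_eq_mul] at h1
  rcases mul_eq_zero.1 h1 with h | h
  · simp at h
  · exact h

lemma trace_mulLeft (a : MonoidAlgebra ℂ G) :
    LinearMap.trace ℂ _ (LinearMap.mulLeft ℂ a) = Fintype.card G * a.coeff 1 := by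
  let b : Module.Basis G ℂ (MonoidAlgebra ℂ G) := ⟨MonoidAlgebra.coeffLinearEquiv ℂ⟩
  have hb : ∀ x, b x = gs x := fun x => rfl
  rw [LinearMap.trace_eq_matrix_trace ℂ b, Matrix.trace]
  have : ∀ x, (LinearMap.toMatrix b b (LinearMap.mulLeft ℂ a)).diag x = a.coeff 1 := by
    intro x
    rw [Matrix.diag_apply, LinearMap.toMatrix_apply, hb, LinearMap.mulLeft_apply]
    change (a * gs x).coeff x = _
    rw [coeff_mul_gs, mul_inv_cancel]
  simp only [this, Finset.sum_const, nsmul_eq_mul, Finset.card_univ]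

instance ka_fin : Module.Finite ℂ (MonoidAlgebra ℂ G) :=
  Module.Finite.of_basis (⟨MonoidAlgebra.coeffLinearEquiv ℂ⟩ : Module.Basis G ℂ (MonoidAlgebra ℂ G))

lemma tau_algEquiv (σ : MonoidAlgebra ℂ G ≃ₐ[ℂ] MonoidAlgebra ℂ G) (a : MonoidAlgebra ℂ G) :
    (σ a).coeff 1 = a.coeff 1 := by
  have h := LinearMap.trace_conj' (LinearMap.mulLeft ℂ a) σ.toLinearEquiv
  have h2 : σ.toLinearEquiv.conj (LinearMap.mulLeft ℂ a) = LinearMap.mulLeft ℂ (σ a) := by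
    refine LinearMap.ext fun x => ?_
    change σ (a * σ.symm x) = σ a * x
    rw [map_mul, AlgEquiv.apply_symm_apply]
  rw [h2, trace_mulLeft, trace_mulLeft] at h
  exact mul_left_cancel₀ (by simp) h

lemma tau_integral {x : MonoidAlgebra ℂ G} {n : ℕ} (hn : 0 < n) (hx : x ^ (n+1) = x) :
    IsIntegral ℤ ((Fintype.card G : ℂ) * x.coeff 1) := by
  rw [← trace_mulLeft]
  set f : Module.End ℂ (MonoidAlgebra ℂ G) := LinearMap.mulLeft ℂ x with hf
  have hfn : f ^ (n+1) = f := by rw [hf, LinearMap.pow_mulLeft, hx]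
  rw [Module.End.trace_eq_sum_roots_charpoly_of_splits (IsAlgClosed.splits _)]
  apply IsIntegral.multiset_sum
  intro μ hμ
  have hev : Module.End.HasEigenvalue f μ := by
    rw [Module.End.hasEigenvalue_iff_isRoot_charpoly]
    exact (Polynomial.mem_roots'.1 hμ).2
  obtain ⟨v, hv⟩ := hev.exists_hasEigenvector
  have h1 : μ ^ (n+1) = μ := by
    have h2 := hv.pow_apply (n+1)
    rw [hfn, hv.apply_eq_smul] at h2
    exact (smul_left_injective ℂ hv.2 h2).symm
  rcases eq_or_ne μ 0 with h0 | h0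
  · rw [h0]; exact isIntegral_zero
  · refine IsIntegral.of_pow hn ?_
    have : μ ^ n = 1 := mul_right_cancel₀ h0 (by rw [← pow_succ, h1, one_mul])
    rw [this]; exact isIntegral_one

/-- rational coefficients -/
def IsRat (a : MonoidAlgebra ℂ G) : Prop := ∀ w, ∃ q : ℚ, a.coeff w = q

lemma IsRat.add {a b : MonoidAlgebra ℂ G} (ha : IsRat a) (hb : IsRat b) : IsRat (a + b) := by
  intro w
  obtain ⟨p, hp⟩ := ha w
  obtain ⟨q, hq⟩ := hb w
  exact ⟨p + q, by simp [hp, hq]⟩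

lemma IsRat.smul {a : MonoidAlgebra ℂ G} (ha : IsRat a) (q : ℚ) : IsRat ((q : ℂ) • a) := by
  intro w
  obtain ⟨p, hp⟩ := ha w
  exact ⟨q * p, by simp [hp]⟩

lemma IsRat.mul {a b : MonoidAlgebra ℂ G} (ha : IsRat a) (hb : IsRat b) : IsRat (a * b) := by
  intro w
  choose p hp using ha
  choose q hq using hb
  exact ⟨∑ x, p x * q (x⁻¹ * w), by rw [ka_coeff_mul]; push_cast; simp [hp, hq]⟩

lemma IsRat.gs (x : G) : IsRat (gs x) := by
  intro w
  rw [coeff_gs]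
  split_ifs
  · exact ⟨1, by simp⟩
  · exact ⟨0, by simp⟩

lemma IsRat.sum {κ : Type*} {s : Finset κ} {f : κ → MonoidAlgebra ℂ G} (h : ∀ i ∈ s, IsRat (f i)) :
    IsRat (∑ i ∈ s, f i) := by
  classical
  induction s using Finset.induction_on with
  | empty => intro w; exact ⟨0, by simp⟩
  | insert a s ha ih =>
    rw [Finset.sum_insert ha]
    exact (h a (by simp)).add (ih fun i hi => h i (by simp [hi]))

lemma IsRat.one : IsRat (1 : MonoidAlgebra ℂ G) := by rw [← gs_one]; exact IsRat.gs 1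

lemma IsRat.pow {a : MonoidAlgebra ℂ G} (ha : IsRat a) (n : ℕ) : IsRat (a ^ n) := by
  induction n with
  | zero => rw [pow_zero]; exact IsRat.one
  | succ n ih => rw [pow_succ]; exact ih.mul ha

lemma int_of_rat_integral {b : ℂ} (h : IsIntegral ℤ b) (q : ℚ) (hq : b = q) : ∃ m : ℤ, b = m := by
  rw [hq] at h
  have h1 : IsIntegral ℤ q := by
    have : (q : ℂ) = algebraMap ℚ ℂ q := rfl
    rw [this] at h
    exact (isIntegral_algebraMap_iff (algebraMap ℚ ℂ).injective).1 h
  obtain ⟨m, hm⟩ := IsIntegrallyClosed.isIntegral_iff.1 h1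
  refine ⟨m, ?_⟩
  rw [hq, ← hm]; simp

end KA

end Part5

section Part6

namespace RD
open MvPolynomial
variable {G ι : Type*} [Group G] [Fintype G] [DecidableEq G] [Fintype ι] [DecidableEq ι]

/-- value in the group algebra of a section under a functional -/
def val (φ : MvPolynomial ι ℂ →ₗ[ℂ] ℂ) (F : G → MvPolynomial ι ℂ) : MonoidAlgebra ℂ G :=
  ∑ w, φ (F w) • gs w

lemma coeff_val (φ : MvPolynomial ι ℂ →ₗ[ℂ] ℂ) (F : G → MvPolynomial ι ℂ) (w : G) :
    (val φ F).coeff w = φ (F w) := by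
  simp [val, ka_sum_coeff, coeff_gs]

/-- right multiplication -/
def rmul (a : MonoidAlgebra ℂ G) (F : G → MvPolynomial ι ℂ) : G → MvPolynomial ι ℂ :=
  fun w => ∑ x, a.coeff x • F (w * x⁻¹)

lemma val_rmul (φ : MvPolynomial ι ℂ →ₗ[ℂ] ℂ) (a : MonoidAlgebra ℂ G) (F : G → MvPolynomial ι ℂ) :
    val φ (rmul a F) = val φ F * a := by
  apply ka_ext
  intro w
  rw [coeff_val, ka_coeff_mul', rmul, map_sum]
  refine Finset.sum_congr rfl fun x _ => ?_
  rw [coeff_val, map_smul, smul_eq_mul, mul_comm]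

lemma val_left (φ : MvPolynomial ι ℂ →ₗ[ℂ] ℂ) (x : G) (F : G → MvPolynomial ι ℂ) :
    val φ (fun w => F (x⁻¹ * w)) = gs x * val φ F := by
  apply ka_ext
  intro w
  rw [coeff_val, coeff_gs_mul, coeff_val]

/-- evaluation functional -/
def evL (v : ι → ℂ) : MvPolynomial ι ℂ →ₗ[ℂ] ℂ := (MvPolynomial.aeval v : _ →ₐ[ℂ] ℂ).toLinearMap

lemma evL_apply (v : ι → ℂ) (f : MvPolynomial ι ℂ) : evL v f = eval v f := by
  change MvPolynomial.aeval v f = _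
  rw [MvPolynomial.aeval_eq_eval]

/-- coefficient along a line -/
def coL (x y : ι → ℂ) (m : ℕ) : MvPolynomial ι ℂ →ₗ[ℂ] ℂ :=
  Polynomial.lcoeff ℂ m ∘ₗ (lineP x y).toLinearMap

lemma coL_apply (x y : ι → ℂ) (m : ℕ) (f : MvPolynomial ι ℂ) : coL x y m f = (lineP x y f).coeff m := rfl

variable (D : RD G ι)

lemma rmul_mem (a : MonoidAlgebra ℂ G) {F : G → MvPolynomial ι ℂ} (hF : F ∈ D.S) : rmul a F ∈ D.S := by
  have : rmul a F = ∑ x, a.coeff x • (fun w => F (w * x⁻¹)) := by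
    ext1 w; simp [rmul, Finset.sum_apply]
  rw [this]
  exact D.S.sum_mem fun x _ => D.S.smul_mem _ (D.right_mem x⁻¹ hF)

lemma T_rmul (x : G) (a : MonoidAlgebra ℂ G) (F : G → MvPolynomial ι ℂ) :
    D.T x (rmul a F) = rmul a (D.T x F) := by
  ext1 w
  simp [rmul, T_apply, mul_assoc]

lemma line_id {x₀ y : ι → ℂ} (hB : ∀ s ∈ D.R, D.α s x₀ = 0 → D.α s y ≠ 0)
    {F : G → MvPolynomial ι ℂ} (hF : F ∈ D.S) :
    ∃ q : Polynomial ℂ, q.eval 0 ≠ 0 ∧ (∀ x, x ≠ 0 → q.eval x ≠ 0 → D.Reg (x₀ + x • y)) ∧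
      ((∀ s ∈ D.R, D.α s x₀ = 0) → q = 1) ∧
      ∀ w, ∃ Z : G → Polynomial ℂ, ((∀ s ∈ D.R, D.α s x₀ = 0) → Z = 0) ∧
      Polynomial.X * q * Polynomial.derivative (lineP x₀ y (F w)) =
      q * (∑ s ∈ D.R.filter (fun s => D.α s x₀ = 0), (lineP x₀ y (F w) - lineP x₀ y (F (s⁻¹ * w)))) +
        Polynomial.X * ∑ s ∈ D.R, Z s * (lineP x₀ y (F w) - lineP x₀ y (F (s⁻¹ * w))) := by
  classical
  set B' := D.R.filter (fun s => ¬ D.α s x₀ = 0) with hB'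
  set q : Polynomial ℂ := ∏ s ∈ B', lineP x₀ y (linP (D.α s)) with hq
  have hev : ∀ x, q.eval x = ∏ s ∈ B', D.α s (x₀ + x • y) := by
    intro x; rw [hq, Polynomial.eval_prod]
    exact Finset.prod_congr rfl fun s _ => by rw [eval_lineP, eval_linP]
  have hq0 : q.eval 0 ≠ 0 := by
    rw [hev, Finset.prod_ne_zero_iff]
    intro s hs
    rw [hB', Finset.mem_filter] at hs
    simpa using hs.2
  have hreg : ∀ x, x ≠ 0 → q.eval x ≠ 0 → D.Reg (x₀ + x • y) := by
    intro x hx hqx s hs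
    by_cases h0 : D.α s x₀ = 0
    · rw [map_add, h0, zero_add, map_smul, smul_eq_mul]
      exact mul_ne_zero hx (hB s hs h0)
    · rw [hev, Finset.prod_ne_zero_iff] at hqx
      exact hqx s (by rw [hB', Finset.mem_filter]; exact ⟨hs, h0⟩)
  have hempty : (∀ s ∈ D.R, D.α s x₀ = 0) → B' = ∅ := by
    intro h
    rw [hB', Finset.filter_eq_empty_iff]
    intro s hs; simpa using h s hs
  refine ⟨q, hq0, hreg, fun h => by rw [hq, hempty h]; simp, fun w => ?_⟩
  refine ⟨fun s => if s ∈ B' then Polynomial.C (D.α s y) * ∏ s' ∈ B'.erase s, lineP x₀ y (linP (D.α s')) else 0,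
    fun h => by rw [hempty h]; ext1 s; simp, ?_⟩
  have hXq : Polynomial.X * q ≠ 0 := by
    refine mul_ne_zero Polynomial.X_ne_zero ?_
    intro h; rw [h] at hq0; simp at hq0
  apply mul_left_cancel₀ hXq
  apply Polynomial.funext
  intro x
  have key : ∀ a b c : Polynomial ℂ, (a.eval x ≠ 0 → b.eval x = c.eval x) →
      (a * b).eval x = (a * c).eval x := by
    intro a b c h
    rw [Polynomial.eval_mul, Polynomial.eval_mul]
    by_cases h0 : a.eval x = 0
    · rw [h0, zero_mul, zero_mul]
    · rw [h h0]
  apply key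
  intro hx0
  rw [Polynomial.eval_mul, Polynomial.eval_X, mul_ne_zero_iff] at hx0
  obtain ⟨hx, hqx⟩ := hx0
  have hR := hreg x hx hqx
  rw [derivative_lineP, Polynomial.eval_mul, eval_lineP, hF _ hR]
  rw [← Finset.sum_filter_add_sum_filter_not D.R (fun s => D.α s x₀ = 0), ← hB', mul_add]
  simp only [Polynomial.eval_mul, Polynomial.eval_add, Polynomial.eval_X, Polynomial.eval_finsetSum]
  congr 1
  · rw [mul_comm x, mul_assoc]
    congr 1
    rw [Finset.mul_sum]
    refine Finset.sum_congr rfl fun s hs => ?_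
    rw [Finset.mem_filter] at hs
    have h1 := hB s hs.1 hs.2
    rw [map_add, hs.2, zero_add, map_smul, smul_eq_mul, Polynomial.eval_sub, eval_lineP, eval_lineP]
    field_simp
  · rw [mul_assoc]
    congr 1
    rw [Finset.mul_sum]
    have : ∀ s, s ∈ D.R → s ∉ B' → 
      (Polynomial.eval x (if s ∈ B' then Polynomial.C (D.α s y) * ∏ s' ∈ B'.erase s, lineP x₀ y (linP (D.α s')) else 0) *
        Polynomial.eval x (lineP x₀ y (F w) - lineP x₀ y (F (s⁻¹ * w)))) = 0 := by
      intro s _ hs; simp [hs]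
    rw [← Finset.sum_subset (Finset.filter_subset _ _) this]
    refine Finset.sum_congr rfl fun s hs => ?_
    rw [if_pos hs]
    have h2 := hR s (Finset.mem_of_mem_filter s hs)
    have h3 : q.eval x = D.α s (x₀ + x • y) * Polynomial.eval x (∏ s' ∈ B'.erase s, lineP x₀ y (linP (D.α s'))) := by
      rw [hq, ← Finset.mul_prod_erase B' _ hs, Polynomial.eval_mul, eval_lineP, eval_linP]
    rw [h3, Polynomial.eval_sub, eval_lineP, eval_lineP, Polynomial.eval_mul, Polynomial.eval_C]
    field_simp

lemma line_lead {x₀ y : ι → ℂ} (hB : ∀ s ∈ D.R, D.α s x₀ = 0 → D.α s y ≠ 0)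
    {F : G → MvPolynomial ι ℂ} (hF : F ∈ D.S) {m : ℕ} (hm : ∀ w, Polynomial.X ^ m ∣ lineP x₀ y (F w)) (w : G) :
    (m : ℂ) * coL x₀ y m (F w) = ∑ s ∈ D.R.filter (fun s => D.α s x₀ = 0),
      (coL x₀ y m (F w) - coL x₀ y m (F (s⁻¹ * w))) := by
  choose g hg using hm
  have hc : ∀ w, coL x₀ y m (F w) = (g w).eval 0 := by
    intro w
    rw [coL_apply, hg, Polynomial.coeff_X_pow_mul', if_pos le_rfl, Nat.sub_self,
      Polynomial.coeff_zero_eq_eval_zero]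
  obtain ⟨q, hq0, -, -, hid⟩ := D.line_id hB hF
  obtain ⟨Z, -, hid⟩ := hid w
  simp only [hg, ← mul_sub, Polynomial.derivative_mul, Polynomial.derivative_X_pow] at hid
  have h2 : q * ((m : Polynomial ℂ) * g w + Polynomial.X * Polynomial.derivative (g w)) =
      q * (∑ s ∈ D.R.filter (fun s => D.α s x₀ = 0), (g w - g (s⁻¹ * w))) +
        Polynomial.X * ∑ s ∈ D.R, Z s * (g w - g (s⁻¹ * w)) := by
    apply mul_left_cancel₀ (pow_ne_zero m (Polynomial.X_ne_zero (R := ℂ)))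
    simp only [mul_left_comm (Z _), ← Finset.mul_sum] at hid
    rcases m with _ | m
    · simp at hid ⊢
      linear_combination hid
    · simp only [Nat.add_sub_cancel, Polynomial.C_eq_natCast] at hid
      linear_combination hid
  have h3 := congrArg (Polynomial.eval 0) h2
  simp only [Polynomial.eval_mul, Polynomial.eval_add, Polynomial.eval_X, zero_mul, add_zero,
    Polynomial.eval_finsetSum, Polynomial.eval_natCast, Polynomial.eval_sub] at h3
  simp only [hc]
  exact mul_left_cancel₀ hq0 h3

/-- the class sum of reflections -/
def z : MonoidAlgebra ℂ G := ∑ t ∈ D.R, gs t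

lemma z_central (a : MonoidAlgebra ℂ G) : a * D.z = D.z * a := by
  apply central_of_gs
  intro x
  rw [z, Finset.mul_sum, Finset.sum_mul, ← D.sum_conj x (fun t => gs t * gs x)]
  refine Finset.sum_congr rfl fun t _ => ?_
  rw [← gs_mul, ← gs_mul]; simp [mul_assoc]

lemma coeff_z_mul (a : MonoidAlgebra ℂ G) (w : G) : (D.z * a).coeff w = ∑ t ∈ D.R, a.coeff (t⁻¹ * w) := by
  rw [z, Finset.sum_mul, ka_sum_coeff]
  simp only [coeff_gs_mul]

/-- radial expansion -/
lemma radial {v : ι → ℂ} (hv : D.Reg v) {F : G → MvPolynomial ι ℂ} (hF : F ∈ D.S) (k : ℕ) :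
    (D.R.card : ℂ) • val (coL 0 v k) F - D.z * val (coL 0 v k) F = (k : ℂ) • val (coL 0 v k) F := by
  obtain ⟨q, -, -, hq, hid⟩ := D.line_id (x₀ := 0) (y := v) (fun s hs _ => hv s hs) hF
  apply ka_ext
  intro w
  obtain ⟨Z, hZ, hid⟩ := hid w
  rw [hq (by simp), hZ (by simp)] at hid
  simp at hid
  have := congrArg (fun p => Polynomial.coeff p k) hid
  simp only [Polynomial.coeff_sub, Polynomial.finsetSum_coeff] at this
  simp only [MonoidAlgebra.coeff_sub, Finsupp.sub_apply, coeff_z_mul, MonoidAlgebra.coeff_smul,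
    Finsupp.smul_apply, coeff_val, smul_eq_mul, coL_apply]
  have h2 : (k : ℂ) * (lineP 0 v (F w)).coeff k =
      (Polynomial.X * Polynomial.derivative (lineP 0 v (F w))).coeff k := by
    rcases k with _ | k
    · simp
    · simp [Polynomial.coeff_derivative, mul_comm]
  rw [h2]
  simpa [nsmul_eq_mul, Polynomial.coeff_natCast_mul] using this.symm

end RD

end Part6

section Part7

namespace RD
open MvPolynomial
variable {G ι : Type*} [Group G] [Fintype G] [DecidableEq G] [Fintype ι] [DecidableEq ι]
variable (D : RD G ι)

/-- normalized fundamental flat section -/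
structure PD (D : RD G ι) where
  v0 : ι → ℂ
  reg : D.Reg v0
  Ψ : G → MvPolynomial ι ℂ
  mem : Ψ ∈ D.S
  norm : val (evL v0) Ψ = 1

lemma exists_PD {v : ι → ℂ} (hv : D.Reg v) : ∃ p : PD D, p.v0 = v := by
  obtain ⟨F, hF⟩ := D.evS_surj hv (fun w => (1 : MonoidAlgebra ℂ G).coeff w)
  refine ⟨⟨v, hv, F.1, F.2, ?_⟩, rfl⟩
  apply ka_ext
  intro w
  rw [coeff_val, evL_apply]
  exact congrFun hF w

variable {D}
variable (p : PD D)

lemma PD.rep {F : G → MvPolynomial ι ℂ} (hF : F ∈ D.S) : F = rmul (val (evL p.v0) F) p.Ψ := by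
  refine D.S_ext hF (D.rmul_mem _ p.mem) p.reg fun w => ?_
  rw [← evL_apply, ← evL_apply, ← coeff_val, ← coeff_val, val_rmul, p.norm, one_mul]

/-- the twist on group elements -/
def PD.σ0 (x : G) : MonoidAlgebra ℂ G := val (evL p.v0) (D.T x p.Ψ)

lemma PD.T_Ψ (x : G) : D.T x p.Ψ = rmul (p.σ0 x) p.Ψ := p.rep (D.T_mem x p.mem)

lemma PD.val_T (φ : MvPolynomial ι ℂ →ₗ[ℂ] ℂ) (x : G) :
    val φ (D.T x p.Ψ) = val φ p.Ψ * p.σ0 x := by rw [p.T_Ψ, val_rmul]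

lemma PD.σ0_mul (x y : G) : p.σ0 (x * y) = p.σ0 x * p.σ0 y := by
  rw [PD.σ0, T_mul, p.T_Ψ y, T_rmul, val_rmul]; rfl

lemma PD.σ0_one : p.σ0 1 = 1 := by rw [PD.σ0, T_one, p.norm]

lemma val_T_ev (x : G) (v : ι → ℂ) (F : G → MvPolynomial ι ℂ) :
    val (evL v) (D.T x F) = gs x * val (evL (D.ρ x⁻¹ v)) F := by
  apply ka_ext
  intro w
  rw [coeff_val, coeff_gs_mul, coeff_val, evL_apply, evL_apply, eval_T]

/-- the twist -/
def PD.σ1 : MonoidAlgebra ℂ G →ₐ[ℂ] MonoidAlgebra ℂ G :=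
  MonoidAlgebra.lift ℂ _ G ⟨⟨p.σ0, p.σ0_one⟩, p.σ0_mul⟩

lemma PD.σ1_gs (x : G) : p.σ1 (gs x) = p.σ0 x := by
  simp [PD.σ1, gs]

lemma PD.σ1_inj : Function.Injective p.σ1 := by
  rw [injective_iff_map_eq_zero]
  intro a ha
  have hI : (fun w => a.coeff w) ∈ D.I := by
    intro F hF
    have h1 : ∑ x, a.coeff x • D.T x p.Ψ = 0 := by
      have hm : ∑ x, a.coeff x • D.T x p.Ψ ∈ D.S :=
        D.S.sum_mem fun x _ => D.S.smul_mem _ (D.T_mem x p.mem)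
      refine D.S_ext_zero hm p.reg fun w => ?_
      rw [ka_eq_sum a, map_sum] at ha
      have h2 := congrArg (fun u => u.coeff w) ha
      simp only [ka_sum_coeff, map_smul, p.σ1_gs, MonoidAlgebra.coeff_smul, Finsupp.smul_apply, PD.σ0,
        coeff_val, evL_apply] at h2
      rw [Finset.sum_apply, map_sum]
      simpa [smul_eval] using h2
    have h3 : ∑ x, a.coeff x • D.T x F = rmul (val (evL p.v0) F) (∑ x, a.coeff x • D.T x p.Ψ) := by
      conv_lhs => rw [p.rep hF]
      simp only [T_rmul]
      ext1 w
      simp only [rmul, Finset.sum_apply, Pi.smul_apply, Finset.smul_sum]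
      rw [Finset.sum_comm]
      refine Finset.sum_congr rfl fun x _ => Finset.sum_congr rfl fun y _ => ?_
      rw [smul_comm]
    rw [h3, h1]
    ext1 w
    simp [rmul]
  rw [D.faithful, Submodule.mem_bot] at hI
  apply ka_ext
  intro w
  simpa using congrFun hI w

/-- the twist as an equivalence -/
def PD.σ : MonoidAlgebra ℂ G ≃ₐ[ℂ] MonoidAlgebra ℂ G :=
  AlgEquiv.ofBijective p.σ1 ⟨p.σ1_inj, (LinearMap.injective_iff_surjective (f := p.σ1.toLinearMap)).1 p.σ1_inj⟩

lemma PD.σ_gs (x : G) : p.σ (gs x) = p.σ0 x := p.σ1_gs x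

lemma unit_of_inj {b : MonoidAlgebra ℂ G} (h : ∀ a, b * a = 0 → a = 0) : ∃ c, b * c = 1 ∧ c * b = 1 := by
  have hi : Function.Injective (LinearMap.mulLeft ℂ b) := by
    rw [← LinearMap.ker_eq_bot, LinearMap.ker_eq_bot']
    exact h
  obtain ⟨c, hc⟩ := (LinearMap.injective_iff_surjective.1 hi) 1
  have hc : b * c = 1 := hc
  refine ⟨c, hc, ?_⟩
  rw [← sub_eq_zero]
  apply h
  rw [mul_sub, ← mul_assoc, hc]; simp

lemma PD.tau_of_intertwine {b : MonoidAlgebra ℂ G} (h : ∀ a, b * a = 0 → a = 0) {t : G}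
    (ht : b * p.σ0 t = gs t * b) {u : MonoidAlgebra ℂ G} (hu : ∀ a, a * u = u * a) :
    (p.σ0 t * u).coeff 1 = (gs t * u).coeff 1 := by
  obtain ⟨c, h1, h2⟩ := unit_of_inj h
  have : p.σ0 t = c * (gs t * b) := by rw [← ht, ← mul_assoc, h2, one_mul]
  rw [this, mul_assoc, tau_comm, mul_assoc, mul_assoc, ← hu c, ← mul_assoc b, h1, one_mul]

open Classical in
/-- reflections with the same hyperplane -/
def BB (D : RD G ι) (t : G) : Finset G := D.R.filter (fun s => D.α s = D.α t)

lemma mem_BB {t s : G} : s ∈ BB D t ↔ s ∈ D.R ∧ D.α s = D.α t := by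
  classical
  rw [BB, Finset.mem_filter]

lemma one_notin_BB {t : G} : 1 ∉ BB D t := fun h => D.one_notin (mem_BB.1 h).1

/-- sum over the stabilizer -/
def EE (D : RD G ι) (t : G) : MonoidAlgebra ℂ G := ∑ s ∈ insert 1 (BB D t), gs s

lemma mem_ins {t : G} (ht : t ∈ D.R) (w : G) :
    w ∈ insert 1 (BB D t) ↔ w ∈ D.P (D.α t) := by
  rw [D.mem_P_iff ht, Finset.mem_insert, mem_BB]

lemma card_ins {t : G} (ht : t ∈ D.R) : (BB D t).card + 1 = D.e (D.α t) := by
  rw [← Finset.card_insert_of_notMem (a := 1) one_notin_BB, e]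
  rw [← Nat.card_eq_finsetCard]
  exact Nat.card_congr (Equiv.subtypeEquivRight (mem_ins ht))

lemma gs_EE {t : G} (ht : t ∈ D.R) {x : G} (hx : x ∈ D.P (D.α t)) : gs x * EE D t = EE D t := by
  rw [EE, Finset.mul_sum]
  refine Finset.sum_bij (fun s _ => x * s) ?_ ?_ ?_ ?_
  · intro s hs; rw [mem_ins ht] at hs ⊢; exact mul_mem hx hs
  · intro a _ b _ h; exact mul_left_cancel h
  · intro s hs; rw [mem_ins ht] at hs
    exact ⟨x⁻¹ * s, by rw [mem_ins ht]; exact mul_mem (inv_mem hx) hs, by simp⟩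
  · intro s _; rw [gs_mul]

lemma EE_gs {t : G} (ht : t ∈ D.R) {x : G} (hx : x ∈ D.P (D.α t)) : EE D t * gs x = EE D t := by
  rw [EE, Finset.sum_mul]
  refine Finset.sum_bij (fun s _ => s * x) ?_ ?_ ?_ ?_
  · intro s hs; rw [mem_ins ht] at hs ⊢; exact mul_mem hs hx
  · intro a _ b _ h; exact mul_right_cancel h
  · intro s hs; rw [mem_ins ht] at hs
    exact ⟨s * x⁻¹, by rw [mem_ins ht]; exact mul_mem hs (inv_mem hx), by simp⟩
  · intro s _; rw [gs_mul]

lemma EE_EE {t : G} (ht : t ∈ D.R) : EE D t * EE D t = (D.e (D.α t) : ℂ) • EE D t := by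
  have h : EE D t * EE D t = ∑ s ∈ insert 1 (BB D t), gs s * EE D t := by
    rw [← Finset.sum_mul]; rfl
  rw [h, Finset.sum_congr rfl fun s hs => gs_EE ht ((mem_ins ht s).1 hs), Finset.sum_const,
    Finset.card_insert_of_notMem one_notin_BB, card_ins ht,
    Nat.cast_smul_eq_nsmul]

lemma exists_h0 {t : G} (ht : t ∈ D.R) : ∃ h : ι → ℂ, D.α t h = 0 ∧ ∀ s ∈ D.R, D.α s h = 0 → D.α s = D.α t := by
  classical
  set r := D.r t
  let π : (ι → ℂ) →ₗ[ℂ] (ι → ℂ) := LinearMap.id - ((D.α t r)⁻¹ • D.α t).smulRight r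
  have hπ : ∀ x, π x = x - ((D.α t r)⁻¹ * D.α t x) • r := fun x => by simp [π]
  have h0 : ∀ x, D.α t (π x) = 0 := by
    intro x
    have := D.rne t ht
    rw [hπ, map_sub, map_smul, smul_eq_mul, mul_right_comm, inv_mul_cancel₀ this, one_mul, sub_self]
  set Q := D.R.filter (fun s => D.α s ≠ D.α t) with hQ
  have hne : ∏ s ∈ Q, linP (D.α s ∘ₗ π) ≠ 0 := by
    rw [Finset.prod_ne_zero_iff]
    intro s hs
    rw [hQ, Finset.mem_filter] at hs
    apply linP_ne_zero
    intro h
    apply hs.2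
    symm
    refine D.same t ht s hs.1 fun x hx => ?_
    have h2 := LinearMap.congr_fun h x
    simpa [hπ, hx] using h2
  obtain ⟨x, hx⟩ : ∃ x, eval x (∏ s ∈ Q, linP (D.α s ∘ₗ π)) ≠ 0 := by
    by_contra hc
    push Not at hc
    exact hne (evext fun v => by rw [hc v, map_zero])
  refine ⟨π x, h0 x, fun s hs h => ?_⟩
  by_contra hn
  rw [map_prod, Finset.prod_ne_zero_iff] at hx
  have := hx s (by rw [hQ, Finset.mem_filter]; exact ⟨hs, hn⟩)
  rw [eval_linP] at this
  exact this h

end RD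

end Part7

section Part8

namespace RD
open MvPolynomial
variable {G ι : Type*} [Group G] [Fintype G] [DecidableEq G] [Fintype ι] [DecidableEq ι]
variable {D : RD G ι}

/-- leading term map -/
def lam (D : RD G ι) (t : G) (h : ι → ℂ) (F : G → MvPolynomial ι ℂ) : MonoidAlgebra ℂ G :=
  EE D t * val (coL h (D.r t) 0) F +
    ((D.e (D.α t) : ℂ) • 1 - EE D t) * val (coL h (D.r t) (D.e (D.α t))) F

lemma lam_rmul (t : G) (h : ι → ℂ) (a : MonoidAlgebra ℂ G) (F : G → MvPolynomial ι ℂ) :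
    lam D t h (rmul a F) = lam D t h F * a := by
  simp only [lam, val_rmul, add_mul, mul_assoc]

lemma lam_inj {t : G} (ht : t ∈ D.R) {h : ι → ℂ} (h1 : D.α t h = 0)
    (h2 : ∀ s ∈ D.R, D.α s h = 0 → D.α s = D.α t) {F : G → MvPolynomial ι ℂ} (hF : F ∈ D.S)
    (h0 : lam D t h F = 0) : F = 0 := by
  classical
  set e := D.e (D.α t) with he
  have he0 : (e : ℂ) ≠ 0 := Nat.cast_ne_zero.2 (D.e_pos _).ne'
  set r := D.r t with hr
  have hB : ∀ s ∈ D.R, D.α s h = 0 → D.α s r ≠ 0 := by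
    intro s hs hsh; rw [h2 s hs hsh]; exact D.rne t ht
  have hfil : D.R.filter (fun s => D.α s h = 0) = BB D t := by
    ext s
    rw [Finset.mem_filter, mem_BB]
    exact ⟨fun ⟨a, b⟩ => ⟨a, h2 s a b⟩, fun ⟨a, b⟩ => ⟨a, by rw [b, h1]⟩⟩
  have hEE := EE_EE ht
  rw [← he] at hEE
  have hc0 : EE D t * val (coL h r 0) F = 0 := by
    have := congrArg (fun x => EE D t * x) h0
    simp only [lam, ← he, ← hr, mul_add, ← mul_assoc, mul_sub, hEE, mul_zero, mul_smul_comm, mul_one,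
      sub_self, zero_mul, add_zero, smul_mul_assoc] at this
    exact (smul_eq_zero.1 this).resolve_left he0
  have hce : (e : ℂ) • val (coL h r e) F = EE D t * val (coL h r e) F := by
    rw [lam, ← hr, hc0, zero_add, ← he, sub_mul, smul_mul_assoc, one_mul, sub_eq_zero] at h0
    exact h0
  have hlead : ∀ m : ℕ, (∀ w, Polynomial.X ^ m ∣ lineP h r (F w)) →
      (m : ℂ) • val (coL h r m) F = (e : ℂ) • val (coL h r m) F - EE D t * val (coL h r m) F := by
    intro m hm
    apply ka_ext
    intro w
    have := D.line_lead hB hF hm w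
    rw [hfil, Finset.sum_sub_distrib, Finset.sum_const, nsmul_eq_mul] at this
    rw [EE, Finset.sum_mul, Finset.sum_insert one_notin_BB, gs_one, one_mul]
    simp only [MonoidAlgebra.coeff_sub, MonoidAlgebra.coeff_add, Finsupp.add_apply, Finsupp.sub_apply, MonoidAlgebra.coeff_smul,
      Finsupp.smul_apply, ka_sum_coeff, coeff_gs_mul, coeff_val, smul_eq_mul]
    rw [this, he, ← card_ins ht]
    push_cast
    ring
  have key : ∀ (m : ℕ) w, Polynomial.X ^ m ∣ lineP h r (F w) := by
    intro m
    induction m with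
    | zero => intro w; simp
    | succ m ih =>
      have hl := hlead m ih
      have hz : val (coL h r m) F = 0 := by
        rcases Nat.eq_zero_or_pos m with hm | hm
        · subst hm
          rw [hc0, sub_zero, Nat.cast_zero, zero_smul] at hl
          exact (smul_eq_zero.1 hl.symm).resolve_left he0
        · have hm0 : (m : ℂ) ≠ 0 := Nat.cast_ne_zero.2 hm.ne'
          by_cases hme : m = e
          · subst hme
            rw [hce, sub_self, ← hce] at hl
            exact (smul_eq_zero.1 hl).resolve_left he0
          · have h3 : EE D t * val (coL h r m) F = 0 := by
              have := congrArg (fun x => EE D t * x) hl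
              simp only [mul_sub, ← mul_assoc, hEE, mul_smul_comm, smul_mul_assoc, sub_self] at this
              exact (smul_eq_zero.1 this).resolve_left hm0
            rw [h3, sub_zero, ← sub_eq_zero, ← sub_smul] at hl
            refine (smul_eq_zero.1 hl).resolve_left ?_
            rw [sub_eq_zero]
            exact_mod_cast hme
      intro w
      refine X_pow_succ_dvd (ih w) ?_
      have := congrArg (fun x => x.coeff w) hz
      simpa [coeff_val, coL_apply] using this
  have hline : ∀ w, lineP h r (F w) = 0 := fun w => eq_zero_of_dvd fun m => key m w
  obtain ⟨q, hq0, hreg, -, -⟩ := D.line_id hB hF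
  have hXq : Polynomial.X * q ≠ 0 := by
    refine mul_ne_zero Polynomial.X_ne_zero ?_
    intro h; rw [h] at hq0; simp at hq0
  obtain ⟨x, hx⟩ : ∃ x, (Polynomial.X * q).eval x ≠ 0 := by
    by_contra hc
    push Not at hc
    exact hXq (Polynomial.funext fun x => by rw [hc x, Polynomial.eval_zero])
  rw [Polynomial.eval_mul, Polynomial.eval_X, mul_ne_zero_iff] at hx
  refine D.S_ext_zero hF (hreg x hx.1 hx.2) fun w => ?_
  rw [← eval_lineP, hline, Polynomial.eval_zero]

lemma lam_T {t : G} (ht : t ∈ D.R) {h : ι → ℂ} (h1 : D.α t h = 0) (F : G → MvPolynomial ι ℂ) :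
    lam D t h (D.T t F) = gs t * lam D t h F := by
  have htP := D.self_mem_P ht
  obtain ⟨c, hc, hcα⟩ := D.α_scale ht (inv_mem htP)
  have hh : D.ρ t⁻¹ h = h := (D.mem_P.1 (inv_mem htP)) h h1
  have hrr : D.ρ t⁻¹ (D.r t) = c • D.r t := by
    have e1 : D.ρ t (D.r t) = (1 + D.α t (D.r t)) • D.r t := by
      rw [D.refl t ht, add_smul, one_smul]
    have e2 := congrArg (D.ρ t⁻¹) e1
    rw [D.ρ_inv_apply', map_smul] at e2
    have e3 := congrArg (D.α t) e2
    rw [map_smul, hcα, smul_eq_mul] at e3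
    have e4 : (1 + D.α t (D.r t)) * c = 1 := by
      have := D.rne t ht
      apply mul_right_cancel₀ this
      rw [one_mul, mul_assoc, ← e3]
    have e5 : c • D.r t = c • ((1 + D.α t (D.r t)) • D.ρ t⁻¹ (D.r t)) := by rw [← e2]
    rw [e5, smul_smul, mul_comm, e4, one_smul]
  have hco : ∀ m, val (coL h (D.r t) m) (D.T t F) = c ^ m • (gs t * val (coL h (D.r t) m) F) := by
    intro m
    apply ka_ext
    intro w
    rw [MonoidAlgebra.coeff_smul, Finsupp.smul_apply, coeff_gs_mul, coeff_val, coeff_val, coL_apply, coL_apply,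
      smul_eq_mul]
    have : lineP h (D.r t) (D.T t F w) = (lineP h (D.r t) (F (t⁻¹ * w))).comp (Polynomial.C c * Polynomial.X) := by
      apply Polynomial.funext
      intro x
      rw [eval_lineP, eval_T, Polynomial.eval_comp, eval_lineP, map_add, hh, map_smul, hrr, smul_smul, Polynomial.eval_mul, Polynomial.eval_C,
        Polynomial.eval_X, mul_comm c]
    rw [this, Polynomial.comp_C_mul_X_coeff, mul_comm]
  rw [lam, hco, hco, hc, pow_zero, one_smul, one_smul, lam, mul_add, ← mul_assoc, ← mul_assoc, ← mul_assoc,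
    ← mul_assoc, EE_gs ht htP, gs_EE ht htP, sub_mul, mul_sub, EE_gs ht htP, gs_EE ht htP]
  simp

variable (p : PD D)

lemma PD.tau_refl {t : G} (ht : t ∈ D.R) {u : MonoidAlgebra ℂ G} (hu : ∀ a, a * u = u * a) :
    (p.σ0 t * u).coeff 1 = (gs t * u).coeff 1 := by
  obtain ⟨h, h1, h2⟩ := exists_h0 ht
  refine p.tau_of_intertwine (b := lam D t h p.Ψ) ?_ ?_ hu
  · intro a ha
    rw [← lam_rmul] at ha
    have := lam_inj ht h1 h2 (D.rmul_mem a p.mem) ha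
    have h3 := val_rmul (evL p.v0) a p.Ψ
    rw [this, p.norm, one_mul] at h3
    rw [← h3]
    simp [val]
  · rw [← lam_rmul, ← p.T_Ψ, lam_T ht h1]

lemma PD.σ_z : p.σ D.z = D.z := by
  rw [← sub_eq_zero]
  apply central_zero
  · intro a
    obtain ⟨a', rfl⟩ := p.σ.surjective a
    rw [mul_sub, sub_mul, D.z_central, ← map_mul, ← map_mul, D.z_central]
  · intro u hu
    rw [sub_mul, MonoidAlgebra.coeff_sub, Finsupp.sub_apply, sub_eq_zero, z, map_sum, Finset.sum_mul, Finset.sum_mul,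
      ka_sum_coeff, ka_sum_coeff]
    refine Finset.sum_congr rfl fun t ht => ?_
    rw [p.σ_gs, p.tau_refl ht hu]

end RD

end Part8

section Part9

namespace RD
open MvPolynomial
variable {G ι : Type*} [Group G] [Fintype G] [DecidableEq G] [Fintype ι] [DecidableEq ι]
variable {D : RD G ι}
variable (p : PD D)

/-- degree components -/
def PD.ε (k : ℕ) : MonoidAlgebra ℂ G := val (coL 0 p.v0 k) p.Ψ

/-- degree bound -/
def PD.M : ℕ := Finset.univ.sup fun w => (lineP 0 p.v0 (p.Ψ w)).natDegree

lemma PD.sum_ε (c : ℂ) : ∑ k ∈ Finset.range (p.M + 1), c ^ k • p.ε k = val (evL (c • p.v0)) p.Ψ := by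
  apply ka_ext
  intro w
  rw [MonoidAlgebra.coeff_sum, Finsupp.finsetSum_apply, coeff_val, evL_apply]
  have h := eval_lineP 0 p.v0 (p.Ψ w) c
  rw [zero_add] at h
  rw [← h, Polynomial.eval_eq_sum_range' (n := p.M + 1)]
  · refine Finset.sum_congr rfl fun k _ => ?_
    rw [MonoidAlgebra.coeff_smul, Finsupp.smul_apply, PD.ε, coeff_val, coL_apply, smul_eq_mul, mul_comm]
  · exact Nat.lt_succ_of_le (Finset.le_sup (f := fun w => (lineP 0 p.v0 (p.Ψ w)).natDegree) (Finset.mem_univ w))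

lemma PD.sum_ε_one : ∑ k ∈ Finset.range (p.M + 1), p.ε k = 1 := by
  have := p.sum_ε 1
  simpa [p.norm] using this

lemma PD.z_ε (k : ℕ) : D.z * p.ε k = ((D.R.card : ℂ) - k) • p.ε k := by
  have := D.radial p.reg p.mem k
  rw [sub_smul, PD.ε, ← this]
  abel

lemma PD.aeval_ε (f : Polynomial ℂ) (k : ℕ) :
    Polynomial.aeval D.z f * p.ε k = f.eval ((D.R.card : ℂ) - k) • p.ε k := by
  induction f using Polynomial.induction_on' with
  | add f g hf hg => rw [map_add, add_mul, hf, hg, Polynomial.eval_add, add_smul]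
  | monomial n a =>
    rw [Polynomial.aeval_monomial, Polynomial.eval_monomial, ← Algebra.smul_def, smul_mul_assoc, mul_smul]
    congr 1
    induction n with
    | zero => simp
    | succ n ih => rw [pow_succ, mul_assoc, p.z_ε, mul_smul_comm, ih, smul_smul, pow_succ, mul_comm]

lemma PD.aeval_eq (f : Polynomial ℂ) :
    Polynomial.aeval D.z f = ∑ k ∈ Finset.range (p.M + 1), f.eval ((D.R.card : ℂ) - k) • p.ε k := by
  rw [← mul_one (Polynomial.aeval D.z f), ← p.sum_ε_one, Finset.mul_sum]
  exact Finset.sum_congr rfl fun k _ => p.aeval_ε f k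

/-- interpolation polynomials -/
def PD.lag (k : ℕ) : Polynomial ℚ :=
  Lagrange.basis (Finset.range (p.M + 1)) (fun k : ℕ => (D.R.card : ℚ) - k) k

lemma PD.lag_eval {j k : ℕ} (hk : k ∈ Finset.range (p.M + 1)) (hj : j ∈ Finset.range (p.M + 1)) :
    ((p.lag k).map (algebraMap ℚ ℂ)).eval ((D.R.card : ℂ) - j) = if j = k then 1 else 0 := by
  have h1 : ((D.R.card : ℂ) - j) = algebraMap ℚ ℂ ((D.R.card : ℚ) - j) := by simp
  rw [h1, Polynomial.eval_map_algebraMap, Polynomial.aeval_algebraMap_apply, Polynomial.coe_aeval_eq_eval]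
  split_ifs with h
  · subst h
    rw [PD.lag, Lagrange.eval_basis_self (v := fun k : ℕ => (D.R.card : ℚ) - k) _ hk, map_one]
    intro a _ b _ hab
    have : (a : ℚ) = b := by simpa using hab
    exact_mod_cast this
  · rw [PD.lag, Lagrange.eval_basis_of_ne (v := fun k : ℕ => (D.R.card : ℚ) - k) (Ne.symm h) hj, map_zero]

lemma PD.ε_eq {k : ℕ} (hk : k ∈ Finset.range (p.M + 1)) :
    p.ε k = Polynomial.aeval D.z ((p.lag k).map (algebraMap ℚ ℂ)) := by
  rw [p.aeval_eq, Finset.sum_congr rfl fun j hj => by rw [p.lag_eval hk hj]]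
  simp only [ite_smul, one_smul, zero_smul]
  rw [Finset.sum_ite_eq', if_pos hk]

lemma PD.ε_mul {j k : ℕ} (hk : k ∈ Finset.range (p.M + 1)) (hj : j ∈ Finset.range (p.M + 1)) :
    p.ε j * p.ε k = if k = j then p.ε k else 0 := by
  rw [p.ε_eq hj, p.aeval_ε, p.lag_eval hj hk]
  simp

lemma PD.ε_central {k : ℕ} (hk : k ∈ Finset.range (p.M + 1)) (a : MonoidAlgebra ℂ G) :
    a * p.ε k = p.ε k * a := by
  rw [p.ε_eq hk, Polynomial.aeval_eq_sum_range]
  refine (Commute.sum_right _ _ _ fun i _ => ?_ : Commute a _)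
  exact ((show Commute a D.z from D.z_central a).pow_right i).smul_right _

lemma z_rat : IsRat D.z := IsRat.sum fun t _ => IsRat.gs t

lemma PD.ε_rat {k : ℕ} (hk : k ∈ Finset.range (p.M + 1)) : IsRat (p.ε k) := by
  rw [p.ε_eq hk, Polynomial.aeval_eq_sum_range]
  refine IsRat.sum fun i _ => ?_
  rw [Polynomial.coeff_map]
  exact (z_rat.pow i).smul _

lemma PD.σ_ε {k : ℕ} (hk : k ∈ Finset.range (p.M + 1)) : p.σ (p.ε k) = p.ε k := by
  rw [p.ε_eq hk, ← Polynomial.aeval_algHom_apply, p.σ_z]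

lemma PD.root_cond {k : ℕ} (hk : k ∈ Finset.range (p.M + 1)) {g : G} {ζ : ℂ} (hg : D.ρ g p.v0 = ζ • p.v0) :
    (p.ε k).coeff g = ζ ^ k * (p.ε k).coeff g := by
  have h1 : p.σ (gs g⁻¹ * p.ε k) = ζ ^ k • (gs g⁻¹ * p.ε k) := by
    rw [map_mul, p.σ_ε hk, p.σ_gs, PD.σ0, val_T_ev, inv_inv, hg, ← p.sum_ε, mul_assoc, Finset.sum_mul]
    rw [Finset.sum_congr rfl fun j hj => by rw [smul_mul_assoc, p.ε_mul hk hj]]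
    simp only [smul_ite, smul_zero]
    rw [Finset.sum_ite_eq, if_pos hk, mul_smul_comm]
  have h2 := tau_algEquiv p.σ (gs g⁻¹ * p.ε k)
  rw [h1, MonoidAlgebra.coeff_smul, Finsupp.smul_apply, coeff_gs_mul, inv_inv, mul_one, smul_eq_mul] at h2
  exact h2.symm

lemma PD.int_cond {k : ℕ} (hk : k ∈ Finset.range (p.M + 1)) (g : G) :
    ∃ m : ℤ, (Fintype.card G : ℂ) * (p.ε k).coeff g = m := by
  have hx : (p.ε k).coeff g = (gs g⁻¹ * p.ε k).coeff 1 := by rw [coeff_gs_mul, inv_inv, mul_one]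
  have hidem : p.ε k * p.ε k = p.ε k := by rw [p.ε_mul hk hk, if_pos rfl]
  have hpow : ∀ n, (gs g⁻¹ * p.ε k) ^ (n + 1) = gs ((g⁻¹) ^ (n + 1)) * p.ε k := by
    intro n
    induction n with
    | zero => simp
    | succ n ih =>
      rw [pow_succ, ih, pow_succ g⁻¹ (n + 1), gs_mul]
      rw [mul_assoc, ← mul_assoc (p.ε k), ← p.ε_central hk, mul_assoc (gs g⁻¹), hidem, mul_assoc]
  have hInt : IsIntegral ℤ ((Fintype.card G : ℂ) * (gs g⁻¹ * p.ε k).coeff 1) := by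
    refine tau_integral (n := orderOf g) (orderOf_pos g) ?_
    rw [hpow, pow_succ, inv_pow, pow_orderOf_eq_one, inv_one, one_mul]
  obtain ⟨q, hq⟩ := p.ε_rat hk g
  rw [← hx] at hInt
  exact int_of_rat_integral hInt (Fintype.card G * q) (by rw [hq]; push_cast; rfl)

theorem main_RD (D : RD G ι) {g : G} {d l : ℕ} {ζ : ℂ} {v : ι → ℂ} (hv : D.Reg v) (hζ : IsPrimitiveRoot ζ d)
    (hg : D.ρ g v = ζ • v) (h0 : ∀ j < l, (D.z ^ j).coeff g = 0) :
    ∃ m : ℤ, (Fintype.card G : ℂ) * (D.z ^ l).coeff g = m * d ^ l * l.factorial := by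
  obtain ⟨p, rfl⟩ := D.exists_PD hv
  have hB : ∀ k, ∃ m : ℤ, k ∈ Finset.range (p.M + 1) → (Fintype.card G : ℂ) * (p.ε k).coeff g = m := by
    intro k
    by_cases hk : k ∈ Finset.range (p.M + 1)
    · obtain ⟨m, hm⟩ := p.int_cond hk g
      exact ⟨m, fun _ => hm⟩
    · exact ⟨0, fun h => absurd h hk⟩
  choose B hB using hB
  set Q : Polynomial ℂ := ∏ i ∈ Finset.range l, (Polynomial.X - Polynomial.C ((D.R.card : ℂ) - d * i)) with hQ
  have hmonic : Q.Monic := Polynomial.monic_prod_of_monic _ _ fun i _ => Polynomial.monic_X_sub_C _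
  have hdeg : Q.natDegree = l := by
    rw [hQ, Polynomial.natDegree_prod_of_monic _ _ fun i _ => Polynomial.monic_X_sub_C _]
    simp only [Polynomial.natDegree_X_sub_C, Finset.sum_const, Finset.card_range, smul_eq_mul, mul_one]
  have hQz : (Polynomial.aeval D.z Q).coeff g = (D.z ^ l).coeff g := by
    rw [Polynomial.aeval_eq_sum_range, hdeg, MonoidAlgebra.coeff_sum, Finsupp.finsetSum_apply, Finset.sum_range_succ,
      Finset.sum_eq_zero, zero_add]
    · have : Q.coeff l = 1 := by rw [← hdeg]; exact hmonic
      rw [this, one_smul]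
    · intro i hi
      rw [MonoidAlgebra.coeff_smul, Finsupp.smul_apply, h0 i (Finset.mem_range.1 hi), smul_zero]
  refine ⟨(-1) ^ l * ∑ k ∈ Finset.range (p.M + 1), B k * (k / d).choose l, ?_⟩
  rw [← hQz, p.aeval_eq, MonoidAlgebra.coeff_sum, Finsupp.finsetSum_apply, Finset.mul_sum]
  push_cast
  rw [Finset.mul_sum, Finset.sum_mul, Finset.sum_mul]
  refine Finset.sum_congr rfl fun k hk => ?_
  rw [MonoidAlgebra.coeff_smul, Finsupp.smul_apply, smul_eq_mul, mul_left_comm, hB k hk]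
  by_cases hdk : d ∣ k
  · obtain ⟨k', rfl⟩ := hdk
    have hev : Q.eval ((D.R.card : ℂ) - (d * k' : ℕ)) = (-1) ^ l * d ^ l * (k'.descFactorial l : ℂ) := by
      rw [hQ, Polynomial.eval_prod]
      have h1 : ∀ i ∈ Finset.range l, (Polynomial.X - Polynomial.C ((D.R.card : ℂ) - d * i)).eval
          ((D.R.card : ℂ) - (d * k' : ℕ)) = (-1) * d * ((k' : ℂ) - i) := by
        intro i _
        simp only [Polynomial.eval_sub, Polynomial.eval_X, Polynomial.eval_C]
        push_cast; ring
      rw [Finset.prod_congr rfl h1, Finset.prod_mul_distrib, Finset.prod_const, Finset.card_range, mul_pow]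
      congr 1
      rw [← descPochhammer_eval_eq_descFactorial, descPochhammer_eval_eq_prod_range]
    rw [hev]
    rcases Nat.eq_zero_or_pos d with hd | hd
    · subst hd
      rcases Nat.eq_zero_or_pos l with hl | hl
      · subst hl; simp
      · simp [hl.ne']
    · rw [Nat.mul_div_cancel_left _ hd, Nat.descFactorial_eq_factorial_mul_choose]
      push_cast
      ring
  · have h1 := p.root_cond hk hg
    have h2 : (p.ε k).coeff g = 0 := by
      by_contra hne
      apply hdk
      apply hζ.dvd_of_pow_eq_one
      apply mul_right_cancel₀ hne
      rw [← h1, one_mul]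
    have h3 := hB k hk
    rw [h2, mul_zero] at h3
    rw [← h3]
    simp

end RD

end Part9

namespace RD
variable {G ι : Type*} [Group G] [Fintype G] [DecidableEq G] [Fintype ι] [DecidableEq ι]

open Classical in
lemma coeff_z_pow (D : RD G ι) (l : ℕ) (w : G) :
    (D.z ^ l).coeff w = ∑ f : Fin l → G, if (∀ i, f i ∈ D.R) ∧ (List.ofFn f).prod = w then (1 : ℂ) else 0 := by
  induction l generalizing w with
  | zero =>
    rw [pow_zero, ← gs_one, coeff_gs]
    simp
  | succ l ih =>
    rw [pow_succ', D.coeff_z_mul, ← (Fin.consEquiv (fun _ => G)).sum_comp, Fintype.sum_prod_type,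
      ← Finset.sum_subset (Finset.subset_univ D.R)]
    · refine Finset.sum_congr rfl fun t ht => ?_
      rw [ih]
      refine Finset.sum_congr rfl fun f _ => ?_
      have h1 : ((∀ i, (Fin.consEquiv (fun _ => G)) (t, f) i ∈ D.R) ∧
          (List.ofFn ((Fin.consEquiv (fun _ => G)) (t, f))).prod = w) ↔
          ((∀ i, f i ∈ D.R) ∧ (List.ofFn f).prod = t⁻¹ * w) := by
        simp only [Fin.consEquiv_apply, Fin.forall_fin_succ, Fin.cons_zero, Fin.cons_succ, List.ofFn_succ,
          List.prod_cons, ht, true_and, eq_inv_mul_iff_mul_eq]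
      rw [if_congr h1.symm rfl rfl]
    · intro t _ ht
      refine Finset.sum_eq_zero fun f _ => ?_
      rw [if_neg]
      rintro ⟨h, -⟩
      exact ht (h 0)

lemma coeff_z_pow_card (D : RD G ι) (l : ℕ) (w : G) :
    (D.z ^ l).coeff w = Nat.card {f : Fin l → G // (∀ i, f i ∈ D.R) ∧ (List.ofFn f).prod = w} := by
  classical
  rw [coeff_z_pow, Finset.sum_boole, Nat.card_eq_fintype_card, Fintype.card_subtype]

end RD

section transport
variable [FiniteDimensional ℂ V]

open Classical in
/-- a linear form with prescribed kernel -/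
def formOf (H : Submodule ℂ V) : V →ₗ[ℂ] ℂ :=
  if h : ∃ l : V →ₗ[ℂ] ℂ, LinearMap.ker l = H then h.choose else 0

lemma ker_formOf {H : Submodule ℂ V} (h : Module.finrank ℂ V = Module.finrank ℂ H + 1) :
    LinearMap.ker (formOf H) = H := by
  have h1 : ∃ l : V →ₗ[ℂ] ℂ, LinearMap.ker l = H := by
    have h2 := Submodule.finrank_quotient_add_finrank H
    have h3 : Module.finrank ℂ (V ⧸ H) = Module.finrank ℂ ℂ := by
      rw [Module.finrank_self]; omega
    let e := LinearEquiv.ofFinrankEq _ _ h3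
    refine ⟨e.toLinearMap ∘ₗ H.mkQ, ?_⟩
    rw [LinearEquiv.ker_comp, Submodule.ker_mkQ]
  rw [formOf, dif_pos h1]
  exact h1.choose_spec

lemma form_prop {U : Type*} [AddCommGroup U] [Module ℂ U] {l m : U →ₗ[ℂ] ℂ} (h : ∀ x, l x = 0 → m x = 0)
    (hm : m ≠ 0) : ∃ c : ℂ, c ≠ 0 ∧ ∀ x, m x = c * l x := by
  have hl : ∃ u, l u ≠ 0 := by
    by_contra hc
    push Not at hc
    exact hm (LinearMap.ext fun x => h x (hc x))
  obtain ⟨u, hu⟩ := hl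
  have hx : ∀ x, m x = m u / l u * l x := by
    intro x
    have := h (x - (l x / l u) • u) (by rw [map_sub, map_smul, smul_eq_mul]; field_simp; ring)
    rw [map_sub, map_smul, smul_eq_mul, sub_eq_zero] at this
    rw [this]; field_simp
  refine ⟨m u / l u, ?_, hx⟩
  intro h0
  apply hm
  ext x
  rw [hx, h0]; simp

variable (W : Subgroup (V →ₗ[ℂ] V)ˣ)

/-- the form of an element -/
def fm (t : W) : V →ₗ[ℂ] ℂ := formOf (fixedSpace (t : (V →ₗ[ℂ] V)ˣ))

variable {W}

lemma mem_fixed (t : W) (x : V) : x ∈ fixedSpace (t : (V →ₗ[ℂ] V)ˣ) ↔ toLin W t x = x := by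
  rw [fixedSpace, LinearMap.mem_ker, LinearMap.sub_apply, sub_eq_zero]; rfl

lemma fm_zero {t : W} (ht : t ∈ refls W) (x : V) : fm W t x = 0 ↔ toLin W t x = x := by
  rw [← mem_fixed, ← ker_formOf (H := fixedSpace (t : (V →ₗ[ℂ] V)ˣ)) ht, LinearMap.mem_ker]
  rfl

lemma fm_congr {s t : W} (h : ∀ x, toLin W s x = x ↔ toLin W t x = x) : fm W s = fm W t := by
  rw [fm, fm]
  congr 1
  ext x
  rw [mem_fixed, mem_fixed, h]

lemma fm_ne {t : W} (ht : t ∈ refls W) : fm W t ≠ 0 := by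
  intro h
  have h1 : fixedSpace (t : (V →ₗ[ℂ] V)ˣ) = ⊤ := by
    rw [Submodule.eq_top_iff']
    intro x
    rw [mem_fixed, ← fm_zero ht, h]; rfl
  have h2 : Module.finrank ℂ V = Module.finrank ℂ (fixedSpace (t : (V →ₗ[ℂ] V)ˣ)) + 1 := ht
  rw [h1, finrank_top] at h2
  omega

lemma toLin_one : toLin W 1 = LinearMap.id := rfl

lemma toLin_mul (a b : W) (x : V) : toLin W (a * b) x = toLin W a (toLin W b x) := rfl

lemma toLin_inj {a b : W} (h : ∀ x, toLin W a x = toLin W b x) : a = b :=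
  Subtype.ext (Units.ext (LinearMap.ext h))

lemma toLin_inv (a : W) (x : V) : toLin W a (toLin W a⁻¹ x) = x := by
  rw [← toLin_mul, mul_inv_cancel]; rfl

lemma toLin_inv' (a : W) (x : V) : toLin W a⁻¹ (toLin W a x) = x := by
  rw [← toLin_mul, inv_mul_cancel]; rfl

lemma one_notin_refls : (1 : W) ∉ refls W := by
  intro h
  apply fm_ne h
  ext x
  exact (fm_zero h x).2 rfl

lemma exists_root {t : W} (ht : t ∈ refls W) : ∃ r, ∀ x, toLin W t x = x + fm W t x • r := by
  obtain ⟨u, hu⟩ : ∃ u, fm W t u ≠ 0 := by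
    by_contra hc
    push Not at hc
    exact fm_ne ht (LinearMap.ext hc)
  refine ⟨(fm W t u)⁻¹ • (toLin W t u - u), fun x => ?_⟩
  have h1 := (fm_zero ht (x - (fm W t x * (fm W t u)⁻¹) • u)).1 (by
    rw [map_sub, map_smul, smul_eq_mul, mul_assoc, inv_mul_cancel₀ hu, mul_one, sub_self])
  rw [map_sub, map_smul] at h1
  rw [smul_smul, smul_sub]
  rw [sub_eq_iff_eq_add] at h1
  rw [h1]
  abel

/-- a root -/
def rt (t : W) : V := by
  classical exact
  if h : t ∈ refls W then (exists_root h).choose else 0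

lemma rt_spec {t : W} (ht : t ∈ refls W) (x : V) : toLin W t x = x + fm W t x • rt t := by
  rw [rt, dif_pos ht]
  exact (exists_root ht).choose_spec x

lemma rt_ne [Finite W] {t : W} (ht : t ∈ refls W) : fm W t (rt t) ≠ 0 := by
  intro h
  have h1 : ∀ (k : ℕ) x, toLin W (t ^ k) x = x + ((k : ℂ) * fm W t x) • rt t := by
    intro k
    induction k with
    | zero => intro x; simp [toLin_one]
    | succ k ih =>
      intro x
      rw [pow_succ, toLin_mul, ih, rt_spec ht, map_add, map_smul, h]
      push_cast
      module
  apply one_notin_refls (W := W)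
  have h2 : t = 1 := by
    apply toLin_inj
    intro x
    have h3 := h1 (orderOf t) x
    rw [pow_orderOf_eq_one, toLin_one, LinearMap.id_apply, left_eq_add, mul_smul, smul_eq_zero] at h3
    rw [rt_spec ht, h3.resolve_left (Nat.cast_ne_zero.2 (orderOf_pos t).ne'), add_zero]; rfl
  rwa [← h2]

lemma conj_mem {t : W} (ht : t ∈ refls W) (w : W) : w * t * w⁻¹ ∈ refls W := by
  have h2 : Module.finrank ℂ V = Module.finrank ℂ (fixedSpace (t : (V →ₗ[ℂ] V)ˣ)) + 1 := ht
  let e : V ≃ₗ[ℂ] V := LinearEquiv.ofLinearMap (toLin W w) (toLin W w⁻¹)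
    (LinearMap.ext (toLin_inv w)) (LinearMap.ext (toLin_inv' w))
  have h3 : fixedSpace ((w * t * w⁻¹ : W) : (V →ₗ[ℂ] V)ˣ) =
      (fixedSpace (t : (V →ₗ[ℂ] V)ˣ)).map (e : V →ₗ[ℂ] V) := by
    ext x
    rw [Submodule.mem_map, mem_fixed, toLin_mul, toLin_mul]
    constructor
    · intro hx
      refine ⟨toLin W w⁻¹ x, ?_, toLin_inv w x⟩
      rw [mem_fixed]
      have := congrArg (toLin W w⁻¹) hx
      rwa [toLin_inv'] at this
    · rintro ⟨y, hy, rfl⟩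
      rw [mem_fixed] at hy
      change toLin W w (toLin W t (toLin W w⁻¹ (toLin W w y))) = toLin W w y
      rw [toLin_inv', hy]
  change Module.finrank ℂ V = Module.finrank ℂ (fixedSpace ((w * t * w⁻¹ : W) : (V →ₗ[ℂ] V)ˣ)) + 1
  rw [h3, LinearEquiv.finrank_map_eq, h2]

lemma stabV {s : W} (hs : s ∈ refls W) (w : W) : (∀ x, fm W s x = 0 → toLin W w x = x) ↔
    (w = 1 ∨ (w ∈ refls W ∧ fm W w = fm W s)) := by
  have h2 : Module.finrank ℂ V = Module.finrank ℂ (fixedSpace (s : (V →ₗ[ℂ] V)ˣ)) + 1 := hs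
  constructor
  · intro h
    have hle : fixedSpace (s : (V →ₗ[ℂ] V)ˣ) ≤ fixedSpace (w : (V →ₗ[ℂ] V)ˣ) := by
      intro x hx
      rw [mem_fixed] at hx ⊢
      exact h x ((fm_zero hs x).2 hx)
    rcases eq_or_lt_of_le hle with heq | hlt
    · right
      constructor
      · change Module.finrank ℂ V = Module.finrank ℂ (fixedSpace (w : (V →ₗ[ℂ] V)ˣ)) + 1
        rw [← heq, h2]
      · rw [fm, fm, heq]
    · left
      have h3 := Submodule.finrank_lt_finrank_of_lt hlt
      have h4 := Submodule.finrank_le (fixedSpace (w : (V →ₗ[ℂ] V)ˣ))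
      have h5 : fixedSpace (w : (V →ₗ[ℂ] V)ˣ) = ⊤ := Submodule.eq_top_of_finrank_eq (by omega)
      apply toLin_inj
      intro x
      rw [(mem_fixed w x).1 (by rw [h5]; trivial)]; rfl
  · rintro (rfl | ⟨hw, h⟩) x hx
    · rfl
    · rw [← fm_zero hw, h, hx]

open Classical in
/-- the reflection data attached to a finite group -/
def mkRD (W : Subgroup (V →ₗ[ℂ] V)ˣ) [Finite W] [Fintype W] {n : ℕ} (φ : V ≃ₗ[ℂ] (Fin n → ℂ)) : RD W (Fin n) where
  ρ := { toFun := fun w => φ.toLinearMap ∘ₗ toLin W w ∘ₗ φ.symm.toLinearMap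
         map_one' := by apply LinearMap.ext; intro x; simp [toLin_one]
         map_mul' := by intro a b; apply LinearMap.ext; intro x; simp [toLin_mul] }
  R := Finset.univ.filter (· ∈ refls W)
  α := fun t => fm W t ∘ₗ φ.symm.toLinearMap
  r := fun t => φ (rt t)
  one_notin := by simpa using one_notin_refls
  refl := by
    intro t ht x
    simp only [Finset.mem_filter, Finset.mem_univ, true_and] at ht
    change φ (toLin W t (φ.symm x)) = _
    rw [rt_spec ht]
    simp
  ane := by
    intro t ht h
    simp only [Finset.mem_filter, Finset.mem_univ, true_and] at ht
    apply fm_ne ht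
    ext x
    have := LinearMap.congr_fun h (φ x)
    simpa using this
  rne := by
    intro t ht
    simp only [Finset.mem_filter, Finset.mem_univ, true_and] at ht
    simpa using rt_ne ht
  conj := by
    intro t ht w
    simp only [Finset.mem_filter, Finset.mem_univ, true_and] at ht ⊢
    exact conj_mem ht w
  aconj := by
    intro t ht w
    simp only [Finset.mem_filter, Finset.mem_univ, true_and] at ht
    have hc := conj_mem ht w
    refine form_prop (l := (fm W t ∘ₗ φ.symm.toLinearMap) ∘ₗ
      (φ.toLinearMap ∘ₗ toLin W w⁻¹ ∘ₗ φ.symm.toLinearMap)) ?_ ?_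
    · intro x hx
      simp only [LinearMap.comp_apply, LinearEquiv.coe_coe, LinearEquiv.symm_apply_apply] at hx ⊢
      rw [fm_zero ht] at hx
      rw [fm_zero hc, toLin_mul, toLin_mul, hx, toLin_inv]
    · intro h
      apply fm_ne hc
      ext x
      have := LinearMap.congr_fun h (φ x)
      simpa using this
  same := by
    intro s hs t ht h
    simp only [Finset.mem_filter, Finset.mem_univ, true_and] at hs ht
    have h' : ∀ x, fm W s x = 0 → fm W t x = 0 := by
      intro x hx
      have := h (φ x)
      simpa [hx] using this
    obtain ⟨c, hc, h2⟩ := form_prop h' (fm_ne ht)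
    change fm W s ∘ₗ _ = fm W t ∘ₗ _
    rw [fm_congr (s := s) (t := t)]
    intro x
    rw [← fm_zero hs, ← fm_zero ht, h2]
    simp [hc]
  stab := by
    intro s hs w
    simp only [Finset.mem_filter, Finset.mem_univ, true_and] at hs ⊢
    have h1 : (fm W w ∘ₗ φ.symm.toLinearMap = fm W s ∘ₗ φ.symm.toLinearMap) ↔ fm W w = fm W s := by
      constructor
      · intro h
        ext x
        have := LinearMap.congr_fun h (φ x)
        simpa using this
      · intro h; rw [h]
    rw [h1, ← stabV hs]
    constructor
    · intro h x hx
      have := h (φ x)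
      simp only [LinearMap.comp_apply, LinearEquiv.coe_coe, LinearEquiv.symm_apply_apply] at this
      have h3 := this hx
      change φ (toLin W w (φ.symm (φ x))) = φ x at h3
      simpa using h3
    · intro h x hx
      change φ (toLin W w (φ.symm x)) = x
      have h4 := h (φ.symm x) hx
      rw [h4]; simp

end transport

/-- For `W` irreducible and `g` regular of order `d` with reflection length
`l_R(g)`, the number of reduced reflection factorizations of `g` is an integer
multiple of `d^{l_R(g)}·(l_R(g))!/|W|`; i.e.
`|W| · Fact_{W,g}(l_R(g)) = m · d^{l_R(g)} · (l_R(g))!` for some `m : ℕ`. -/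
theorem reduced_factorization_count_multiple
    (V : Type*) [AddCommGroup V] [Module ℂ V] [FiniteDimensional ℂ V]
    (W : Subgroup (V →ₗ[ℂ] V)ˣ) [Finite W]
    (hgen : Subgroup.closure (refls W) = ⊤)
    (hirr : IsIrredAction W)
    (d : ℕ) (g : W) (hg : IsRegularElt W g d)
    (lg : ℕ) (hlg : IsReflLength W g lg) :
    ∃ m : ℕ, Nat.card W * Nat.card {f : Fin lg → W // IsReflFac W g lg f} =
      m * d ^ lg * lg.factorial := by
  classical
  have : Fintype W := Fintype.ofFinite W
  obtain ⟨hd, ζ, v, hv0, hζ, hgv, hreg⟩ := hg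
  let φ : V ≃ₗ[ℂ] (Fin (Module.finrank ℂ V) → ℂ) := LinearEquiv.ofFinrankEq _ _ (by simp)
  let D := mkRD W φ
  have hR : ∀ t, t ∈ D.R ↔ t ∈ refls W := by
    intro t
    change t ∈ Finset.univ.filter (· ∈ refls W) ↔ _
    simp
  have hcard : ∀ j, (D.z ^ j).coeff g = Nat.card {f : Fin j → W // IsReflFac W g j f} := by
    intro j
    rw [D.coeff_z_pow_card]
    congr 1
    refine Nat.card_congr (Equiv.subtypeEquivRight fun f => ?_)
    simp only [hR]
    rfl
  have hDreg : D.Reg (φ v) := by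
    intro t ht
    rw [hR] at ht
    change fm W t (φ.symm (φ v)) ≠ 0
    rw [LinearEquiv.symm_apply_apply]
    intro h
    rw [fm_zero ht, ← mem_fixed] at h
    exact hreg _ ⟨t, ht, rfl⟩ h
  have hDg : D.ρ g (φ v) = ζ • φ v := by
    change φ (toLin W g (φ.symm (φ v))) = _
    rw [LinearEquiv.symm_apply_apply, hgv, map_smul]
  have h0 : ∀ j < lg, (D.z ^ j).coeff g = 0 := by
    intro j hj
    rw [hcard]
    have : IsEmpty {f : Fin j → W // IsReflFac W g j f} :=
      ⟨fun f => absurd (hlg.2 j f.1 f.2) (not_le.2 hj)⟩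
    simp
  obtain ⟨m, hm⟩ := RD.main_RD D hDreg hζ hDg h0
  rw [hcard, ← Nat.card_eq_fintype_card] at hm
  set A := Nat.card W * Nat.card {f : Fin lg → W // IsReflFac W g lg f} with hA
  have hm' : (A : ℤ) = m * ((d ^ lg * lg.factorial : ℕ) : ℤ) := by
    rw [hA]
    push_cast
    rw [← mul_assoc]
    exact_mod_cast hm
  have hdvd : d ^ lg * lg.factorial ∣ A := by
    rw [← Int.natCast_dvd_natCast, hm']
    exact dvd_mul_left _ _
  obtain ⟨k, hk⟩ := hdvd
  exact ⟨k, by rw [hk]; ring⟩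
end
end

section
/- Let n ≥ 2 and let g ∈ S_n be a permutation consisting of a single (n−1)-cycle and one fixed point. Then for every l ≥ 0, the number of tuples (t_1, …, t_l) of transpositions in S_n with t_1⋯t_l = g such that the subgroup generated by {t_1, …, t_l} acts transitively on {1, …, n} equals (1/n!) · Σ_{k=0}^{n} (−1)^k · binom(n, k) · (n(n−1)/2 − k(n−1))^l. -/
open scoped BigOperators
open Polynomial Finset

namespace TF

variable {α : Type*} [Fintype α] [DecidableEq α]

/-- Permutation matrix with polynomial entries. -/
noncomputable def M (g : Equiv.Perm α) : Matrix α α ℤ[X] :=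
  Matrix.of fun i j => if i = g j then 1 else 0

/-- `det (1 - X M_g)`. -/
noncomputable def P (g : Equiv.Perm α) : ℤ[X] := (1 - (X : ℤ[X]) • M g).det

/-- The adjugate of `1 - X M_g`. -/
noncomputable def N (g : Equiv.Perm α) : Matrix α α ℤ[X] :=
  (1 - (X : ℤ[X]) • M g).adjugate

noncomputable def A (g : Equiv.Perm α) : Matrix α α ℤ[X] := M g * N g

lemma M_mul (g : Equiv.Perm α) (B : Matrix α α ℤ[X]) (i j : α) : (M g * B) (g i) j = B i j := by
  simp [Matrix.mul_apply, M]

lemma A_apply (g : Equiv.Perm α) (i j : α) : A g (g i) j = N g i j := M_mul g _ i j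

lemma N_eq (g : Equiv.Perm α) : N g = P g • (1 : Matrix α α ℤ[X]) + (X : ℤ[X]) • A g := by
  have h := Matrix.mul_adjugate (1 - (X : ℤ[X]) • M g)
  rw [sub_mul, one_mul, Matrix.smul_mul] at h
  rw [P, ← h, A, N]; abel

lemma N_row (g : Equiv.Perm α) (i : α) : (1 - X) * ∑ j, N g i j = P g := by
  have h := Matrix.adjugate_mul (1 - (X : ℤ[X]) • M g)
  have h2 := congrArg (fun B => (B.mulVec (fun _ => (1 : ℤ[X]))) i) h
  have h3 : (1 - (X : ℤ[X]) • M g).mulVec (fun _ => (1 : ℤ[X])) = fun _ => 1 - X := by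
    funext a
    have : ∀ x, (a = g x) ↔ (x = g.symm a) := fun x => by
      rw [Equiv.eq_symm_apply, eq_comm]
    simp [M, Matrix.mulVec, dotProduct, this, Matrix.one_apply]
  simp only [← Matrix.mulVec_mulVec, h3] at h2
  simp [Matrix.mulVec, dotProduct, Matrix.smul_apply, Matrix.one_apply] at h2
  rw [P, ← h2, mul_sum]
  exact sum_congr rfl fun _ _ => mul_comm _ _

lemma N_col (g : Equiv.Perm α) (j : α) : (1 - X) * ∑ i, N g i j = P g := by
  have h := Matrix.mul_adjugate (1 - (X : ℤ[X]) • M g)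
  have h2 := congrArg (fun B => (Matrix.vecMul (fun _ => (1 : ℤ[X])) B) j) h
  have h3 : Matrix.vecMul (fun _ => (1 : ℤ[X])) (1 - (X : ℤ[X]) • M g)  = fun _ => 1 - X := by
    funext a
    simp [M, Matrix.vecMul, dotProduct, Matrix.one_apply, sum_sub_distrib]
  simp only [← Matrix.vecMul_vecMul, h3] at h2
  simp [Matrix.vecMul, dotProduct, Matrix.smul_apply, Matrix.one_apply] at h2
  rw [P, ← h2, mul_sum]; rfl

lemma A_row (g : Equiv.Perm α) (i : α) : (1 - X) * ∑ j, A g i j = P g := by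
  obtain ⟨i, rfl⟩ := g.surjective i
  simp only [A_apply, N_row]

lemma A_col (g : Equiv.Perm α) (j : α) : (1 - X) * ∑ i, A g i j = P g := by
  rw [← Equiv.sum_comp g]
  simp only [A_apply, N_col]

lemma A_fix (g : Equiv.Perm α) (i : α) (h : g i = i) : (1 - X) * A g i i = P g := by
  have h1 := congrFun (congrFun (N_eq g) i) i
  have h2 := A_apply g i i
  rw [h] at h2
  simp [← h2] at h1
  linear_combination h1

lemma A_f4 (g : Equiv.Perm α) :
    ∑ i, A g (g i) i = (Fintype.card α : ℤ[X]) * P g + X * ∑ i, A g i i := by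
  simp only [A_apply]
  rw [N_eq]
  simp [sum_add_distrib, mul_sum]

/-- number of fixed points -/
noncomputable def m (g : Equiv.Perm α) : ℤ[X] := ∑ i, M g i i

lemma A_f5 (g : Equiv.Perm α) :
    X * ∑ i, A g i (g i) = ∑ i, A g i i - m g * P g := by
  have : ∀ i, X * A g i (g i) = A g (g i) (g i) - M g i i * P g := by
    intro i
    have h1 := congrFun (congrFun (N_eq g) i) (g i)
    rw [A_apply]
    rw [h1]; simp [Matrix.one_apply, M]
  rw [mul_sum, sum_congr rfl fun i _ => this i, sum_sub_distrib, m, sum_mul,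
    Equiv.sum_comp g (fun i => A g i i)]

lemma deriv_det (B : Matrix α α ℤ[X]) :
    derivative B.det = (B.adjugate * B.map derivative).trace := by
  have h : ∀ i, (B.adjugate * B.map derivative) i i
      = (B.updateCol i (fun k => derivative (B k i))).det := by
    intro i
    rw [← Matrix.cramer_apply, Matrix.cramer_eq_adjugate_mulVec]
    rfl
  simp only [Matrix.trace, Matrix.diag, h, Matrix.det_apply', derivative_sum]
  rw [sum_comm]
  refine sum_congr rfl fun σ _ => ?_
  rw [← C_eq_intCast, ← smul_eq_C_mul, derivative_smul, derivative_prod_finset, smul_eq_C_mul, mul_sum]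
  refine sum_congr rfl fun i _ => ?_
  congr 1
  rw [← mul_prod_erase univ _ (mem_univ i), mul_comm]
  congr 1
  · simp
  · refine prod_congr rfl fun j hj => ?_
    rw [Matrix.updateCol_ne (ne_of_mem_erase hj)]

lemma P_deriv (g : Equiv.Perm α) : derivative (P g) = - ∑ i, A g i i := by
  rw [P, deriv_det]
  have : (1 - (X : ℤ[X]) • M g).map derivative = - M g := by
    ext1 i j
    simp [M, Matrix.one_apply]
    split_ifs <;> simp
  rw [this, mul_neg, Matrix.trace_neg, Matrix.trace_mul_comm]
  rfl

lemma det_rank_one {K : Type*} [Field K] (B : Matrix α α K) (u v : α → K) (h : B.det ≠ 0) :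
    (B + Matrix.vecMulVec u v).det = B.det + v ⬝ᵥ (B.adjugate.mulVec u) := by
  have := Matrix.det_add_replicateCol_mul_replicateRow (ι := Unit) (A := B) (isUnit_iff_ne_zero.2 h) u v
  rw [Matrix.vecMulVec_eq Unit, this]
  rw [Matrix.inv_def, Ring.inverse_eq_inv']
  simp [Matrix.det_unique, Matrix.mul_apply, dotProduct, Matrix.mulVec, mul_add, sum_mul, mul_sum]
  rw [sum_comm]
  refine sum_congr rfl fun i _ => sum_congr rfl fun j _ => ?_
  field_simp

lemma P_coeff_zero (g : Equiv.Perm α) : (P g).coeff 0 = 1 := by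
  rw [coeff_zero_eq_eval_zero, P, ← coe_evalRingHom, RingHom.map_det]
  have : (evalRingHom (0:ℤ)).mapMatrix (1 - (X : ℤ[X]) • M g) = 1 := by
    ext i j
    simp [M, Matrix.one_apply]
    split_ifs <;> simp
  rw [this, Matrix.det_one]

lemma P_ne (g : Equiv.Perm α) : P g ≠ 0 := by
  intro h
  have := P_coeff_zero g
  simp [h] at this

lemma det_rank_one' (B : Matrix α α ℤ[X]) (u v : α → ℤ[X]) (h : B.det ≠ 0) :
    (B + Matrix.vecMulVec u v).det = B.det + v ⬝ᵥ (B.adjugate.mulVec u) := by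
  let φ := algebraMap ℤ[X] (FractionRing ℤ[X])
  have hφ : Function.Injective φ := IsFractionRing.injective _ _
  apply hφ
  have := det_rank_one (φ.mapMatrix B) (φ ∘ u) (φ ∘ v) (by
    rw [← RingHom.map_det]; exact fun h0 => h (hφ (by simpa using h0)))
  rw [RingHom.map_det, map_add φ, RingHom.map_det]
  have e1 : φ.mapMatrix (Matrix.vecMulVec u v) = Matrix.vecMulVec (φ ∘ u) (φ ∘ v) := by
    ext i j; simp [Matrix.vecMulVec_apply]
  rw [map_add, e1, this]
  congr 1
  · rw [RingHom.map_dotProduct]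
    congr 1
    rw [← RingHom.map_adjugate]
    ext i
    simp [RingHom.map_mulVec]

lemma M_swap (g : Equiv.Perm α) (a b : α) (i j : α) :
    M (Equiv.swap a b * g) i j = M g i j -
      ((Pi.single a 1 - Pi.single b 1 : α → ℤ[X]) i) * (M g a j - M g b j) := by
  simp only [M, Matrix.of_apply, Equiv.Perm.coe_mul, Function.comp_apply, Equiv.swap_apply_def,
    Pi.sub_apply, Pi.single_apply]
  by_cases h1 : i = a <;> by_cases h2 : i = b <;> grind

lemma P_swap (g : Equiv.Perm α) (a b : α) :
    P (Equiv.swap a b * g) = P g + X * (A g a a + A g b b - A g a b - A g b a) := by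
  have h : (1 - (X : ℤ[X]) • M (Equiv.swap a b * g)) = (1 - (X : ℤ[X]) • M g) +
      Matrix.vecMulVec ((X : ℤ[X]) • (Pi.single a 1 - Pi.single b 1 : α → ℤ[X]))
        (fun j => M g a j - M g b j) := by
    ext1 i j
    simp only [Matrix.sub_apply, Matrix.add_apply, Matrix.smul_apply, M_swap, Matrix.vecMulVec_apply,
      Pi.smul_apply, smul_eq_mul]
    ring
  rw [P, h, det_rank_one' _ _ _ (P_ne g)]
  have h2 : (fun j => M g a j - M g b j) = Matrix.vecMul (Pi.single a 1 - Pi.single b 1) (M g) := by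
    rw [Matrix.sub_vecMul]; simp; rfl
  rw [h2, ← Matrix.dotProduct_mulVec, Matrix.mulVec_mulVec, Matrix.mulVec_smul]
  change P g + _ ⬝ᵥ X • (A g).mulVec _ = _
  simp [Matrix.mulVec_sub, sub_dotProduct]
  ring

lemma m_swap (g : Equiv.Perm α) (a b : α) :
    m (Equiv.swap a b * g) = m g - (M g a a + M g b b - M g a b - M g b a) := by
  simp only [m, M_swap, sum_sub_distrib, Pi.sub_apply, sub_mul, Pi.single_apply]
  simp
  ring


/-- The transpositions. -/
noncomputable def swaps (α : Type*) [Fintype α] [DecidableEq α] : Finset (Equiv.Perm α) := by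
  classical exact univ.filter fun s => s.IsSwap

lemma mem_swaps (s : Equiv.Perm α) : s ∈ swaps α ↔ s.IsSwap := by
  simp [swaps]

lemma sum_swaps {E : Type*} [CommRing E] (F : Equiv.Perm α → E) :
    2 * ∑ s ∈ swaps α, F s = ∑ a, ∑ b, F (Equiv.swap a b) - (Fintype.card α : E) * F 1 := by
  classical
  have h1 : ∑ a, ∑ b, F (Equiv.swap a b) - (Fintype.card α : E) * F 1
      = ∑ p ∈ (univ : Finset (α × α)).filter (fun p => p.1 ≠ p.2), F (Equiv.swap p.1 p.2) := by
    rw [← Fintype.sum_prod_type' (f := fun a b => F (Equiv.swap a b)),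
      ← sum_filter_add_sum_filter_not univ (fun p : α × α => p.1 ≠ p.2)]
    have : ∑ p ∈ (univ : Finset (α × α)).filter (fun p => ¬ p.1 ≠ p.2), F (Equiv.swap p.1 p.2)
        = (Fintype.card α : E) * F 1 := by
      have e : (univ : Finset (α × α)).filter (fun p => ¬ p.1 ≠ p.2) = univ.diag := by
        ext ⟨a, b⟩; simp
      rw [e, sum_diag]
      simp [Equiv.Perm.one_def]
    rw [this]; ring
  rw [h1]
  have h2 : ∀ p ∈ (univ : Finset (α × α)).filter (fun p => p.1 ≠ p.2),
      Equiv.swap p.1 p.2 ∈ swaps α := by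
    intro p hp
    rw [mem_swaps]
    exact ⟨p.1, p.2, by simpa using hp, rfl⟩
  rw [← sum_fiberwise_of_maps_to h2, mul_sum]
  refine sum_congr rfl fun s hs => ?_
  obtain ⟨c, d, hcd, rfl⟩ := (mem_swaps s).1 hs
  have e : ((univ : Finset (α × α)).filter (fun p => p.1 ≠ p.2)).filter
      (fun p => Equiv.swap p.1 p.2 = Equiv.swap c d) = {(c, d), (d, c)} := by
    ext ⟨a, b⟩
    simp only [mem_filter, mem_univ, true_and, mem_insert, mem_singleton, Prod.mk.injEq]
    constructor
    · rintro ⟨hab, h⟩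
      have ha := congrArg (fun e => e a) h
      have hb := congrArg (fun e => e b) h
      simp only [Equiv.swap_apply_left, Equiv.swap_apply_right, Equiv.swap_apply_def] at ha hb
      grind
    · rintro (⟨rfl, rfl⟩ | ⟨rfl, rfl⟩)
      · exact ⟨hcd, rfl⟩
      · exact ⟨hcd.symm, Equiv.swap_comm _ _⟩
  rw [e, sum_pair (by simp [hcd])]
  simp only [Equiv.swap_comm d c]
  ring

lemma two_choose (n : ℕ) : (2 : ℤ[X]) * (n.choose 2 : ℤ[X]) = n * (n - 1) := by
  have h : 2 * n.choose 2 = n * (n - 1) := by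
    rw [Nat.choose_two_right, Nat.mul_div_cancel' (Nat.even_mul_pred_self n).two_dvd]
  rcases n with _ | n
  · simp
  · have := congrArg (Nat.cast : ℕ → ℤ[X]) h
    push_cast [Nat.add_sub_cancel] at this ⊢
    linear_combination this

lemma A_total (g : Equiv.Perm α) :
    (1 - X) * ∑ a, ∑ b, A g a b = (Fintype.card α : ℤ[X]) * P g := by
  rw [mul_sum, sum_congr rfl fun i _ => A_row g i]
  simp

lemma TP (g : Equiv.Perm α) : 2 * ∑ s ∈ swaps α, P (s * g) =
    (Fintype.card α : ℤ[X]) ^ 2 * P g + X * (2 * (Fintype.card α : ℤ[X]) * ∑ a, A g a a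
      - 2 * ∑ a, ∑ b, A g a b) - (Fintype.card α : ℤ[X]) * P g := by
  rw [sum_swaps (fun s => P (s * g))]
  simp only [P_swap, one_mul]
  simp only [mul_sub, mul_add, sum_add_distrib, sum_sub_distrib, ← mul_sum]
  rw [sum_comm (f := fun a b => A g b a)]
  simp
  simp only [← mul_sum]
  ring

lemma one_sub_X_ne : (1 - X : ℤ[X]) ≠ 0 := by
  intro h
  have := congrArg (fun p => p.coeff 0) h
  simp at this

lemma TR (R : Equiv.Perm α → ℤ[X]) (hR : ∀ g, P g = (1 - X) * R g) (g : Equiv.Perm α) :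
    ∑ s ∈ swaps α, R (s * g) = ((Fintype.card α).choose 2 : ℤ[X]) * R g
      - (Fintype.card α : ℤ[X]) * X * derivative (R g) := by
  have h1 := TP g
  have h2 := A_total g
  have h3 := P_deriv g
  have h4 : ∑ s ∈ swaps α, P (s * g) = (1 - X) * ∑ s ∈ swaps α, R (s * g) := by
    rw [mul_sum]; exact sum_congr rfl fun s _ => hR _
  have h5 := hR g
  have h6 : derivative (P g) = (1 - X) * derivative (R g) - R g := by
    rw [h5]; simp; ring
  have h7 := two_choose (Fintype.card α)
  have hne : (2 * (1 - X) ^ 2 : ℤ[X]) ≠ 0 :=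
    mul_ne_zero two_ne_zero (pow_ne_zero _ one_sub_X_ne)
  apply mul_left_cancel₀ hne
  generalize (∑ a, ∑ b, A g a b) = al at *
  generalize (∑ a, A g a a) = τ at *
  generalize (∑ s ∈ swaps α, R (s * g)) = TR at *
  generalize (∑ s ∈ swaps α, P (s * g)) = TP at *
  generalize derivative (R g) = R' at *
  generalize derivative (P g) = P' at *
  generalize (Fintype.card α : ℤ[X]) = n at *
  generalize R g = r at *
  generalize P g = p at *
  generalize ((Fintype.card α).choose 2 : ℤ[X]) = c at *
  subst h4 h5 h6
  linear_combination (1 - X) * h1 - 2 * X * h2 - (1 - X) ^ 2 * r * h7 + 2 * (1 - X) * X * n * h3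

lemma sym_sum (B z : α → α → ℤ[X]) (hz : ∀ a b, z a b = z b a) :
    ∑ a, ∑ b, (B a a + B b b - B a b - B b a) * z a b = 2 * ∑ a, ∑ b, (B a a - B a b) * z a b := by
  have h : ∑ a, ∑ b, (B b b - B b a) * z a b = ∑ a, ∑ b, (B a a - B a b) * z a b := by
    rw [sum_comm]
    exact sum_congr rfl fun a _ => sum_congr rfl fun b _ => by rw [hz]
  rw [two_mul]
  nth_rw 2 [← h]
  simp only [← sum_add_distrib]
  exact sum_congr rfl fun a _ => sum_congr rfl fun b _ => by ring

lemma M_row (g : Equiv.Perm α) (i : α) : ∑ j, M g i j = 1 := by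
  have : ∀ x, (i = g x) ↔ (x = g.symm i) := fun x => by
    rw [Equiv.eq_symm_apply, eq_comm]
  simp [M, this]

lemma M_col (g : Equiv.Perm α) (j : α) : ∑ i, M g i j = 1 := by
  simp [M]

lemma sum_M (g : Equiv.Perm α) (f : α → α → ℤ[X]) :
    ∑ a, ∑ b, M g a b * f a b = ∑ b, f (g b) b := by
  rw [sum_comm]; simp [M]

lemma wz (g : Equiv.Perm α) : ∑ a, ∑ b, (M g a a + M g b b - M g a b - M g b a)
      * (A g a a + A g b b - A g a b - A g b a) =
    2 * ((Fintype.card α : ℤ[X]) * ∑ a, M g a a * A g a a + m g * ∑ a, A g a a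
      - ∑ a, M g a a * ∑ b, A g a b - ∑ a, M g a a * ∑ b, A g b a)
    - 2 * (2 * ∑ a, A g a a - ∑ i, A g (g i) i - ∑ i, A g i (g i)) := by
  rw [sym_sum (M g) (fun a b => A g a a + A g b b - A g a b - A g b a) (fun a b => by ring)]
  simp only [sub_mul, sum_sub_distrib, sum_M, sum_add_distrib]
  rw [Equiv.sum_comp g (fun i => A g i i)]
  simp only [mul_sub, mul_add, sum_add_distrib, sum_sub_distrib, mul_sum, m, sum_mul]
  simp
  rw [sum_comm (f := fun a b => 2 * (M g b b * A g a a))]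
  simp only [← mul_sum (univ : Finset α)]
  ring

lemma m_A (g : Equiv.Perm α) (f : α → ℤ[X]) (hf : ∀ i, g i = i → (1 - X) * f i = P g) :
    (1 - X) * ∑ a, M g a a * f a = m g * P g := by
  rw [mul_sum, m, sum_mul]
  refine sum_congr rfl fun i _ => ?_
  by_cases h : g i = i
  · rw [← hf i h]; ring
  · simp [M, Ne.symm h]

lemma m_eq (g : Equiv.Perm α) : m g = C (#(univ.filter fun i => g i = i) : ℤ) := by
  simp [m, M, eq_comm]

lemma TU (g : Equiv.Perm α) : 2 * ∑ s ∈ swaps α, m (s * g) * P (s * g) =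
    m g * ((Fintype.card α : ℤ[X]) ^ 2 * P g + X * (2 * (Fintype.card α : ℤ[X]) * ∑ a, A g a a
      - 2 * ∑ a, ∑ b, A g a b)) - P g * (2 * (Fintype.card α : ℤ[X]) * m g
        - 2 * (Fintype.card α : ℤ[X]))
      - X * ∑ a, ∑ b, (M g a a + M g b b - M g a b - M g b a)
      * (A g a a + A g b b - A g a b - A g b a) - (Fintype.card α : ℤ[X]) * (m g * P g) := by
  rw [sum_swaps (fun s => m (s * g) * P (s * g))]
  have h1 := TP g
  rw [sum_swaps (fun s => P (s * g))] at h1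
  simp only [one_mul] at h1 ⊢
  have h2 : ∑ a, ∑ b, (M g a a + M g b b - M g a b - M g b a) =
      2 * (Fintype.card α : ℤ[X]) * m g - 2 * (Fintype.card α : ℤ[X]) := by
    simp only [sum_add_distrib, sum_sub_distrib, M_row, M_col, m]
    simp [← mul_sum]
    ring
  have h3 : ∀ a b, m (Equiv.swap a b * g) * P (Equiv.swap a b * g) =
      m g * P (Equiv.swap a b * g) - P g * (M g a a + M g b b - M g a b - M g b a)
      - X * ((M g a a + M g b b - M g a b - M g b a)
      * (A g a a + A g b b - A g a b - A g b a)) := by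
    intro a b
    rw [m_swap, P_swap]; ring
  rw [← h2]
  have h4 : ∑ a, ∑ b, m (Equiv.swap a b * g) * P (Equiv.swap a b * g) =
      m g * ∑ a, ∑ b, P (Equiv.swap a b * g)
      - P g * ∑ a, ∑ b, (M g a a + M g b b - M g a b - M g b a)
      - X * ∑ a, ∑ b, ((M g a a + M g b b - M g a b - M g b a)
      * (A g a a + A g b b - A g a b - A g b a)) := by
    simp only [mul_sum (univ : Finset α), ← sum_sub_distrib, h3]
  rw [h4]
  linear_combination m g * h1

lemma TS (Q : Equiv.Perm α → ℤ[X]) (hQ : ∀ g, m g * P g = (1 - X) ^ 2 * Q g) (g : Equiv.Perm α) :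
    ∑ s ∈ swaps α, (P (s * g) + X * Q (s * g)) =
      ((Fintype.card α).choose 2 : ℤ[X]) * (P g + X * Q g)
      - ((Fintype.card α : ℤ[X]) - 1) * X * derivative (P g + X * Q g) := by
  have h1 := TP g
  have h2 := A_total g
  have h3 := P_deriv g
  have h4 : ∑ s ∈ swaps α, m (s * g) * P (s * g) = (1 - X) ^ 2 * ∑ s ∈ swaps α, Q (s * g) := by
    rw [mul_sum]; exact sum_congr rfl fun s _ => hQ _
  have h5 := hQ g
  have h6 : m g * derivative (P g) = (1 - X) ^ 2 * derivative (Q g) - 2 * (1 - X) * Q g := by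
    have := congrArg derivative h5
    rw [m_eq] at this ⊢
    simp [pow_two] at this ⊢
    linear_combination this
  have h7 := two_choose (Fintype.card α)
  have h8 := TU g
  have h9 := wz g
  have k1 := m_A g (fun i => A g i i) (fun i h => A_fix g i h)
  have k2 := m_A g (fun i => ∑ b, A g i b) (fun i _ => A_row g i)
  have k3 := m_A g (fun i => ∑ b, A g b i) (fun i _ => A_col g i)
  have k4 := A_f4 g
  have k5 := A_f5 g
  have hd : derivative (P g + X * Q g) = derivative (P g) + Q g + X * derivative (Q g) := by
    simp; ring
  rw [hd, sum_add_distrib, ← mul_sum]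
  rw [h9] at h8
  clear h9 hd hQ
  have hne : (2 * (1 - X) ^ 3 : ℤ[X]) ≠ 0 :=
    mul_ne_zero two_ne_zero (pow_ne_zero _ one_sub_X_ne)
  apply mul_left_cancel₀ hne
  generalize (∑ a, M g a a * ∑ b, A g a b) = r1 at *
  generalize (∑ a, M g a a * ∑ b, A g b a) = r2 at *
  generalize (∑ a, M g a a * A g a a) = s1 at *
  generalize (∑ i, A g (g i) i) = κ1 at *
  generalize (∑ i, A g i (g i)) = κ2 at *
  generalize (∑ a, ∑ b, A g a b) = al at *
  generalize (∑ a, A g a a) = τ at *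
  generalize (∑ s ∈ swaps α, m (s * g) * P (s * g)) = TU at *
  generalize (∑ s ∈ swaps α, Q (s * g)) = TQ at *
  generalize (∑ s ∈ swaps α, P (s * g)) = TP at *
  generalize derivative (Q g) = Q' at *
  generalize derivative (P g) = P' at *
  generalize (Fintype.card α : ℤ[X]) = n at *
  generalize Q g = q at *
  generalize P g = p at *
  generalize m g = mm at *
  generalize ((Fintype.card α).choose 2 : ℤ[X]) = c at *
  have h4' : (1 - X) ^ 2 * TQ = TU := h4.symm
  subst h3
  linear_combination (1 - X) ^ 3 * h1 + 2 * (1 - X) * X * h4' + (1 - X) * X * h8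
    - 2 * X * (1 - X) ^ 2 * h2 - 2 * X ^ 2 * mm * h2 - 2 * n * X ^ 2 * k1 + 2 * X ^ 2 * k2
    + 2 * X ^ 2 * k3 - 2 * (1 - X) * X ^ 2 * k4 - 2 * (1 - X) * X * k5
    - (1 - X) ^ 3 * (p + X * q) * h7
    - 2 * (1 - X) * (n - 1) * X ^ 2 * h6
    - (- n * (n - 1) * (1 - X) * X + 2 * (1 - X) * (n - 1) * X + 4 * (n - 1) * X ^ 2) * h5

lemma P_split (g : Equiv.Perm α) (p : α → Prop) [DecidablePred p] (h : ∀ x, p (g x) ↔ p x) :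
    P g = P (g.subtypePerm h) *
      P (g.subtypePerm (p := fun x => ¬ p x) (fun x => not_congr (h x))) := by
  rw [P, Matrix.twoBlockTriangular_det _ p]
  · congr 1
    · rw [P]; congr 1; ext1 i j
      simp [Matrix.toSquareBlockProp, M, Matrix.one_apply, Subtype.ext_iff]
    · rw [P]; congr 1; ext1 i j
      simp [Matrix.toSquareBlockProp, M, Matrix.one_apply, Subtype.ext_iff]
  · intro i hi j hj
    have h1 : i ≠ j := fun e => hi (e ▸ hj)
    have h2 : i ≠ g j := fun e => hi (e ▸ (h j).2 hj)
    simp [M, h1, h2]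

lemma P_dvd [Nonempty α] (g : Equiv.Perm α) : (1 - X) ∣ P g :=
  ⟨_, (N_row g (Classical.arbitrary α)).symm⟩

lemma P_dvd_sq (g : Equiv.Perm α) (h : ¬ ∀ x y, g.SameCycle x y) : (1 - X) ^ 2 ∣ P g := by
  classical
  push Not at h
  obtain ⟨x, y, h⟩ := h
  rw [P_split g (fun z => g.SameCycle x z) (fun z => Equiv.Perm.sameCycle_apply_right), pow_two]
  have : Nonempty {z // g.SameCycle x z} := ⟨⟨x, Equiv.Perm.SameCycle.refl _ _⟩⟩
  have : Nonempty {z // ¬ g.SameCycle x z} := ⟨⟨y, h⟩⟩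
  exact mul_dvd_mul (P_dvd _) (P_dvd _)

lemma P_dvd_inst {β : Type*} (_ : Fintype β) (_ : DecidableEq β) (_ : Nonempty β)
    (g : Equiv.Perm β) : (1 - X) ∣ P g := P_dvd g

lemma dvd_helper {a b : ℤ[X]} (h : (1 - X) ∣ a) : ∃ p, a * b = (1 - X) * p * b := by
  obtain ⟨p, rfl⟩ := h
  exact ⟨p, rfl⟩

lemma P_fix (g : Equiv.Perm α) (i : α) (hi : g i = i) : ∃ p, P g = (1 - X) * p *
    P (g.subtypePerm (p := fun x => x ≠ i) (fun x => by
      rw [ne_eq, ne_eq, not_iff_not]; constructor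
      · intro h; exact g.injective (h.trans hi.symm)
      · rintro rfl; exact hi)) := by
  have h : ∀ x, g x = i ↔ x = i := fun x => by
    constructor
    · intro h; exact g.injective (h.trans hi.symm)
    · rintro rfl; exact hi
  rw [P_split g (fun x => x = i) h]
  have : Nonempty {x // x = i} := ⟨⟨i, rfl⟩⟩
  exact dvd_helper (P_dvd_inst _ _ this _)

lemma exists_Q (hα : 2 ≤ Fintype.card α) (g : Equiv.Perm α) :
    ∃ q, m g * P g = (1 - X) ^ 2 * q := by
  by_cases h : ∃ i, g i = i
  · obtain ⟨i, hi⟩ := h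
    obtain ⟨p, hp⟩ := P_fix g i hi
    have : Nontrivial α := Fintype.one_lt_card_iff_nontrivial.1 (by omega)
    obtain ⟨j, hj⟩ := exists_ne i
    have : Nonempty {x // x ≠ i} := ⟨⟨j, hj⟩⟩
    obtain ⟨r, hr⟩ := P_dvd (g.subtypePerm (p := fun x => x ≠ i) (fun x => by
      rw [ne_eq, ne_eq, not_iff_not]; constructor
      · intro h; exact g.injective (h.trans hi.symm)
      · rintro rfl; exact hi))
    exact ⟨m g * p * r, by rw [hp, hr]; ring⟩
  · refine ⟨0, ?_⟩
    push Not at h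
    simp [m, M, fun i => (h i).symm]

lemma R_support (g : Equiv.Perm α) (r : ℤ[X]) (hr : P g = (1 - X) * r) (h : r.eval 1 ≠ 0) :
    ∀ x y, g.SameCycle x y := by
  by_contra hc
  obtain ⟨q, hq⟩ := P_dvd_sq g hc
  apply h
  have : r = (1 - X) * q := mul_left_cancel₀ one_sub_X_ne (by rw [← hr, hq]; ring)
  simp [this]

lemma isCycle_of_fix (hα : 3 ≤ Fintype.card α) (g : Equiv.Perm α) (i : α) (hi : g i = i)
    (h : ∀ x y, x ≠ i → y ≠ i → g.SameCycle x y) :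
    g.IsCycle ∧ g.support.card = Fintype.card α - 1 := by
  have key : ∀ x, x ≠ i → g x ≠ x := by
    intro x hx hgx
    obtain ⟨y, hy, hy2⟩ : ∃ y, y ≠ x ∧ y ≠ i := by
      by_contra hc
      push Not at hc
      have : (univ : Finset α) ⊆ {x, i} := by
        intro y _
        by_cases hyx : y = x
        · simp [hyx]
        · simp [hc y hyx]
      have := (card_le_card this).trans card_le_two
      rw [card_univ] at this
      omega
    obtain ⟨k, hk⟩ := h x y hx hy2
    rw [Equiv.Perm.zpow_apply_eq_self_of_apply_eq_self hgx] at hk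
    exact hy hk.symm
  have hs : g.support = univ.erase i := by
    ext x
    simp only [Equiv.Perm.mem_support, mem_erase, mem_univ, and_true]
    exact ⟨fun hx e => hx (e ▸ hi), key x⟩
  have : Nontrivial α := Fintype.one_lt_card_iff_nontrivial.1 (by omega)
  obtain ⟨j, hj⟩ := exists_ne i
  refine ⟨⟨j, key j hj, fun y hy => h j y hj (fun e => hy (e ▸ hi))⟩, ?_⟩
  rw [hs, card_erase_of_mem (mem_univ _), card_univ]

lemma S_support (hα : 3 ≤ Fintype.card α) (g : Equiv.Perm α) (q : ℤ[X])
    (hq : m g * P g = (1 - X) ^ 2 * q) (h : (P g + X * q).eval 1 ≠ 0) :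
    g.IsCycle ∧ g.support.card = Fintype.card α - 1 := by
  have : Nonempty α := Fintype.card_pos_iff.1 (by omega)
  have hP : (P g).eval 1 = 0 := by
    obtain ⟨r, hr⟩ := P_dvd g
    simp [hr]
  have hq1 : q.eval 1 ≠ 0 := by simpa [hP] using h
  have hne : ((1 - X) ^ 2 : ℤ[X]) ≠ 0 := pow_ne_zero _ one_sub_X_ne
  by_cases hf : ∃ i, g i = i
  · obtain ⟨i, hi⟩ := hf
    refine isCycle_of_fix hα g i hi ?_
    obtain ⟨p, hp⟩ := P_fix g i hi
    have hinv : ∀ x, g x ≠ i ↔ x ≠ i := fun x => by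
      rw [ne_eq, ne_eq, not_iff_not]; constructor
      · intro h; exact g.injective (h.trans hi.symm)
      · rintro rfl; exact hi
    have h2 : ∀ x y, (g.subtypePerm (p := fun x => x ≠ i) hinv).SameCycle x y := by
      by_contra hc
      obtain ⟨r, hr⟩ := P_dvd_sq _ hc
      apply hq1
      have : q = (1 - X) * (m g * p * r) := mul_left_cancel₀ hne (by rw [← hq, hp, hr]; ring)
      simp [this]
    intro x y hx hy
    have := h2 ⟨x, hx⟩ ⟨y, hy⟩
    rwa [Equiv.Perm.sameCycle_subtypePerm] at this
  · exfalso
    push Not at hf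
    apply hq1
    have : m g = 0 := by simp [m, M, fun i => (hf i).symm]
    rw [this, zero_mul] at hq
    have : q = 0 := by
      rcases mul_eq_zero.1 hq.symm with h | h
      · exact absurd h hne
      · exact h
    simp [this]

/-- number of factorizations, recursively -/
noncomputable def cnt : ℕ → Equiv.Perm α → ℤ
  | 0, g => if g = 1 then 1 else 0
  | l + 1, g => ∑ s ∈ swaps α, cnt l (s⁻¹ * g)

lemma swap_conj (c s : Equiv.Perm α) (hs : s.IsSwap) : (c * s * c⁻¹).IsSwap := by
  obtain ⟨x, y, hxy, rfl⟩ := hs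
  exact ⟨c x, c y, fun h => hxy (c.injective h), (Equiv.swap_apply_apply c x y).symm⟩

lemma cnt_conj (l : ℕ) (c g : Equiv.Perm α) : cnt l (c * g * c⁻¹) = cnt l g := by
  induction l generalizing g with
  | zero => simp [cnt, mul_inv_eq_one]
  | succ l ih =>
    simp only [cnt]
    refine sum_bij (fun s _ => c⁻¹ * s * c) ?_ ?_ ?_ ?_
    · intro s hs
      rw [mem_swaps] at hs ⊢
      have := swap_conj c⁻¹ s hs
      simpa using this
    · intro a _ b _ h
      simpa using h
    · intro s hs
      rw [mem_swaps] at hs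
      refine ⟨c * s * c⁻¹, (mem_swaps _).2 (swap_conj c s hs), by group⟩
    · intro s _
      rw [← ih ((c⁻¹ * s * c)⁻¹ * g)]
      congr 1
      group

/-- the diagonal operator -/
noncomputable def Lop (a b : ℤ) (p : ℤ[X]) : ℤ[X] := C a * p - C b * X * derivative p

lemma Lop_coeff (a b : ℤ) (p : ℤ[X]) (k : ℕ) : (Lop a b p).coeff k = (a - k * b) * p.coeff k := by
  rw [Lop, coeff_sub, coeff_C_mul, mul_assoc, coeff_C_mul]
  rcases k with _ | k
  · simp
  · rw [coeff_X_mul, coeff_derivative]; push_cast; ring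

lemma Lop_iter_coeff (a b : ℤ) (p : ℤ[X]) (k l : ℕ) :
    ((Lop a b)^[l] p).coeff k = (a - k * b) ^ l * p.coeff k := by
  induction l with
  | zero => simp
  | succ l ih => rw [Function.iterate_succ_apply', Lop_coeff, ih]; ring

lemma Lop_sum {ι : Type*} (a b : ℤ) (s : Finset ι) (w : ι → ℤ) (f : ι → ℤ[X]) :
    ∑ i ∈ s, C (w i) * Lop a b (f i) = Lop a b (∑ i ∈ s, C (w i) * f i) := by
  ext k
  simp only [Lop_coeff, finsetSum_coeff, coeff_C_mul, mul_sum]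
  exact sum_congr rfl fun i _ => by ring

lemma cnt_sum (f : Equiv.Perm α → ℤ[X]) (a b : ℤ)
    (hf : ∀ g, ∑ s ∈ swaps α, f (s * g) = Lop a b (f g)) (l : ℕ) :
    ∑ h, C (cnt l h) * f h = (Lop a b)^[l] (f 1) := by
  induction l with
  | zero =>
    simp [cnt, apply_ite C]
  | succ l ih =>
    rw [Function.iterate_succ_apply', ← ih, ← Lop_sum]
    simp only [cnt, map_sum, sum_mul, ← hf, mul_sum]
    rw [sum_comm]
    conv_rhs => rw [sum_comm]
    refine sum_congr rfl fun s _ => ?_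
    rw [← Equiv.sum_comp (Equiv.mulLeft s)]
    simp

lemma total (f : Equiv.Perm α → ℤ[X]) (b : ℤ) (hb : b ≠ 0)
    (hf : ∀ g, ∑ s ∈ swaps α, f (s * g) = Lop (#(swaps α) : ℤ) b (f g))
    (h0 : ∀ g, (f g).coeff 0 = 1) :
    ∑ g, f g = C ((Fintype.card α).factorial : ℤ) := by
  have h1 : Lop (#(swaps α) : ℤ) b (∑ g, f g) = C (#(swaps α) : ℤ) * ∑ g, f g := by
    have := Lop_sum (#(swaps α) : ℤ) b univ (fun _ => 1) f
    simp only [map_one, one_mul] at this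
    rw [← this]
    simp only [← hf]
    rw [sum_comm]
    have : ∀ s : Equiv.Perm α, ∑ g, f (s * g) = ∑ g, f g := fun s =>
      Equiv.sum_comp (Equiv.mulLeft s) f
    simp [this]
  ext k
  have h2 := congrArg (fun p => p.coeff k) h1
  simp only [Lop_coeff, coeff_C_mul] at h2
  rcases k with _ | k
  · simp [h0, Fintype.card_perm]
  · rw [coeff_C_succ]
    have h3 : ((k + 1 : ℕ) : ℤ) * b * (∑ g, f g).coeff (k + 1) = 0 := by linear_combination -h2
    have h4 : ((k + 1 : ℕ) : ℤ) * b ≠ 0 := mul_ne_zero (by positivity) hb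
    exact (mul_eq_zero.1 h3).resolve_left h4

lemma main_count (f : Equiv.Perm α → ℤ[X]) (b : ℤ) (hb : b ≠ 0)
    (hf : ∀ g, ∑ s ∈ swaps α, f (s * g) = Lop (#(swaps α) : ℤ) b (f g))
    (h0 : ∀ g, (f g).coeff 0 = 1) (g : Equiv.Perm α)
    (hg : ∀ h, (f h).eval 1 ≠ 0 → IsConj g h) (l K : ℕ) (hK : (f 1).natDegree < K) :
    ((Fintype.card α).factorial : ℤ) * cnt l g =
      ∑ k ∈ range K, (f 1).coeff k * ((#(swaps α) : ℤ) - k * b) ^ l := by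
  have h1 := congrArg (eval 1) (cnt_sum f _ b hf l)
  have h2 := congrArg (eval 1) (total f b hb hf h0)
  have h3 : ((Lop (#(swaps α) : ℤ) b)^[l] (f 1)).natDegree < K := by
    refine lt_of_le_of_lt (natDegree_le_iff_coeff_eq_zero.2 fun k hk => ?_) hK
    rw [Lop_iter_coeff, coeff_eq_zero_of_natDegree_lt hk, mul_zero]
  rw [eval_eq_sum_range' h3] at h1
  simp only [Lop_iter_coeff, one_pow, mul_one, eval_finsetSum, eval_mul, eval_C] at h1 h2
  rw [← h2, sum_mul]
  rw [sum_congr rfl fun k _ => mul_comm ((f 1).coeff k) _, ← h1]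
  refine sum_congr rfl fun h _ => ?_
  by_cases hh : (f h).eval 1 = 0
  · simp [hh]
  · obtain ⟨c, hc⟩ := isConj_iff.1 (hg h hh)
    rw [← hc, cnt_conj, mul_comm]

lemma card_swaps : (2 : ℤ) * #(swaps α) = Fintype.card α * (Fintype.card α - 1) := by
  have := sum_swaps (α := α) (fun _ => (1 : ℤ))
  simp at this
  linear_combination this

lemma card_swaps' : #(swaps α) = (Fintype.card α).choose 2 := by
  have h1 := card_swaps (α := α)
  have h2 := congrArg (eval 1) (two_choose (Fintype.card α))
  simp at h2
  have : (#(swaps α) : ℤ) = (Fintype.card α).choose 2 := by linarith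
  exact_mod_cast this

lemma P_one : P (1 : Equiv.Perm α) = (1 - X) ^ Fintype.card α := by
  have : M (1 : Equiv.Perm α) = 1 := by
    ext1 i j; simp [M, Matrix.one_apply]; rfl
  rw [P, this]
  have : (1 - (X : ℤ[X]) • (1 : Matrix α α ℤ[X])) = (1 - X : ℤ[X]) • 1 := by
    rw [sub_smul, one_smul]
  rw [this, Matrix.det_smul, Matrix.det_one, mul_one]

lemma m_one : m (1 : Equiv.Perm α) = (Fintype.card α : ℤ[X]) := by
  simp [m, M]

lemma natDegree_pow (n : ℕ) : ((1 - X : ℤ[X]) ^ n).natDegree ≤ n := by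
  refine natDegree_pow_le_of_le (m := 1) n ?_ |>.trans (by simp)
  exact (natDegree_sub_le _ _).trans (by simp)

/-- Factorizations of a long cycle. -/
lemma long_count (hα : 2 ≤ Fintype.card α) (g : Equiv.Perm α) (hg : ∀ x y, g.SameCycle x y)
    (l K : ℕ) (hK : Fintype.card α ≤ K) :
    ((Fintype.card α).factorial : ℤ) * cnt l g =
      ∑ k ∈ range K, ((1 - X : ℤ[X]) ^ (Fintype.card α - 1)).coeff k *
        (((Fintype.card α).choose 2 : ℤ) - k * Fintype.card α) ^ l := by
  have : Nonempty α := Fintype.card_pos_iff.1 (by omega)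
  have : Nontrivial α := Fintype.one_lt_card_iff_nontrivial.1 (by omega)
  choose R hR using fun g : Equiv.Perm α => P_dvd g
  have hR1 : R 1 = (1 - X) ^ (Fintype.card α - 1) := by
    apply mul_left_cancel₀ one_sub_X_ne
    rw [← hR, P_one, ← pow_succ', Nat.sub_add_cancel (by omega)]
  have hcyc : ∀ h : Equiv.Perm α, (∀ x y, h.SameCycle x y) →
      h.IsCycle ∧ h.support = univ := by
    intro h hh
    have key : ∀ x, h x ≠ x := by
      intro x hx
      obtain ⟨y, hy⟩ := exists_ne x
      obtain ⟨k, hk⟩ := hh x y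
      rw [Equiv.Perm.zpow_apply_eq_self_of_apply_eq_self hx] at hk
      exact hy hk.symm
    refine ⟨⟨Classical.arbitrary α, key _, fun y _ => hh _ _⟩, ?_⟩
    ext x; simp [key x]
  have := main_count R (Fintype.card α) (by omega) (fun g => by
      rw [TR R hR, Lop, card_swaps']; simp) (fun g => by
      have := P_coeff_zero g
      rw [hR g] at this
      simpa [sub_mul] using this) g (fun h hh => by
      obtain ⟨a1, a2⟩ := hcyc g hg
      obtain ⟨b1, b2⟩ := hcyc h (R_support h _ (hR h) hh)
      exact a1.isConj b1 (by rw [a2, b2])) l K (by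
      rw [hR1]
      exact (natDegree_pow _).trans_lt (by omega))
  rw [hR1, card_swaps'] at this
  exact this

/-- Factorizations of an almost long cycle. -/
lemma almost_count (hα : 3 ≤ Fintype.card α) (g : Equiv.Perm α)
    (hg : g.IsCycle ∧ g.support.card = Fintype.card α - 1) (l : ℕ) :
    ((Fintype.card α).factorial : ℤ) * cnt l g =
      ∑ k ∈ range (Fintype.card α + 1), ((1 - X : ℤ[X]) ^ (Fintype.card α) +
        X * ((Fintype.card α : ℤ[X]) * (1 - X) ^ (Fintype.card α - 2))).coeff k *
        (((Fintype.card α).choose 2 : ℤ) - k * (Fintype.card α - 1)) ^ l := by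
  choose Q hQ using fun g : Equiv.Perm α => exists_Q (by omega) g
  have hne : ((1 - X) ^ 2 : ℤ[X]) ≠ 0 := pow_ne_zero _ one_sub_X_ne
  have hQ1 : Q 1 = (Fintype.card α : ℤ[X]) * (1 - X) ^ (Fintype.card α - 2) := by
    apply mul_left_cancel₀ hne
    rw [← hQ, P_one, m_one, mul_left_comm, ← pow_add]
    congr 2; omega
  have := main_count (fun g => P g + X * Q g) (Fintype.card α - 1) (by omega) (fun g => by
      rw [TS Q hQ, Lop, card_swaps']; simp) (fun g => by
      simp [P_coeff_zero g]) g (fun h hh => by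
      obtain ⟨b1, b2⟩ := S_support hα h _ (hQ h) hh
      exact hg.1.isConj b1 (by rw [hg.2, b2])) l (Fintype.card α + 1) (by
      rw [hQ1, P_one, Nat.lt_succ_iff]
      refine natDegree_add_le_of_degree_le (natDegree_pow _) ?_
      refine natDegree_mul_le.trans ?_
      rw [← C_eq_natCast]
      have h1 := natDegree_C_mul_le ((Fintype.card α : ℤ)) ((1 - X : ℤ[X]) ^ (Fintype.card α - 2))
      have h2 := natDegree_pow (Fintype.card α - 2)
      rw [natDegree_X]
      have h3 : ((Fintype.card α : ℕ) : ℤ[X]) = C (Fintype.card α : ℤ) := by simp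
      simp only [C_eq_natCast] at *
      simp at *
      omega)
  rw [hQ1, card_swaps', P_one] at this
  exact this

lemma cnt_card (l : ℕ) (g : Equiv.Perm α) :
    (Nat.card {t : Fin l → Equiv.Perm α // (∀ i, (t i).IsSwap) ∧ (List.ofFn t).prod = g} : ℤ)
      = cnt l g := by
  classical
  induction l generalizing g with
  | zero =>
    rw [cnt]
    split_ifs with h
    · subst h
      rw [Nat.card_eq_fintype_card, Fintype.card_subtype]
      simp
    · have : IsEmpty {t : Fin 0 → Equiv.Perm α // (∀ i, (t i).IsSwap) ∧ (List.ofFn t).prod = g} :=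
        ⟨fun t => h (by simpa using t.2.2.symm)⟩
      rw [Nat.card_of_isEmpty]; rfl
  | succ l ih =>
    let e : {t : Fin (l + 1) → Equiv.Perm α // (∀ i, (t i).IsSwap) ∧ (List.ofFn t).prod = g} ≃
        Σ s : {s // s ∈ swaps α}, {t : Fin l → Equiv.Perm α // (∀ i, (t i).IsSwap) ∧
          (List.ofFn t).prod = s.1⁻¹ * g} :=
      { toFun := fun t => ⟨⟨t.1 0, (mem_swaps _).2 (t.2.1 0)⟩, ⟨fun i => t.1 i.succ,
          fun i => t.2.1 i.succ, by
            have := t.2.2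
            rw [List.ofFn_succ, List.prod_cons] at this
            exact eq_inv_mul_iff_mul_eq.2 this⟩⟩
        invFun := fun t => ⟨Fin.cons t.1.1 t.2.1, fun i => by
            refine Fin.cases ?_ (fun i => ?_) i
            · simpa using (mem_swaps _).1 t.1.2
            · simpa using t.2.2.1 i, by
            rw [List.ofFn_succ, List.prod_cons]
            simp [t.2.2.2]⟩
        left_inv := fun t => by
          apply Subtype.ext
          funext i
          refine Fin.cases ?_ (fun i => ?_) i <;> simp
        right_inv := fun t => by
          rcases t with ⟨⟨s, hs⟩, ⟨t, ht⟩⟩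
          rfl }
    rw [Nat.card_congr e, Nat.card_sigma, cnt, ← sum_coe_sort (swaps α)]
    push_cast
    exact sum_congr rfl fun s _ => ih _

lemma nontrans_card (g : Equiv.Perm α) (i j : α) (hij : j ≠ i) (hi : g i = i)
    (hc : ∀ x y, x ≠ i → y ≠ i → g.SameCycle x y)
    (hinv : ∀ x, g x ≠ i ↔ x ≠ i) (l : ℕ) :
    Nat.card {t : Fin l → Equiv.Perm α // (∀ i, (t i).IsSwap) ∧ (List.ofFn t).prod = g ∧
        ¬ ∀ x y : α, ∃ p ∈ Subgroup.closure {p : Equiv.Perm α | ∃ i, p = t i}, p x = y} =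
    Nat.card {t : Fin l → Equiv.Perm {x // x ≠ i} // (∀ i, (t i).IsSwap) ∧
      (List.ofFn t).prod = g.subtypePerm (p := fun x => x ≠ i) hinv} := by
  symm
  have hgs : Equiv.Perm.ofSubtype (g.subtypePerm (p := fun x => x ≠ i) hinv) = g :=
    Equiv.Perm.ofSubtype_subtypePerm hinv (fun x hx e => hx (e ▸ hi))
  have hprod : ∀ t : Fin l → Equiv.Perm {x // x ≠ i},
      (List.ofFn fun k => Equiv.Perm.ofSubtype (t k)).prod =
        Equiv.Perm.ofSubtype (List.ofFn t).prod := by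
    intro t
    rw [map_list_prod, List.map_ofFn]; rfl
  have hinj : Function.Injective (Equiv.Perm.ofSubtype : Equiv.Perm {x // x ≠ i} →* _) :=
    Equiv.Perm.ofSubtype_injective
  refine Nat.card_congr (Equiv.ofBijective (fun t => ⟨fun k => Equiv.Perm.ofSubtype (t.1 k),
    fun k => (t.2.1 k).of_subtype_isSwap, by rw [hprod, t.2.2, hgs], ?_⟩) ⟨?_, ?_⟩)
  · intro h
    obtain ⟨p, hp, hpi⟩ := h i j
    have hle : Subgroup.closure {p : Equiv.Perm α | ∃ k, p = Equiv.Perm.ofSubtype (t.1 k)} ≤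
        MulAction.stabilizer (Equiv.Perm α) i := by
      rw [Subgroup.closure_le]
      rintro _ ⟨k, rfl⟩
      change Equiv.Perm.ofSubtype (t.1 k) i = i
      exact Equiv.Perm.ofSubtype_apply_of_not_mem _ (by simp)
    exact hij (hpi.symm.trans (hle hp))
  · intro t t' h
    apply Subtype.ext
    funext k
    exact hinj (congrFun (congrArg Subtype.val h) k)
  · rintro ⟨t, hs, hp, hn⟩
    have hfix : ∀ k, t k i = i := by
      intro k
      by_contra hk
      apply hn
      set H := Subgroup.closure {p : Equiv.Perm α | ∃ i, p = t i} with hH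
      have hmem : ∀ k, t k ∈ H := fun k => Subgroup.subset_closure ⟨k, rfl⟩
      have hg : g ∈ H := by
        rw [← hp]
        refine Subgroup.list_prod_mem _ fun x hx => ?_
        obtain ⟨k, rfl⟩ := (List.mem_ofFn' _ _).1 hx
        exact hmem k
      have key : ∀ x, ∃ p ∈ H, p (t k i) = x := by
        intro x
        by_cases hx : x = i
        · exact ⟨(t k)⁻¹, H.inv_mem (hmem k), by simp [hx]⟩
        · obtain ⟨z, hz⟩ := hc (t k i) x hk hx
          exact ⟨g ^ z, H.zpow_mem hg z, hz⟩
      intro x y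
      obtain ⟨p, hp1, hp2⟩ := key x
      obtain ⟨q, hq1, hq2⟩ := key y
      exact ⟨q * p⁻¹, H.mul_mem hq1 (H.inv_mem hp1), by simp [← hp2, hq2]⟩
    have hex : ∀ k, ∃ s : Equiv.Perm {x // x ≠ i}, s.IsSwap ∧ Equiv.Perm.ofSubtype s = t k := by
      intro k
      obtain ⟨a, b, hab, he⟩ := hs k
      have hf := hfix k
      have ha : a ≠ i := by
        rintro rfl
        rw [he, Equiv.swap_apply_left] at hf
        exact hab hf.symm
      have hb : b ≠ i := by
        rintro rfl
        rw [he, Equiv.swap_apply_right] at hf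
        exact hab hf
      refine ⟨Equiv.swap ⟨a, ha⟩ ⟨b, hb⟩, ⟨_, _, fun e => hab (congrArg Subtype.val e), rfl⟩, ?_⟩
      rw [he, Equiv.Perm.ofSubtype_swap_eq]
    choose s hs1 hs2 using hex
    refine ⟨⟨s, hs1, hinj ?_⟩, ?_⟩
    · rw [hgs, ← hprod, ← hp]
      simp only [hs2]
    · apply Subtype.ext
      funext k
      exact hs2 k

lemma coeff_pow (n k : ℕ) : ((1 - X : ℤ[X]) ^ n).coeff k = (-1) ^ k * n.choose k := by
  have h : (1 - X : ℤ[X]) ^ n = ((1 + X) ^ n : ℤ[X]).comp (C (-1) * X) := by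
    simp [sub_eq_add_neg]
  rw [h, comp_C_mul_X_coeff, coeff_one_add_X_pow, mul_comm]

end TF

/-- Transitive factorizations of the regular element `g = (12⋯(n−1))(n) ∈ S_n`:
for every `l ≥ 0`, the number of `l`-tuples of transpositions with product `g`
generating a transitive subgroup equals
`(1/n!) Σ_{k=0}^{n} (−1)^k (n choose k) (n(n−1)/2 − k(n−1))^l`. -/
theorem transitive_factorizations_of_almost_long_cycle
    (n : ℕ) (hn : 2 ≤ n) (g : Equiv.Perm (Fin n))
    (hg : g.IsCycle ∧ g.support.card = n - 1) (l : ℕ) :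
    (n.factorial : ℤ) *
      Nat.card {t : Fin l → Equiv.Perm (Fin n) //
        (∀ i, (t i).IsSwap) ∧ (List.ofFn t).prod = g ∧
        ∀ x y : Fin n,
          ∃ p ∈ Subgroup.closure {p : Equiv.Perm (Fin n) | ∃ i, p = t i}, p x = y} =
      ∑ k ∈ Finset.range (n + 1),
        (-1 : ℤ) ^ k * (n.choose k) * ((n.choose 2 : ℤ) - k * ((n : ℤ) - 1)) ^ l := by
  classical
  have hn3 : 3 ≤ n := by
    have := hg.1.two_le_card_support
    omega
  -- the fixed point
  obtain ⟨i, hi⟩ : ∃ i, g i = i := by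
    by_contra hc
    push Not at hc
    have : g.support = Finset.univ := by
      ext x; simp [hc x]
    have h2 := hg.2
    rw [this, Finset.card_univ, Fintype.card_fin] at h2
    omega
  have hsupp : ∀ x, x ≠ i → g x ≠ x := by
    intro x hx
    have h1 : g.support ⊆ Finset.univ.erase i := by
      intro y hy
      rw [Finset.mem_erase]
      exact ⟨fun e => (Equiv.Perm.mem_support.1 hy) (e ▸ hi), Finset.mem_univ _⟩
    have h2 := Finset.eq_of_subset_of_card_le h1 (by
      rw [hg.2, Finset.card_erase_of_mem (Finset.mem_univ _), Finset.card_univ, Fintype.card_fin])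
    have : x ∈ g.support := by rw [h2]; simp [hx]
    exact Equiv.Perm.mem_support.1 this
  have hc : ∀ x y, x ≠ i → y ≠ i → g.SameCycle x y := fun x y hx hy =>
    hg.1.sameCycle (hsupp x hx) (hsupp y hy)
  have hinv : ∀ x, g x ≠ i ↔ x ≠ i := fun x => by
    rw [ne_eq, ne_eq, not_iff_not]; constructor
    · intro h; exact g.injective (h.trans hi.symm)
    · rintro rfl; exact hi
  obtain ⟨j, hij⟩ : ∃ j, j ≠ i := by
    have : Nontrivial (Fin n) := Fin.nontrivial_iff_two_le.2 hn
    exact exists_ne i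
  have hnt := TF.nontrans_card g i j hij hi hc hinv l
  have hcardβ : Fintype.card {x : Fin n // x ≠ i} = n - 1 := by
    simp
  have hsum : Nat.card {t : Fin l → Equiv.Perm (Fin n) //
        (∀ i, (t i).IsSwap) ∧ (List.ofFn t).prod = g ∧
        ∀ x y : Fin n,
          ∃ p ∈ Subgroup.closure {p : Equiv.Perm (Fin n) | ∃ i, p = t i}, p x = y} +
      Nat.card {t : Fin l → Equiv.Perm (Fin n) //
        (∀ i, (t i).IsSwap) ∧ (List.ofFn t).prod = g ∧
        ¬ ∀ x y : Fin n,
          ∃ p ∈ Subgroup.closure {p : Equiv.Perm (Fin n) | ∃ i, p = t i}, p x = y} =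
      Nat.card {t : Fin l → Equiv.Perm (Fin n) //
        (∀ i, (t i).IsSwap) ∧ (List.ofFn t).prod = g} := by
    simp only [Nat.card_eq_fintype_card, Fintype.card_subtype, ← and_assoc]
    simp only [← Finset.filter_filter _ _ Finset.univ]
    exact Finset.card_filter_add_card_filter_not _
  have h1 := TF.almost_count (by simpa using hn3) g (by simpa using hg) l
  have h2 := TF.long_count (α := {x : Fin n // x ≠ i}) (by rw [hcardβ]; omega)
    (g.subtypePerm (p := fun x => x ≠ i) hinv) (fun x y => by
      rw [Equiv.Perm.sameCycle_subtypePerm]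
      exact hc _ _ x.2 y.2) l n (by rw [hcardβ]; omega)
  rw [← TF.cnt_card] at h1 h2
  rw [← hsum, hnt] at h1
  rw [hcardβ] at h2
  rw [Fintype.card_fin] at h1
  generalize Nat.card {t : Fin l → Equiv.Perm {x : Fin n // x ≠ i} // (∀ i, (t i).IsSwap) ∧
      (List.ofFn t).prod = g.subtypePerm (p := fun x => x ≠ i) hinv} = z at *
  have hfac : (n.factorial : ℤ) = n * (n - 1).factorial := by
    rw [← Nat.mul_factorial_pred (by omega)]; push_cast; rfl
  have hch : (n.choose 2 : ℤ) = (n - 1).choose 2 + (n - 1 : ℕ) := by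
    obtain ⟨r, rfl⟩ : ∃ r, n = r + 1 := ⟨n - 1, by omega⟩
    rw [Nat.add_sub_cancel, Nat.choose_succ_succ' r 1, Nat.choose_one_right]
    push_cast; ring
  have hn1 : ((n - 1 : ℕ) : ℤ) = n - 1 := by
    push_cast [show 1 ≤ n by omega]; ring
  have h3 : (n : ℤ) * ∑ k ∈ Finset.range n, ((1 - Polynomial.X : Polynomial ℤ) ^ (n - 1 - 1)).coeff k *
        (((n - 1).choose 2 : ℤ) - k * (n - 1 : ℕ)) ^ l =
      ∑ k ∈ Finset.range (n + 1), (Polynomial.X * ((n : Polynomial ℤ) *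
        (1 - Polynomial.X) ^ (n - 2))).coeff k * ((n.choose 2 : ℤ) - k * (n - 1)) ^ l := by
    rw [Finset.sum_range_succ', Finset.mul_sum]
    simp only [Polynomial.coeff_X_mul, Polynomial.coeff_X_mul_zero, zero_mul, add_zero]
    refine Finset.sum_congr rfl fun k _ => ?_
    rw [← Polynomial.C_eq_natCast, Polynomial.coeff_C_mul, mul_assoc, hch, hn1, Nat.sub_sub]
    push_cast
    ring
  simp only [Polynomial.coeff_add, add_mul, Finset.sum_add_distrib, TF.coeff_pow] at h1
  rw [← h3] at h1
  simp only [TF.coeff_pow] at h1 h2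
  rw [← h2] at h1
  push_cast at h1
  linear_combination h1 - (z : ℤ) * hfac
end

section
/- Jackson's formula: Let n ≥ 1 and let g ∈ S_n be an n-cycle. Then for every l ≥ 0, the number of tuples (t_1, …, t_l) of transpositions in S_n with t_1⋯t_l = g equals (1/n!) · Σ_{k=0}^{n−1} (−1)^k · binom(n−1, k) · (n(n−1)/2 − k·n)^l. -/
open scoped BigOperators

namespace Jackson
open Polynomial Matrix Equiv

lemma det_rank_one {n : ℕ} {R : Type*} [CommRing R] [IsDomain R] (A : Matrix (Fin n) (Fin n) R)
    (hA : A.det ≠ 0) (u v : Fin n → R) :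
    (A + Matrix.of fun a b => u a * v b).det
      = A.det + ∑ a, ∑ b, v b * A.adjugate b a * u a := by
  apply IsFractionRing.injective R (FractionRing R)
  set φ := algebraMap R (FractionRing R) with hφ
  have hA' : IsUnit (φ.mapMatrix A).det := by
    rw [← RingHom.map_det, isUnit_iff_ne_zero]
    exact fun h => hA ((map_eq_zero_iff φ (IsFractionRing.injective R (FractionRing R))).1 h)
  have key := det_add_replicateCol_mul_replicateRow (ι := Unit) hA' (φ ∘ u) (φ ∘ v)
  have e1 : φ.mapMatrix (A + Matrix.of fun a b => u a * v b) =
      φ.mapMatrix A + replicateCol Unit (φ ∘ u) * replicateRow Unit (φ ∘ v) := by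
    ext a b
    simp [Matrix.mul_apply]
  rw [RingHom.map_det, e1, key, det_unique (n := Unit), map_add, RingHom.map_det]
  have h2 : ((φ.mapMatrix A).det) • (φ.mapMatrix A)⁻¹ = φ.mapMatrix A.adjugate := by
    rw [Matrix.inv_def, smul_smul, Ring.mul_inverse_cancel _ hA', one_smul, RingHom.map_adjugate]
  rw [Matrix.add_apply, mul_add]
  congr 1
  · simp
  · have h3 : ∀ b a, (φ.mapMatrix A).det * (φ.mapMatrix A)⁻¹ b a = φ (A.adjugate b a) := by
      intro b a
      simpa using congrFun (congrFun h2 b) a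
    simp only [Matrix.mul_apply, replicateRow_apply, replicateCol_apply, Function.comp,
      Finset.mul_sum, Finset.sum_mul, map_sum, map_mul]
    refine Finset.sum_congr rfl fun a _ => Finset.sum_congr rfl fun b _ => ?_
    rw [← h3]; ring

lemma derivative_det' {n : ℕ} (A : Matrix (Fin n) (Fin n) ℤ[X]) :
    derivative A.det = ∑ a, ∑ b, derivative (A a b) * A.adjugate b a := by
  have h1 : ∀ a, ∑ b, derivative (A a b) * A.adjugate b a
      = (A.updateRow a (fun b => derivative (A a b))).det := by
    intro a
    rw [det_eq_sum_mul_adjugate_row _ a]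
    refine Finset.sum_congr rfl fun b _ => ?_
    rw [adjugate_apply, adjugate_apply]
    simp
  simp only [h1]
  simp only [← det_transpose (updateRow _ _ _)]
  rw [← det_transpose]
  simp only [det_apply', map_sum, transpose_apply]
  rw [Finset.sum_comm]
  refine Finset.sum_congr rfl fun σ _ => ?_
  rw [← Finset.mul_sum, derivative_intCast_mul, derivative_prod_finset]
  congr 1
  refine Finset.sum_congr rfl fun a _ => ?_
  rw [← Finset.mul_prod_erase _ _ (Finset.mem_univ a), mul_comm]
  congr 1
  · simp
  · refine Finset.prod_congr rfl fun b hb => ?_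
    rw [updateRow_ne (Finset.ne_of_mem_erase hb)]

/-- The matrix `1 - X P_σ`. -/
noncomputable def A {n : ℕ} (σ : Perm (Fin n)) : Matrix (Fin n) (Fin n) ℤ[X] :=
  Matrix.of fun a b => (if a = b then 1 else 0) - (if a = σ b then X else 0)

lemma dvd_det {ι R : Type*} [Fintype ι] [DecidableEq ι] [Nonempty ι] [CommRing R]
    (M : Matrix ι ι R) (c : R) (h : ∀ j, ∑ i, M j i = c) : c ∣ M.det := by
  have i : ι := Classical.arbitrary ι
  have h1 := congrArg (fun N => ∑ j, N i j) (adjugate_mul M)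
  simp only [Matrix.mul_apply] at h1
  rw [Finset.sum_comm] at h1
  simp only [← Finset.mul_sum, h, ← Finset.sum_mul] at h1
  refine ⟨∑ j, M.adjugate i j, ?_⟩
  rw [mul_comm c, h1]
  simp [Matrix.one_apply]

lemma row_sum {n : ℕ} (σ : Perm (Fin n)) (a : Fin n) : ∑ b, A σ a b = 1 - X := by
  simp only [A, of_apply, Finset.sum_sub_distrib]
  congr 1
  · simp
  · rw [Finset.sum_eq_single (σ⁻¹ a)] <;> simp
    intro b hb h; exact absurd (by simp [h]) hb

lemma col_sum {n : ℕ} (σ : Perm (Fin n)) (b : Fin n) : ∑ a, A σ a b = 1 - X := by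
  simp [A]

lemma oneX : (1 - X : ℤ[X]) ≠ 0 := by
  intro h
  have := congrArg (eval 0) h
  simp at this

lemma det_ne {n : ℕ} (σ : Perm (Fin n)) : (A σ).det ≠ 0 := by
  intro h
  have h1 := congrArg (evalRingHom (0:ℤ)) h
  rw [RingHom.map_det] at h1
  have : (evalRingHom (0:ℤ)).mapMatrix (A σ) = 1 := by
    ext a b
    simp [A, Matrix.one_apply]
    split_ifs <;> simp
  rw [this] at h1
  simp at h1

lemma exists_f {n : ℕ} (hn : 1 ≤ n) (σ : Perm (Fin n)) : ∃ f : ℤ[X], (A σ).det = (1 - X) * f := by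
  have : Nonempty (Fin n) := ⟨⟨0, hn⟩⟩
  exact dvd_det _ _ (row_sum σ)

lemma A_swap {n : ℕ} (σ : Perm (Fin n)) (i j : Fin n) :
    A (swap i j * σ) = A σ + Matrix.of fun a b =>
      (X * ((if a = i then 1 else 0) - (if a = j then 1 else 0))) *
        ((if σ b = i then 1 else 0) - (if σ b = j then 1 else 0)) := by
  have key : ∀ a b c : Fin n, (((if a = b then 1 else 0) - if a = swap i j c then X else 0) : ℤ[X]) =
      ((if a = b then 1 else 0) - if a = c then X else 0) +
        X * ((if a = i then 1 else 0) - if a = j then 1 else 0) *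
          ((if c = i then 1 else 0) - if c = j then 1 else 0) := by
    intro a b c
    rw [swap_apply_def]
    by_cases h1 : c = i <;> by_cases h2 : c = j <;> by_cases h3 : a = i <;>
      by_cases h4 : a = j <;> simp [h1, h2, h3, h4] <;> grind
  ext1 a b
  exact key a b (σ b)

lemma det_swap {n : ℕ} (σ : Perm (Fin n)) (i j : Fin n) :
    (A (swap i j * σ)).det = (A σ).det + X * (
      (A σ).adjugate (σ⁻¹ i) i + (A σ).adjugate (σ⁻¹ j) j
       - (A σ).adjugate (σ⁻¹ i) j - (A σ).adjugate (σ⁻¹ j) i) := by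
  rw [A_swap, det_rank_one _ (det_ne σ)]
  congr 1
  have : ∀ a, ∑ b, ((if σ b = i then 1 else 0) - (if σ b = j then 1 else 0)) *
      (A σ).adjugate b a * (X * ((if a = i then 1 else 0) - (if a = j then 1 else 0)))
      = X * (((A σ).adjugate (σ⁻¹ i) a - (A σ).adjugate (σ⁻¹ j) a) *
        ((if a = i then 1 else 0) - (if a = j then 1 else 0))) := by
    intro a
    rw [← Finset.sum_mul, ← Equiv.sum_comp σ⁻¹]
    simp [sub_mul]
    ring
  simp only [this, ← Finset.mul_sum]
  congr 1
  simp [mul_sub]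
  ring

lemma adj_row {n : ℕ} (σ : Perm (Fin n)) (f : ℤ[X]) (hf : (A σ).det = (1 - X) * f) (i : Fin n) :
    ∑ j, (A σ).adjugate i j = f := by
  apply mul_left_cancel₀ oneX
  rw [← hf]
  have h1 := congrArg (fun N => ∑ j, N i j) (adjugate_mul (A σ))
  simp only [Matrix.mul_apply] at h1
  rw [Finset.sum_comm] at h1
  simp only [← Finset.mul_sum, row_sum, ← Finset.sum_mul] at h1
  rw [mul_comm, h1]
  simp [Matrix.one_apply]

lemma deriv_A {n : ℕ} (σ : Perm (Fin n)) :
    derivative (A σ).det = - ∑ i, (A σ).adjugate (σ⁻¹ i) i := by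
  rw [derivative_det']
  rw [← Finset.sum_neg_distrib]
  refine Finset.sum_congr rfl fun a _ => ?_
  rw [← Equiv.sum_comp σ⁻¹]
  have : ∀ b, derivative (A σ a (σ⁻¹ b)) = if a = b then -1 else 0 := by
    intro b
    simp only [A, of_apply, derivative_sub]
    rw [← Perm.mul_apply, mul_inv_cancel, Perm.one_apply]
    split_ifs <;> simp
  simp only [this]
  simp

lemma sum_pairs {n : ℕ} (σ : Perm (Fin n)) (f : ℤ[X]) (hf : (A σ).det = (1 - X) * f) :
    ∑ i, ∑ j, (A (swap i j * σ)).det = (1 - X) * ((n : ℤ[X]) ^ 2 * f - 2 * (n : ℤ[X]) * X * derivative f) := by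
  simp only [det_swap, Finset.sum_add_distrib, ← Finset.mul_sum, Finset.sum_sub_distrib,
    adj_row σ f hf]
  rw [Finset.sum_comm (f := fun i j => (A σ).adjugate (σ⁻¹ j) i)]
  have h1 : ∀ i, ∑ j, (A σ).adjugate (σ⁻¹ i) j = f := fun i => adj_row σ f hf _
  have h2 := deriv_A σ
  have h3 : ∑ i, (A σ).adjugate (σ⁻¹ i) i = - derivative (A σ).det := by rw [h2]; ring
  simp only [h1, Finset.sum_const, Finset.card_univ, Fintype.card_fin, nsmul_eq_mul,
    ← Finset.mul_sum, h3]
  rw [hf]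
  simp
  ring

noncomputable instance swapFintype (n : ℕ) : Fintype {t : Perm (Fin n) // t.IsSwap} :=
  Fintype.ofFinite _

lemma sum_swaps {n : ℕ} {M : Type*} [AddCommGroup M] (F : Perm (Fin n) → M) :
    ∑ i, ∑ j, F (swap i j) = n • F 1 + 2 • ∑ t : {t : Perm (Fin n) // t.IsSwap}, F t := by
  have h1 : ∑ t : {t : Perm (Fin n) // t.IsSwap}, F t
      = ∑ p : Fin n × Fin n with p.1 < p.2, F (swap p.1 p.2) := by
    symm
    refine Finset.sum_bij (fun p hp => ⟨swap p.1 p.2, p.1, p.2, ?_, rfl⟩) ?_ ?_ ?_ ?_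
    · simp at hp; exact hp.ne
    · simp
    · rintro ⟨a, b⟩ hp ⟨c, d⟩ hq h
      simp only [Finset.mem_filter, Finset.mem_univ, true_and] at hp hq
      replace h := congrArg Subtype.val h
      dsimp only at h
      have ha := congrArg (fun e => e a) h
      have hb := congrArg (fun e => e c) h
      simp only [swap_apply_def] at ha hb
      ext <;> grind
    · rintro ⟨t, x, y, hxy, rfl⟩ _
      rcases lt_or_gt_of_ne hxy with h | h
      · exact ⟨(x, y), by simpa using h, rfl⟩
      · exact ⟨(y, x), by simpa using h, by simp [Equiv.swap_comm x y]⟩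
    · simp
  have h2 : ∑ p : Fin n × Fin n with p.1 < p.2, F (swap p.1 p.2)
      = ∑ i, ∑ j, if i < j then F (swap i j) else 0 := by
    rw [Finset.sum_filter, Fintype.sum_prod_type]
  have h3 : ∑ p : Fin n × Fin n with p.1 < p.2, F (swap p.1 p.2)
      = ∑ i, ∑ j, if j < i then F (swap i j) else 0 := by
    rw [h2, Finset.sum_comm]
    refine Finset.sum_congr rfl fun i _ => Finset.sum_congr rfl fun j _ => ?_
    rw [Equiv.swap_comm]
  rw [two_smul, h1]
  nth_rw 1 [h2]
  rw [h3]
  have h4 : n • F 1 = ∑ i : Fin n, ∑ j, if i = j then F (swap i j) else 0 := by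
    simp [Perm.one_def]
  rw [h4]
  simp only [← Finset.sum_add_distrib]
  refine Finset.sum_congr rfl fun i _ => Finset.sum_congr rfl fun j _ => ?_
  rcases lt_trichotomy i j with h | h | h
  · simp [h, h.ne, h.not_gt]
  · simp [h]
  · simp [h, h.ne', h.not_gt]

lemma eigen {n : ℕ} (f : Perm (Fin n) → ℤ[X]) (hf : ∀ σ, (A σ).det = (1 - X) * f σ)
    (σ : Perm (Fin n)) (k : ℕ) :
    ∑ t : {t : Perm (Fin n) // t.IsSwap}, (f (t * σ)).coeff k
      = ((n.choose 2 : ℤ) - k * n) * (f σ).coeff k := by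
  have h1 := sum_pairs σ (f σ) (hf σ)
  rw [sum_swaps (fun t => (A (t * σ)).det)] at h1
  simp only [hf, one_mul, ← Finset.mul_sum] at h1
  have h2 : (n : ℤ[X]) * f σ + 2 * ∑ t : {t : Perm (Fin n) // t.IsSwap}, f (t * σ)
      = (n : ℤ[X]) ^ 2 * f σ - 2 * (n : ℤ[X]) * X * derivative (f σ) := by
    apply mul_left_cancel₀ oneX
    rw [← h1]
    simp only [nsmul_eq_mul]
    push_cast
    ring
  have h3 := congrArg (fun p => coeff p k) h2
  have e1 : (n : ℤ[X]) = C (n : ℤ) := by simp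
  have e2 : (2 : ℤ[X]) = C (2 : ℤ) := by simp
  have e3 : coeff (X * derivative (f σ)) k = k * (f σ).coeff k := by
    cases k with
    | zero => simp
    | succ k => rw [coeff_X_mul, coeff_derivative]; push_cast; ring
  rw [e1, e2] at h3
  simp only [coeff_add, coeff_sub, mul_assoc, ← C_pow, coeff_C_mul, e3, finsetSum_coeff] at h3
  have h4 : (2 : ℤ) * n.choose 2 = n * n - n := by
    have := Nat.triangle_succ
    have h5 : n.choose 2 * 2 = n * (n - 1) := by
      rw [Nat.choose_two_right]
      exact Nat.div_mul_cancel (Nat.even_mul_pred_self n).two_dvd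
    cases n with
    | zero => simp
    | succ m =>
      simp only [Nat.add_sub_cancel] at h5
      zify at h5 ⊢
      linear_combination h5
  have : (2 : ℤ) ≠ 0 := by norm_num
  apply mul_left_cancel₀ this
  linear_combination h3 - (f σ).coeff k * h4

lemma sum_tuples {n : ℕ} (a : Perm (Fin n) → ℤ) (c : ℤ)
    (h : ∀ σ, ∑ t : {t : Perm (Fin n) // t.IsSwap}, a (t * σ) = c * a σ) (l : ℕ) :
    ∑ t : Fin l → {t : Perm (Fin n) // t.IsSwap}, a (List.ofFn (fun i => (t i : Perm (Fin n)))).prod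
      = c ^ l * a 1 := by
  induction l with
  | zero => simp
  | succ l ih =>
    rw [← Equiv.sum_comp (Fin.consEquiv fun _ => {t : Perm (Fin n) // t.IsSwap}),
      Fintype.sum_prod_type, Finset.sum_comm]
    simp only [Fin.consEquiv, Equiv.coe_fn_mk, List.ofFn_succ, Fin.cons_zero, Fin.cons_succ,
      List.prod_cons, h]
    rw [← Finset.mul_sum, ih]
    ring

lemma f_one {n : ℕ} (hn : 1 ≤ n) (f : ℤ[X]) (hf : (A (1 : Perm (Fin n))).det = (1 - X) * f) :
    f = (1 - X) ^ (n - 1) := by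
  apply mul_left_cancel₀ oneX
  rw [← hf]
  have : A (1 : Perm (Fin n)) = (1 - X : ℤ[X]) • (1 : Matrix (Fin n) (Fin n) ℤ[X]) := by
    ext1 a b
    by_cases h : a = b <;> simp [A, h]
  rw [this, det_smul, det_one, mul_one, Fintype.card_fin, ← pow_succ', Nat.sub_add_cancel hn]

lemma coeff_pow (m k : ℕ) : ((1 - X : ℤ[X]) ^ m).coeff k = (-1) ^ k * m.choose k := by
  induction m generalizing k with
  | zero => cases k <;> simp [coeff_one]
  | succ m ih =>
    rw [pow_succ', sub_mul, one_mul, coeff_sub, ih]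
    cases k with
    | zero => simp
    | succ k =>
      rw [coeff_X_mul, ih, Nat.choose_succ_succ]
      push_cast
      ring

lemma f_deg {n : ℕ} (hn : 1 ≤ n) (σ : Perm (Fin n)) (f : ℤ[X]) (hf : (A σ).det = (1 - X) * f) :
    f.natDegree < n := by
  by_cases h0 : f = 0
  · subst h0; simpa using Nat.lt_of_lt_of_le Nat.zero_lt_one hn
  have h1 : (A σ).det.natDegree ≤ n := by
    rw [det_apply]
    refine natDegree_sum_le_of_forall_le _ _ fun τ _ => ?_
    refine (natDegree_smul_le _ _).trans ?_
    refine (natDegree_prod_le _ _).trans ?_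
    refine (Finset.sum_le_card_nsmul _ _ 1 fun i _ => ?_).trans (by simp)
    simp only [A, of_apply]
    refine (natDegree_sub_le _ _).trans (max_le ?_ ?_) <;> split_ifs <;> simp
  rw [hf, natDegree_mul oneX h0] at h1
  have : (1 - X : ℤ[X]).natDegree = 1 := by
    rw [← neg_sub, natDegree_neg]; exact natDegree_X_sub_C (1:ℤ)
  omega

lemma f_not_cycle {n : ℕ} (σ : Perm (Fin n)) (f : ℤ[X]) (hf : (A σ).det = (1 - X) * f)
    (x y : Fin n) (hxy : ¬ σ.SameCycle x y) : f.eval 1 = 0 := by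
  classical
  have hb := twoBlockTriangular_det (A σ) (fun i => σ.SameCycle x i) (by
    intro i hi j hj
    have h1 : i ≠ j := by rintro rfl; exact hi hj
    have h2 : i ≠ σ j := by rintro rfl; exact hi (by simpa using hj)
    simp [A, h1, h2])
  have : Nonempty {i // σ.SameCycle x i} := ⟨⟨x, Perm.SameCycle.refl _ _⟩⟩
  have : Nonempty {i // ¬ σ.SameCycle x i} := ⟨⟨y, hxy⟩⟩
  have key : ∀ (p : Fin n → Prop) [DecidablePred p], (∀ i, p (σ i) ↔ p i) →
      ∀ j : {i // p i}, ∑ i, toSquareBlockProp (A σ) p j i = 1 - X := by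
    intro p _ hp j
    rw [← row_sum σ j]
    have h0 : ∑ b : {b // ¬ p b}, A σ j b = 0 := by
      refine Finset.sum_eq_zero fun b _ => ?_
      have h1 : (j : Fin n) ≠ b := by
        intro h; exact b.2 (h ▸ j.2)
      have h2 : (j : Fin n) ≠ σ b := by
        intro h; exact b.2 ((hp _).1 (h ▸ j.2))
      simp [A, h1, h2]
    rw [← Fintype.sum_subtype_add_sum_subtype p (fun b => A σ j b), h0, add_zero]
    rfl
  obtain ⟨u, hu⟩ := dvd_det _ _ (key (fun i => σ.SameCycle x i) (by simp))
  obtain ⟨v, hv⟩ := dvd_det _ _ (key (fun i => ¬ σ.SameCycle x i) (by simp))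
  have : f = (1 - X) * (u * v) := by
    apply mul_left_cancel₀ oneX
    rw [← hf, hb, hu, hv]; ring
  rw [this]; simp

lemma f_cycle {n : ℕ} (σ : Perm (Fin n)) (f : ℤ[X]) (hf : (A σ).det = (1 - X) * f)
    (hσ : σ.IsCycle) (hs : σ.support.card = n) : f.eval 1 = n := by
  have hall : ∀ x, σ x ≠ x := by
    intro x
    have : σ.support = Finset.univ := by
      rw [← Finset.card_eq_iff_eq_univ, hs, Fintype.card_fin]
    rw [← Perm.mem_support, this]; simp
  have hdet : (A σ).det = 1 - X ^ n := by
    rw [det_apply', ← Finset.sum_subset (Finset.subset_univ {1, σ}), Finset.sum_pair hσ.ne_one.symm]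
    · have e1 : ∀ i, A σ i i = 1 := by
        intro i; simp [A, (hall i).symm]
      have e2 : ∀ i, A σ (σ i) i = -X := by
        intro i; simp [A, hall i]
      simp only [Perm.one_apply, e1, e2, hσ.sign, hs]
      simp
      rw [neg_pow (X : ℤ[X]), ← sub_eq_zero]
      have : ((-1 : ℤ[X]) ^ n) * (-1) ^ n = 1 := by rw [← mul_pow]; simp
      linear_combination (- X ^ n) * this
    · intro τ _ hτ
      by_contra hne
      apply hτ
      have hne' : ∏ i, A σ (τ i) i ≠ 0 := fun h => hne (by rw [h, mul_zero])
      rw [Finset.prod_ne_zero_iff] at hne'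
      have hor : ∀ i, τ i = i ∨ τ i = σ i := by
        intro i
        by_contra h
        push Not at h
        exact hne' i (Finset.mem_univ _) (by simp [A, h.1, h.2])
      by_cases h1 : ∃ i, τ i = σ i
      · obtain ⟨i, hi⟩ := h1
        have hk : ∀ k : ℕ, τ ((σ ^ k) i) = σ ((σ ^ k) i) := by
          intro k
          induction k with
          | zero => simpa using hi
          | succ k ih =>
            rw [pow_succ', Perm.mul_apply]
            rcases hor (σ ((σ ^ k) i)) with h | h
            · have := τ.injective (h.trans ih.symm)
              exact absurd this (hall _)
            · exact h
        have : τ = σ := by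
          ext1 y
          obtain ⟨k, rfl⟩ := hσ.exists_pow_eq (hall i) (hall y)
          exact hk k
        simp [this]
      · push Not at h1
        have : τ = 1 := by
          ext1 y
          exact (hor y).resolve_right (h1 y)
        simp [this]
  have h := congrArg (fun p => eval 1 (derivative p)) (hdet.symm.trans hf)
  simp [derivative_mul, derivative_X_pow] at h
  linarith

lemma eval_f {n : ℕ} (hn : 2 ≤ n) (σ : Perm (Fin n)) (f : ℤ[X])
    (hf : (A σ).det = (1 - X) * f) [Decidable (σ.cycleType = {n})] :
    f.eval 1 = if σ.cycleType = {n} then (n : ℤ) else 0 := by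
  split_ifs with h
  · have hc : σ.IsCycle := by
      rw [← Perm.card_cycleType_eq_one, h]; simp
    refine f_cycle σ f hf hc ?_
    rw [← Perm.sum_cycleType, h]; simp
  · by_contra hne
    apply h
    have hall : ∀ x y, σ.SameCycle x y := by
      intro x y
      by_contra hxy
      exact hne (f_not_cycle σ f hf x y hxy)
    have hfix : ∀ x, σ x ≠ x := by
      intro x hx
      have h0 := (hall x ⟨0, by omega⟩).eq_of_left hx
      have h1 := (hall x ⟨1, by omega⟩).eq_of_left hx
      have := h0.symm.trans h1
      simp at this
    have hc : σ.IsCycle := ⟨⟨0, by omega⟩, hfix _, fun y _ => hall _ _⟩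
    have hs : σ.support = Finset.univ := by
      ext x; simp [hfix x]
    rw [hc.cycleType, hs]; simp

lemma prod_conj {n l : ℕ} (c : Perm (Fin n)) (t : Fin l → Perm (Fin n)) :
    (List.ofFn fun i => c * t i * c⁻¹).prod = c * (List.ofFn t).prod * c⁻¹ := by
  have := map_list_prod (MulAut.conj c) (List.ofFn t)
  rw [List.map_ofFn] at this
  simpa [Function.comp_def] using this.symm

lemma swap_conj {n : ℕ} (c t : Perm (Fin n)) (ht : t.IsSwap) : (c * t * c⁻¹).IsSwap := by
  obtain ⟨x, y, hxy, rfl⟩ := ht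
  refine ⟨c x, c y, c.injective.ne hxy, ?_⟩
  rw [Equiv.mul_swap_eq_swap_mul]; simp

/-- product of a tuple of transpositions -/
def pr {n l : ℕ} (t : Fin l → {t : Perm (Fin n) // t.IsSwap}) : Perm (Fin n) :=
  (List.ofFn (fun i => (t i : Perm (Fin n)))).prod

lemma card_conj_le {n l : ℕ} (c τ : Perm (Fin n)) :
    (Finset.univ.filter fun t : Fin l → {t : Perm (Fin n) // t.IsSwap} => pr t = τ).card ≤
    (Finset.univ.filter fun t : Fin l → {t : Perm (Fin n) // t.IsSwap} =>
      pr t = c * τ * c⁻¹).card := by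
  apply Finset.card_le_card_of_injOn (fun t i => ⟨c * t i * c⁻¹, swap_conj c _ (t i).2⟩)
  · intro t ht
    simp only [Finset.coe_filter, Finset.mem_univ, true_and, Set.mem_ofPred_eq] at ht ⊢
    rw [← ht]
    exact prod_conj c _
  · intro t _ s _ h
    funext i
    have := congrArg Subtype.val (congrFun h i)
    apply Subtype.ext
    simpa using this

lemma card_conj {n l : ℕ} (σ τ : Perm (Fin n)) (h : IsConj σ τ) :
    (Finset.univ.filter fun t : Fin l → {t : Perm (Fin n) // t.IsSwap} => pr t = τ).card =
    (Finset.univ.filter fun t : Fin l → {t : Perm (Fin n) // t.IsSwap} => pr t = σ).card := by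
  obtain ⟨c, rfl⟩ := isConj_iff.1 h
  apply le_antisymm
  · have := card_conj_le (l := l) c⁻¹ (c * σ * c⁻¹)
    simpa [mul_assoc] using this
  · exact card_conj_le c σ

lemma card_eq {n l : ℕ} (g : Perm (Fin n)) :
    Nat.card {t : Fin l → Equiv.Perm (Fin n) //
        (∀ i, (t i).IsSwap) ∧ (List.ofFn t).prod = g} =
    (Finset.univ.filter fun t : Fin l → {t : Perm (Fin n) // t.IsSwap} => pr t = g).card := by
  rw [← Fintype.card_subtype, ← Nat.card_eq_fintype_card]
  exact Nat.card_congr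
    { toFun := fun t => ⟨fun i => ⟨t.1 i, t.2.1 i⟩, t.2.2⟩
      invFun := fun t => ⟨fun i => t.1 i, fun i => (t.1 i).2, t.2⟩
      left_inv := fun t => rfl
      right_inv := fun t => rfl }

end Jackson

theorem jackson_formula
    (n : ℕ) (hn : 1 ≤ n) (g : Equiv.Perm (Fin n))
    (hg : g.IsCycle ∧ g.support.card = n) (l : ℕ) :
    (n.factorial : ℤ) *
      Nat.card {t : Fin l → Equiv.Perm (Fin n) //
        (∀ i, (t i).IsSwap) ∧ (List.ofFn t).prod = g} =
      ∑ k ∈ Finset.range n,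
        (-1 : ℤ) ^ k * ((n - 1).choose k) * ((n.choose 2 : ℤ) - k * n) ^ l := by
  classical
  have h2 : 2 ≤ n := hg.2 ▸ hg.1.two_le_card_support
  have hgt : g.cycleType = {n} := by rw [hg.1.cycleType, hg.2]
  choose f hf using Jackson.exists_f (n := n) hn
  have hR : ∑ t : Fin l → {t : Equiv.Perm (Fin n) // t.IsSwap}, (f (Jackson.pr t)).eval 1 =
      ∑ k ∈ Finset.range n,
        (-1 : ℤ) ^ k * ((n - 1).choose k) * ((n.choose 2 : ℤ) - k * n) ^ l := by
    have : ∀ τ, (f τ).eval 1 = ∑ k ∈ Finset.range n, (f τ).coeff k := by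
      intro τ
      rw [Polynomial.eval_eq_sum_range' (Jackson.f_deg hn τ _ (hf τ))]
      simp
    simp only [this]
    rw [Finset.sum_comm]
    refine Finset.sum_congr rfl fun k _ => ?_
    have := Jackson.sum_tuples (fun τ => (f τ).coeff k) _
      (fun σ => Jackson.eigen f hf σ k) l
    simp only [Jackson.pr]
    rw [this, Jackson.f_one hn _ (hf 1), Jackson.coeff_pow]
    ring
  rw [← hR]
  simp only [Jackson.eval_f h2 _ _ (hf _)]
  rw [← Finset.sum_filter, Finset.sum_const]
  rw [Finset.card_eq_sum_card_fiberwise (f := Jackson.pr)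
    (t := Finset.univ.filter fun τ : Equiv.Perm (Fin n) => τ.cycleType = {n})
    (by intro t ht; simpa using ht)]
  rw [Finset.sum_congr rfl (g := fun _ => Nat.card {t : Fin l → Equiv.Perm (Fin n) //
        (∀ i, (t i).IsSwap) ∧ (List.ofFn t).prod = g})]
  · rw [Finset.sum_const, Equiv.Perm.card_of_cycleType_singleton h2 (by simp)]
    obtain ⟨m, rfl⟩ : ∃ m, n = m + 1 := ⟨n - 1, by omega⟩
    simp [Nat.factorial_succ]
    ring
  · intro τ hτ
    simp only [Finset.mem_filter, Finset.mem_univ, true_and] at hτ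
    rw [Jackson.card_eq, ← Jackson.card_conj g τ
      (Equiv.Perm.isConj_iff_cycleType_eq.2 (hgt.trans hτ.symm)), Finset.filter_filter]
    congr 1
    ext t
    simp only [Finset.mem_filter, Finset.mem_univ, true_and]
    constructor
    · exact fun h => h.2
    · intro h; exact ⟨h ▸ hτ, h⟩
end
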